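/- Let f : [-π,π]² → [0,∞) be integrable and even, and suppose that the essential infimum of (x,y) ↦ f(x,y) + f(y,x) over [-π,π]² is strictly positive. Let (G_{i,j} : i,j ∈ ℤ) be a centered stationary Gaussian process with spectral density f, and for N ≥ 1 let Ḡ_N be the N×N real symmetric random matrix with entries Ḡ_N(i,j) = (G_{i,j} + G_{j,i})/√N for 1 ≤ i,j ≤ N. Then there exists a probability measure ν on ℝ which is absolutely continuous with respect to Lebesgue measure such that the empirical spectral distribution of Ḡ_N converges weakly in probability to ν as N → ∞, i.e., for every bounded continuous φ : ℝ → ℝ, the random variables ∫ φ d(ESD(Ḡ_N)) converge in probability to ∫ φ dν. -/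

import Mathlib

open MeasureTheory Real Filter

/-- The empirical spectral distribution of an `N × N` real matrix: the uniform probability
measure on the (real) roots of its characteristic polynomial, counted with multiplicity.
For a real symmetric matrix these roots are exactly the eigenvalues `λ_1 ≤ … ≤ λ_N`
counted with multiplicity, so this is `(1/N) ∑_{j=1}^N δ_{λ_j}`. -/
noncomputable def ESD {N : ℕ} (M : Matrix (Fin N) (Fin N) ℝ) : Measure ℝ :=
  (N : ENNReal)⁻¹ • (M.charpoly.roots.map Measure.dirac).sum

/-- The resolvent `(A - z)⁻¹` of a real matrix at a complex number. -/
noncomputable def matResolvent {n : Type*} [Fintype n] [DecidableEq n]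
    (A : Matrix n n ℝ) (z : ℂ) : Matrix n n ℂ :=
  (A.map Complex.ofReal - z • 1)⁻¹

section MatResolvent

open scoped Matrix.Norms.L2Operator

variable {n : Type*} [Fintype n] [DecidableEq n]

lemma ofReal_sub_ne_zero_of_im_pos (x : ℝ) {z : ℂ} (hz : 0 < z.im) : (x : ℂ) - z ≠ 0 := by
  intro h
  have := congrArg Complex.im h
  simp at this
  exact hz.ne' this

lemma matResolvent_diagonalization {A : Matrix n n ℝ} (hA : A.IsHermitian) {z : ℂ}
    (hz : 0 < z.im) :
    ∃ U ∈ Matrix.unitaryGroup n ℂ,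
      (A.map Complex.ofReal - z • 1) =
        U * Matrix.diagonal (fun i => (hA.eigenvalues i : ℂ) - z) * star U ∧
      matResolvent A z =
        U * Matrix.diagonal (fun i => ((hA.eigenvalues i : ℂ) - z)⁻¹) * star U := by
  set O : Matrix n n ℝ := (hA.eigenvectorUnitary : Matrix n n ℝ) with hO
  set U : Matrix n n ℂ := O.map Complex.ofReal with hU
  have hstar : star U = (star O).map Complex.ofReal := by
    ext i j
    simp [hU, Matrix.star_apply]
  have h1 : U * star U = 1 := by
    rw [hstar, hU]
    have : O * star O = 1 := Matrix.mem_unitaryGroup_iff.1 hA.eigenvectorUnitary.2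
    have h2 := congrArg (fun M : Matrix n n ℝ => M.map Complex.ofRealHom) this
    simp only [Matrix.map_mul] at h2
    refine h2.trans ?_
    simp
  have h2 : star U * U = 1 := mul_eq_one_comm.1 h1
  have hAeq : A = O * Matrix.diagonal hA.eigenvalues * star O := by
    have := hA.spectral_theorem
    rw [Unitary.conjStarAlgAut_apply] at this
    simpa [Function.comp_def] using this
  have hAm : A.map Complex.ofReal =
      U * Matrix.diagonal (fun i => (hA.eigenvalues i : ℂ)) * star U := by
    have h3 := congrArg (fun M : Matrix n n ℝ => M.map Complex.ofRealHom) hAeq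
    simp only [Matrix.map_mul] at h3
    rw [hstar, hU]
    rw [Matrix.diagonal_map (by simp)] at h3
    exact h3
  have hsub : (A.map Complex.ofReal - z • 1) =
      U * Matrix.diagonal (fun i => (hA.eigenvalues i : ℂ) - z) * star U := by
    rw [hAm]
    have : Matrix.diagonal (fun i => (hA.eigenvalues i : ℂ) - z) =
        Matrix.diagonal (fun i => (hA.eigenvalues i : ℂ)) - z • (1 : Matrix n n ℂ) := by
      rw [← Matrix.diagonal_one, ← Matrix.diagonal_smul, Matrix.diagonal_sub]
      simp
    rw [this, mul_sub, sub_mul]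
    simp [h1]
  refine ⟨U, Matrix.mem_unitaryGroup_iff.2 h1, hsub, ?_⟩
  rw [matResolvent, hsub]
  apply Matrix.inv_eq_right_inv
  calc U * Matrix.diagonal (fun i => (hA.eigenvalues i : ℂ) - z) * star U *
        (U * Matrix.diagonal (fun i => ((hA.eigenvalues i : ℂ) - z)⁻¹) * star U)
      = U * (Matrix.diagonal (fun i => (hA.eigenvalues i : ℂ) - z) * (star U * U) *
        Matrix.diagonal (fun i => ((hA.eigenvalues i : ℂ) - z)⁻¹)) * star U := by
        simp only [mul_assoc]
    _ = 1 := by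
        rw [h2, mul_one, Matrix.diagonal_mul_diagonal]
        have : (fun i => ((hA.eigenvalues i : ℂ) - z) * ((hA.eigenvalues i : ℂ) - z)⁻¹) =
            fun _ => 1 := by
          funext i
          exact mul_inv_cancel₀ (ofReal_sub_ne_zero_of_im_pos _ hz)
        rw [this, Matrix.diagonal_one, mul_one, h1]

lemma isUnit_det_sub {A : Matrix n n ℝ} (hA : A.IsHermitian) {z : ℂ} (hz : 0 < z.im) :
    IsUnit (A.map Complex.ofReal - z • 1).det := by
  obtain ⟨U, hU, h, -⟩ := matResolvent_diagonalization hA hz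
  have h1 := Matrix.mem_unitaryGroup_iff.1 hU
  rw [h, Matrix.det_mul_right_comm, h1, one_mul, Matrix.det_diagonal, isUnit_iff_ne_zero,
    Finset.prod_ne_zero_iff]
  exact fun i _ => ofReal_sub_ne_zero_of_im_pos _ hz

lemma mul_matResolvent {A : Matrix n n ℝ} (hA : A.IsHermitian) {z : ℂ} (hz : 0 < z.im) :
    (A.map Complex.ofReal - z • 1) * matResolvent A z = 1 :=
  Matrix.mul_nonsing_inv _ (isUnit_det_sub hA hz)

lemma matResolvent_mul {A : Matrix n n ℝ} (hA : A.IsHermitian) {z : ℂ} (hz : 0 < z.im) :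
    matResolvent A z * (A.map Complex.ofReal - z • 1) = 1 :=
  Matrix.nonsing_inv_mul _ (isUnit_det_sub hA hz)

lemma norm_inv_ofReal_sub_le (x : ℝ) {z : ℂ} (hz : 0 < z.im) :
    ‖((x : ℂ) - z)⁻¹‖ ≤ z.im⁻¹ := by
  rw [norm_inv]
  apply inv_anti₀ hz
  calc z.im = |((x : ℂ) - z).im| := by simp [abs_of_pos hz]
    _ ≤ _ := Complex.abs_im_le_norm _

lemma norm_matResolvent_le {A : Matrix n n ℝ} (hA : A.IsHermitian) {z : ℂ} (hz : 0 < z.im) :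
    ‖matResolvent A z‖ ≤ z.im⁻¹ := by
  obtain ⟨U, hU, -, h⟩ := matResolvent_diagonalization hA hz
  rw [h, CStarRing.norm_mul_mem_unitary _ (Unitary.star_mem hU),
    CStarRing.norm_mem_unitary_mul _ hU, Matrix.l2_opNorm_diagonal,
    pi_norm_le_iff_of_nonneg (inv_nonneg.2 hz.le)]
  exact fun i => norm_inv_ofReal_sub_le _ hz

lemma trace_matResolvent {A : Matrix n n ℝ} (hA : A.IsHermitian) {z : ℂ} (hz : 0 < z.im) :
    (matResolvent A z).trace = ∑ i, ((hA.eigenvalues i : ℂ) - z)⁻¹ := by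
  obtain ⟨U, hU, -, h⟩ := matResolvent_diagonalization hA hz
  rw [h, Matrix.trace_mul_cycle, Matrix.mem_unitaryGroup_iff'.1 hU, one_mul,
    Matrix.trace_diagonal]

lemma im_matResolvent_nonneg {A : Matrix n n ℝ} (hA : A.IsHermitian) {z : ℂ} (hz : 0 < z.im)
    (v : n → ℂ) : 0 ≤ (star v ⬝ᵥ (matResolvent A z).mulVec v).im := by
  obtain ⟨U, hU, -, h⟩ := matResolvent_diagonalization hA hz
  have : star v ⬝ᵥ (matResolvent A z).mulVec v =
      ∑ i, ((hA.eigenvalues i : ℂ) - z)⁻¹ * (‖(star U).mulVec v i‖ ^ 2 : ℝ) := by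
    rw [h, ← Matrix.mulVec_mulVec, ← Matrix.mulVec_mulVec, Matrix.dotProduct_mulVec]
    have h2 : Matrix.vecMul (star v) U = star ((star U).mulVec v) := by
      rw [Matrix.star_mulVec]
      simp [Matrix.star_eq_conjTranspose]
    rw [h2, dotProduct]
    refine Finset.sum_congr rfl fun i _ => ?_
    rw [Matrix.mulVec_diagonal, Pi.star_apply]
    have : star ((star U).mulVec v i) * (star U).mulVec v i =
      ((‖(star U).mulVec v i‖ ^ 2 : ℝ) : ℂ) := by
      rw [Complex.star_def, Complex.conj_mul']
      simp
    rw [← this]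
    ring
  rw [this, Complex.im_sum]
  refine Finset.sum_nonneg fun i _ => ?_
  rw [Complex.im_mul_ofReal]
  refine mul_nonneg ?_ (sq_nonneg _)
  rw [Complex.inv_im]
  simp only [Complex.sub_im, Complex.ofReal_im, zero_sub, neg_neg]
  exact div_nonneg hz.le (Complex.normSq_nonneg _)

/-- The resolvent identity for a perturbation of the matrix. -/
lemma matResolvent_sub {A B : Matrix n n ℝ} (hA : A.IsHermitian) (hB : B.IsHermitian) {z : ℂ}
    (hz : 0 < z.im) :
    matResolvent B z - matResolvent A z =
      -(matResolvent B z * (B - A).map Complex.ofReal * matResolvent A z) := by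
  have h : (B - A).map Complex.ofReal =
      (B.map Complex.ofReal - z • 1) - (A.map Complex.ofReal - z • 1) := by
    ext i j
    simp
  rw [h, mul_sub, sub_mul, matResolvent_mul hB hz, mul_assoc (matResolvent B z),
    mul_matResolvent hA hz]
  simp

lemma norm_entry_le_l2_opNorm (M : Matrix n n ℂ) (i j : n) : ‖M i j‖ ≤ ‖M‖ := by
  have h := Matrix.l2_opNorm_mulVec M (EuclideanSpace.single j 1)
  have h2 := PiLp.norm_apply_le (WithLp.toLp 2 (M.mulVec (EuclideanSpace.single j (1 : ℂ)).ofLp)) i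
  simp at h h2
  exact h2.trans h

lemma sum_norm_sq_le_card_mul (M : Matrix n n ℂ) :
    ∑ i, ∑ j, ‖M i j‖ ^ 2 ≤ Fintype.card n * ‖M‖ ^ 2 := by
  rw [Finset.sum_comm]
  have : ∀ j, ∑ i, ‖M i j‖ ^ 2 ≤ ‖M‖ ^ 2 := by
    intro j
    have h := Matrix.l2_opNorm_mulVec M (EuclideanSpace.single j 1)
    have h3 := pow_le_pow_left₀ (norm_nonneg _) h 2
    rw [EuclideanSpace.norm_sq_eq] at h3
    simpa using h3
  calc _ ≤ ∑ _j : n, ‖M‖ ^ 2 := Finset.sum_le_sum fun j _ => this j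
    _ = _ := by simp

lemma norm_trace_mul_le (P Q : Matrix n n ℂ) :
    ‖(P * Q).trace‖ ≤ √(∑ i, ∑ j, ‖P i j‖ ^ 2) * (√(Fintype.card n) * ‖Q‖) := by
  have h1 : ‖(P * Q).trace‖ ≤ ∑ x : n × n, ‖P x.1 x.2‖ * ‖Q x.2 x.1‖ := by
    rw [Fintype.sum_prod_type, Matrix.trace]
    refine (norm_sum_le _ _).trans (Finset.sum_le_sum fun i _ => ?_)
    rw [Matrix.diag_apply, Matrix.mul_apply]
    exact (norm_sum_le _ _).trans (Finset.sum_le_sum fun j _ => (norm_mul _ _).le)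
  refine h1.trans ((Real.sum_mul_le_sqrt_mul_sqrt _ _ _).trans ?_)
  rw [Fintype.sum_prod_type, Fintype.sum_prod_type]
  gcongr
  rw [← Real.sqrt_sq (norm_nonneg Q), ← Real.sqrt_mul (by positivity)]
  apply Real.sqrt_le_sqrt
  rw [Finset.sum_comm]
  exact sum_norm_sq_le_card_mul Q

lemma norm_trace_matResolvent_sub_le {A B : Matrix n n ℝ} (hA : A.IsHermitian)
    (hB : B.IsHermitian) {z : ℂ} (hz : 0 < z.im) :
    ‖(matResolvent B z).trace - (matResolvent A z).trace‖ ≤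
      √(∑ i, ∑ j, (B i j - A i j) ^ 2) * (√(Fintype.card n) * z.im⁻¹ ^ 2) := by
  rw [← Matrix.trace_sub, matResolvent_sub hA hB hz, Matrix.trace_neg, norm_neg, mul_assoc,
    Matrix.trace_mul_comm, mul_assoc]
  refine (norm_trace_mul_le _ _).trans ?_
  have h1 : ‖matResolvent A z * matResolvent B z‖ ≤ z.im⁻¹ ^ 2 := by
    refine (norm_mul_le _ _).trans ?_
    rw [sq]
    gcongr
    · exact norm_matResolvent_le hA hz
    · exact norm_matResolvent_le hB hz
  have h2 : ∀ i j, ‖(B - A).map Complex.ofReal i j‖ ^ 2 = (B i j - A i j) ^ 2 := fun i j => by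
    rw [Matrix.map_apply, Complex.norm_real, Real.norm_eq_abs, sq_abs, Matrix.sub_apply]
  simp only [h2]
  gcongr

end MatResolvent

lemma integral_ESD {N : ℕ} {A : Matrix (Fin N) (Fin N) ℝ} (hA : A.IsHermitian)
    {E : Type*} [NormedAddCommGroup E] [NormedSpace ℝ E] [CompleteSpace E] (g : ℝ → E) :
    ∫ x, g x ∂(ESD A) = (N : ℝ)⁻¹ • ∑ i, g (hA.eigenvalues i) := by
  have h : (A.charpoly.roots.map Measure.dirac).sum =
      ∑ i, Measure.dirac (hA.eigenvalues i) := by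
    rw [hA.roots_charpoly_eq_eigenvalues, Multiset.map_map]
    rfl
  rw [ESD, h, integral_smul_measure, integral_finsetSum_measure]
  · simp
  · intro i _
    exact integrable_dirac (by simp)

lemma isProbabilityMeasure_ESD {N : ℕ} [NeZero N] {A : Matrix (Fin N) (Fin N) ℝ}
    (hA : A.IsHermitian) : IsProbabilityMeasure (ESD A) := by
  have h : (A.charpoly.roots.map Measure.dirac).sum =
      ∑ i, Measure.dirac (hA.eigenvalues i) := by
    rw [hA.roots_charpoly_eq_eigenvalues, Multiset.map_map]
    rfl
  constructor
  rw [ESD, h]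
  simp [ENNReal.inv_mul_cancel, NeZero.ne N]

/-- The Poisson integral of `φ` at height `η`. -/
noncomputable def poissonSmooth (φ : ℝ → ℝ) (η x : ℝ) : ℝ :=
  π⁻¹ * ∫ E, φ E * (((x : ℂ) - (E + η * Complex.I))⁻¹).im

section Poisson

open scoped Topology

lemma im_inv_sub_eq (x E η : ℝ) :
    (((x : ℂ) - (E + η * Complex.I))⁻¹).im = η / ((x - E) ^ 2 + η ^ 2) := by
  rw [Complex.inv_im, Complex.normSq_apply]
  simp
  ring

lemma poissonSmooth_eq {φ : ℝ → ℝ} {η : ℝ} (hη : 0 < η) (x : ℝ) :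
    poissonSmooth φ η x = ∫ s, φ (x + η * s) * (π⁻¹ * (1 + s ^ 2)⁻¹) := by
  have h := Measure.integral_comp_mul_left
    (fun E => φ (x + E) * (((x : ℂ) - ((x + E : ℝ) + η * Complex.I))⁻¹).im) η
  have h2 := integral_add_left_eq_self (μ := (volume : Measure ℝ))
    (fun E => φ E * (((x : ℂ) - ((E : ℝ) + η * Complex.I))⁻¹).im) x
  rw [h2] at h
  rw [poissonSmooth]
  have h3 : ∫ E, φ E * (((x : ℂ) - (E + η * Complex.I))⁻¹).im =
      η * ∫ s, φ (x + η * s) * (((x : ℂ) - ((x + η * s : ℝ) + η * Complex.I))⁻¹).im := by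
    rw [h, abs_of_pos (inv_pos.2 hη), smul_eq_mul, mul_inv_cancel_left₀ hη.ne']
  rw [h3, ← integral_const_mul, ← integral_const_mul]
  congr 1
  funext s
  rw [im_inv_sub_eq]
  field_simp
  ring

lemma integral_cauchyKernel : ∫ s : ℝ, π⁻¹ * (1 + s ^ 2)⁻¹ = 1 := by
  rw [integral_const_mul, integral_univ_inv_one_add_sq, inv_mul_cancel₀ Real.pi_ne_zero]

lemma integrable_cauchyKernel : Integrable fun s : ℝ => π⁻¹ * (1 + s ^ 2)⁻¹ :=
  integrable_inv_one_add_sq.const_mul _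

lemma cauchyKernel_nonneg (s : ℝ) : 0 ≤ π⁻¹ * (1 + s ^ 2)⁻¹ := by positivity

lemma exists_poissonSmooth_near {φ : ℝ → ℝ} (hc : Continuous φ) (hs : HasCompactSupport φ)
    {ε : ℝ} (hε : 0 < ε) : ∃ η > 0, ∀ x, |poissonSmooth φ η x - φ x| ≤ ε := by
  obtain ⟨B, hB⟩ := hs.exists_bound_of_continuous hc
  have hB0 : 0 ≤ B := (norm_nonneg _).trans (hB 0)
  have huc : UniformContinuous φ := hs.uniformContinuous_of_continuous hc
  obtain ⟨δ, hδ, hδφ⟩ := Metric.uniformContinuous_iff.1 huc (ε / 2) (half_pos hε)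
  have hlim : Tendsto (fun η : ℝ => ∫ s : ℝ,
      Set.indicator {s : ℝ | δ ≤ η * |s|} (fun s => π⁻¹ * (1 + s ^ 2)⁻¹) s) (𝓝[>] 0)
      (𝓝 (∫ _s : ℝ, (0 : ℝ))) := by
    refine tendsto_integral_filter_of_dominated_convergence
      (fun s => π⁻¹ * (1 + s ^ 2)⁻¹) ?_ ?_ integrable_cauchyKernel ?_
    · refine Eventually.of_forall fun η => ?_
      refine integrable_cauchyKernel.aestronglyMeasurable.indicator ?_
      exact measurableSet_le measurable_const (by fun_prop)
    · refine Eventually.of_forall fun η => Eventually.of_forall fun s => ?_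
      refine (norm_indicator_le_norm_self _ _).trans ?_
      rw [Real.norm_of_nonneg (cauchyKernel_nonneg s)]
    · refine Eventually.of_forall fun s => ?_
      have h1 : Tendsto (fun η : ℝ => η * |s|) (𝓝[>] 0) (𝓝 0) := by
        have : Tendsto (fun η : ℝ => η * |s|) (𝓝 0) (𝓝 (0 * |s|)) :=
          (continuous_id.mul continuous_const).tendsto 0
        rw [zero_mul] at this
        exact this.mono_left nhdsWithin_le_nhds
      refine tendsto_const_nhds.congr' ?_
      filter_upwards [h1.eventually (gt_mem_nhds hδ)] with η hη
      rw [Set.indicator_of_notMem]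
      simpa using hη
  rw [integral_zero] at hlim
  have h2 : 0 < ε / 2 / (2 * B + 1) := by positivity
  obtain ⟨η, hη1, hη2⟩ := ((hlim.eventually (gt_mem_nhds h2)).and self_mem_nhdsWithin).exists
  have hη0 : 0 < η := hη2
  refine ⟨η, hη0, fun x => ?_⟩
  rw [poissonSmooth_eq hη0]
  have hφint : Integrable fun s => φ (x + η * s) * (π⁻¹ * (1 + s ^ 2)⁻¹) := by
    refine integrable_cauchyKernel.bdd_mul (c := B) ?_ ?_
    · exact (hc.comp (by fun_prop)).aestronglyMeasurable
    · exact Eventually.of_forall fun s => hB _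
  have hφx : φ x = ∫ s : ℝ, φ x * (π⁻¹ * (1 + s ^ 2)⁻¹) := by
    rw [integral_const_mul, integral_cauchyKernel, mul_one]
  have hφint2 : Integrable fun s : ℝ => φ x * (π⁻¹ * (1 + s ^ 2)⁻¹) :=
    integrable_cauchyKernel.const_mul _
  rw [hφx, ← integral_sub hφint hφint2, ← Real.norm_eq_abs]
  have hSm : MeasurableSet {s : ℝ | δ ≤ η * |s|} :=
    measurableSet_le measurable_const (by fun_prop)
  have hint3 : Integrable fun s : ℝ => ε / 2 * (π⁻¹ * (1 + s ^ 2)⁻¹) + 2 * B *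
      Set.indicator {s : ℝ | δ ≤ η * |s|} (fun s => π⁻¹ * (1 + s ^ 2)⁻¹) s :=
    (integrable_cauchyKernel.const_mul _).add ((integrable_cauchyKernel.indicator hSm).const_mul _)
  refine (norm_integral_le_of_norm_le hint3 (Eventually.of_forall fun s => ?_)).trans ?_
  · rw [← sub_mul, norm_mul, Real.norm_of_nonneg (cauchyKernel_nonneg s)]
    by_cases hsd : δ ≤ η * |s|
    · rw [Set.indicator_of_mem (by exact hsd), ← add_mul]
      refine mul_le_mul_of_nonneg_right ?_ (cauchyKernel_nonneg s)
      have := norm_sub_le (φ (x + η * s)) (φ x)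
      have h4 := hB (x + η * s)
      have h5 := hB x
      linarith
    · rw [Set.indicator_of_notMem (by exact hsd), mul_zero, add_zero]
      refine mul_le_mul_of_nonneg_right ?_ (cauchyKernel_nonneg s)
      rw [← dist_eq_norm]
      refine (hδφ ?_).le
      rw [Real.dist_eq, add_sub_cancel_left, abs_mul, abs_of_pos hη0]
      exact not_le.1 hsd
  · rw [integral_add (integrable_cauchyKernel.const_mul _)
      ((integrable_cauchyKernel.indicator hSm).const_mul _), integral_const_mul (ε / 2),
      integral_const_mul (2 * B), integral_cauchyKernel]
    rw [lt_div_iff₀ (by positivity)] at hη1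
    have h6 : 0 ≤ ∫ s : ℝ,
        Set.indicator {s : ℝ | δ ≤ η * |s|} (fun s => π⁻¹ * (1 + s ^ 2)⁻¹) s :=
      integral_nonneg fun s => Set.indicator_nonneg (fun s _ => cauchyKernel_nonneg s) s
    nlinarith

lemma integrable_mul_im_inv {φ : ℝ → ℝ} (hφ : Integrable φ) (x : ℝ) {η : ℝ} (hη : 0 < η) :
    Integrable fun E : ℝ => φ E * (((x : ℂ) - (E + η * Complex.I))⁻¹).im := by
  refine hφ.mul_bdd (c := η⁻¹) ?_ (Eventually.of_forall fun E => ?_)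
  · simp only [im_inv_sub_eq]
    exact Measurable.aestronglyMeasurable (by fun_prop)
  · refine (Complex.abs_im_le_norm _).trans ?_
    simpa using norm_inv_ofReal_sub_le x (z := E + η * Complex.I) (by simpa using hη)

lemma integral_poissonSmooth_ESD {N : ℕ} {A : Matrix (Fin N) (Fin N) ℝ} (hA : A.IsHermitian)
    {φ : ℝ → ℝ} (hφ : Integrable φ) {η : ℝ} (hη : 0 < η) :
    ∫ x, poissonSmooth φ η x ∂(ESD A) =
      π⁻¹ * ∫ E, φ E * ((N : ℂ)⁻¹ * (matResolvent A (E + η * Complex.I)).trace).im := by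
  rw [integral_ESD hA, smul_eq_mul]
  simp only [poissonSmooth]
  rw [← Finset.mul_sum, ← integral_finsetSum _ fun i _ => integrable_mul_im_inv hφ _ hη,
    mul_left_comm, ← integral_const_mul]
  congr 2
  funext E
  rw [trace_matResolvent hA (by simpa using hη), ← Finset.mul_sum, mul_left_comm]
  congr 1
  rw [← Complex.ofReal_natCast, ← Complex.ofReal_inv, Complex.im_ofReal_mul, Complex.im_sum]

end Poisson

section ResolventTrace

variable {n : Type*} [Fintype n] [DecidableEq n]

lemma measurable_det_of_entries {α : Type*} [MeasurableSpace α] {B : α → Matrix n n ℂ}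
    (h : ∀ i j, Measurable fun a => B a i j) : Measurable fun a => (B a).det := by
  simp only [Matrix.det_apply]
  refine Finset.measurable_sum _ fun σ _ => ?_
  exact (Finset.measurable_prod _ fun i _ => h _ _).const_smul _

lemma measurable_matResolvent_apply {α : Type*} [MeasurableSpace α] {A : α → Matrix n n ℝ}
    (h : ∀ i j, Measurable fun a => A a i j) {z : α → ℂ} (hz : Measurable z) (i j : n) :
    Measurable fun a => matResolvent (A a) (z a) i j := by
  have hB : ∀ i j, Measurable fun a => ((A a).map Complex.ofReal - z a • 1) i j := by
    intro i j
    simp only [Matrix.sub_apply, Matrix.map_apply, Matrix.smul_apply, smul_eq_mul]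
    exact (Complex.measurable_ofReal.comp (h i j)).sub (hz.mul measurable_const)
  simp only [matResolvent, Matrix.inv_def, Matrix.smul_apply, smul_eq_mul, Ring.inverse_eq_inv',
    Matrix.adjugate_apply]
  refine (measurable_det_of_entries hB).inv.mul (measurable_det_of_entries fun k l => ?_)
  simp only [Matrix.updateRow_apply]
  split_ifs
  · exact measurable_const
  · exact hB k l

lemma measurable_trace_matResolvent {α : Type*} [MeasurableSpace α] {A : α → Matrix n n ℝ}
    (h : ∀ i j, Measurable fun a => A a i j) {z : α → ℂ} (hz : Measurable z) :
    Measurable fun a => (matResolvent (A a) (z a)).trace :=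
  Finset.measurable_sum _ fun i _ => measurable_matResolvent_apply h hz i i

lemma norm_trace_matResolvent_le {A : Matrix n n ℝ} (hA : A.IsHermitian) {z : ℂ}
    (hz : 0 < z.im) : ‖(matResolvent A z).trace‖ ≤ Fintype.card n * z.im⁻¹ := by
  rw [trace_matResolvent hA hz]
  refine (norm_sum_le _ _).trans ((Finset.sum_le_sum fun i _ => norm_inv_ofReal_sub_le _ hz).trans ?_)
  simp

lemma norm_normalized_trace_le {N : ℕ} {A : Matrix (Fin N) (Fin N) ℝ} (hA : A.IsHermitian)
    {z : ℂ} (hz : 0 < z.im) : ‖(N : ℂ)⁻¹ * (matResolvent A z).trace‖ ≤ z.im⁻¹ := by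
  rcases Nat.eq_zero_or_pos N with rfl | hN
  · simp [hz.le]
  · have h := norm_trace_matResolvent_le hA hz
    rw [Fintype.card_fin] at h
    have hN' : (0 : ℝ) < N := by exact_mod_cast hN
    rw [norm_mul, norm_inv, Complex.norm_natCast]
    calc (N : ℝ)⁻¹ * ‖(matResolvent A z).trace‖ ≤ (N : ℝ)⁻¹ * (N * z.im⁻¹) := by gcongr
      _ = z.im⁻¹ := by rw [inv_mul_cancel_left₀ hN'.ne']

lemma integral_sq_ESD {N : ℕ} {A : Matrix (Fin N) (Fin N) ℝ} (hA : A.IsHermitian) :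
    ∫ x, x ^ 2 ∂(ESD A) = (N : ℝ)⁻¹ * ∑ i, ∑ j, A i j ^ 2 := by
  rw [integral_ESD hA, smul_eq_mul]
  congr 1
  have h1 : (A * A).trace = ∑ i, ∑ j, A i j ^ 2 := by
    simp only [Matrix.trace, Matrix.diag_apply, Matrix.mul_apply]
    refine Finset.sum_congr rfl fun i _ => Finset.sum_congr rfl fun j _ => ?_
    have : A j i = A i j := by simpa using hA.apply i j
    rw [this, sq]
  have hO := Matrix.mem_unitaryGroup_iff'.1 hA.eigenvectorUnitary.2
  have hAeq : A = (hA.eigenvectorUnitary : Matrix (Fin N) (Fin N) ℝ) *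
      Matrix.diagonal hA.eigenvalues *
      star (hA.eigenvectorUnitary : Matrix (Fin N) (Fin N) ℝ) := by
    have := hA.spectral_theorem
    rw [Unitary.conjStarAlgAut_apply] at this
    simpa [Function.comp_def] using this
  set O : Matrix (Fin N) (Fin N) ℝ := (hA.eigenvectorUnitary : Matrix (Fin N) (Fin N) ℝ)
  have h2 : A * A = O * (Matrix.diagonal hA.eigenvalues * Matrix.diagonal hA.eigenvalues) *
      star O := by
    calc A * A = (O * Matrix.diagonal hA.eigenvalues * star O) *
        (O * Matrix.diagonal hA.eigenvalues * star O) := by rw [← hAeq]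
      _ = O * Matrix.diagonal hA.eigenvalues * (star O * O) *
        (Matrix.diagonal hA.eigenvalues * star O) := by simp only [mul_assoc]
      _ = _ := by rw [hO]; simp only [mul_assoc, mul_one]
  rw [← h1, h2, Matrix.trace_mul_cycle, hO, one_mul, Matrix.diagonal_mul_diagonal,
    Matrix.trace_diagonal]
  simp [sq]

end ResolventTrace

/-- A trapezoidal cutoff equal to `1` on `[-R, R]`. -/
noncomputable def trapezoid (R : ℝ) (x : ℝ) : ℝ := max 0 (min 1 (2 - |x| / R))

section Trapezoid

lemma continuous_trapezoid (R : ℝ) : Continuous (trapezoid R) := by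
  unfold trapezoid
  fun_prop

lemma trapezoid_nonneg (R x : ℝ) : 0 ≤ trapezoid R x := le_max_left _ _

lemma trapezoid_le_one (R x : ℝ) : trapezoid R x ≤ 1 :=
  max_le zero_le_one (min_le_left _ _)

lemma hasCompactSupport_trapezoid {R : ℝ} (hR : 0 < R) : HasCompactSupport (trapezoid R) := by
  refine HasCompactSupport.intro (isCompact_Icc (a := -(2 * R)) (b := 2 * R)) fun x hx => ?_
  have : 2 * R < |x| := by
    by_contra! h
    exact hx (abs_le.1 h)
  have h2 : 2 - |x| / R ≤ 0 := by
    rw [sub_nonpos, le_div_iff₀ hR]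
    exact this.le
  exact max_eq_left ((min_le_right _ _).trans h2)

lemma one_sub_trapezoid_le {R : ℝ} (hR : 0 < R) (x : ℝ) :
    1 - trapezoid R x ≤ (R ^ 2)⁻¹ * x ^ 2 := by
  by_cases h : |x| ≤ R
  · have h1 : 1 ≤ 2 - |x| / R := by
      have := (div_le_one hR).2 h
      linarith
    have : trapezoid R x = 1 := by
      rw [trapezoid, min_eq_left h1, max_eq_right zero_le_one]
    rw [this]
    simp only [sub_self]
    positivity
  · have h2 : R ^ 2 ≤ x ^ 2 := by
      rw [← sq_abs x]
      have := not_le.1 h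
      gcongr
    have h3 : 1 ≤ (R ^ 2)⁻¹ * x ^ 2 := by
      rw [inv_mul_eq_div, one_le_div (by positivity)]
      exact h2
    linarith [trapezoid_nonneg R x]

end Trapezoid

section LimitFunctional

open scoped Topology

variable {Ω : Type*} [MeasurableSpace Ω] {P : Measure Ω} [IsProbabilityMeasure P]
  {A : (N : ℕ) → Ω → Matrix (Fin N) (Fin N) ℝ}

lemma measurable_integral_poissonSmooth_ESD (hA : ∀ N ω, (A N ω).IsHermitian)
    (hmeas : ∀ N i j, Measurable fun ω => A N ω i j) {φ : ℝ → ℝ} (hφm : Measurable φ)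
    (hφ : Integrable φ) {η : ℝ} (hη : 0 < η) (N : ℕ) :
    Measurable fun ω => ∫ x, poissonSmooth φ η x ∂(ESD (A N ω)) := by
  simp only [integral_poissonSmooth_ESD (hA N _) hφ hη]
  refine Measurable.const_mul ?_ _
  have h : Measurable fun p : Ω × ℝ =>
      φ p.2 * ((N : ℂ)⁻¹ * (matResolvent (A N p.1) (p.2 + η * Complex.I)).trace).im := by
    refine (hφm.comp measurable_snd).mul (Complex.measurable_im.comp (Measurable.const_mul ?_ _))
    exact measurable_trace_matResolvent (fun i j => (hmeas N i j).comp measurable_fst)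
      ((Complex.measurable_ofReal.comp measurable_snd).add_const _)
  exact h.stronglyMeasurable.integral_prod_right.measurable

lemma integrable_ESD {N : ℕ} {B : Matrix (Fin N) (Fin N) ℝ} (hB : B.IsHermitian) (g : ℝ → ℝ) :
    Integrable g (ESD B) := by
  have h : (B.charpoly.roots.map Measure.dirac).sum =
      ∑ i, Measure.dirac (hB.eigenvalues i) := by
    rw [hB.roots_charpoly_eq_eigenvalues, Multiset.map_map]
    rfl
  rw [ESD, h]
  rcases Nat.eq_zero_or_pos N with rfl | hN
  · simp
  · refine Integrable.smul_measure ?_ (by simp [hN.ne'])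
    exact integrable_finsetSum_measure.2 fun i _ => integrable_dirac (by simp)

lemma abs_integral_ESD_le {N : ℕ} {B : Matrix (Fin N) (Fin N) ℝ} (hB : B.IsHermitian)
    {g : ℝ → ℝ} {c : ℝ} (hc : 0 ≤ c) (hg : ∀ x, |g x| ≤ c) : |∫ x, g x ∂(ESD B)| ≤ c := by
  rw [integral_ESD hB, smul_eq_mul, abs_mul, abs_inv, Nat.abs_cast]
  rcases Nat.eq_zero_or_pos N with rfl | hN
  · simpa using hc
  have hN' : (0 : ℝ) < N := by exact_mod_cast hN
  rw [inv_mul_le_iff₀ hN']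
  refine (Finset.abs_sum_le_sum_abs _ _).trans ((Finset.sum_le_sum fun i _ => hg _).trans ?_)
  simp

lemma measurable_integral_ESD (hA : ∀ N ω, (A N ω).IsHermitian)
    (hmeas : ∀ N i j, Measurable fun ω => A N ω i j) {φ : ℝ → ℝ} (hc : Continuous φ)
    (hs : HasCompactSupport φ) (N : ℕ) : Measurable fun ω => ∫ x, φ x ∂(ESD (A N ω)) := by
  choose η hη hηφ using fun k : ℕ =>
    exists_poissonSmooth_near hc hs (ε := 1 / ((k : ℝ) + 1)) (by positivity)
  refine measurable_of_tendsto_metrizable (fun k => measurable_integral_poissonSmooth_ESD hA hmeas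
    hc.measurable (hc.integrable_of_hasCompactSupport hs) (hη k) N) ?_
  rw [tendsto_pi_nhds]
  intro ω
  rw [tendsto_iff_norm_sub_tendsto_zero]
  refine squeeze_zero (fun k => norm_nonneg _) (fun k => ?_) tendsto_one_div_add_atTop_nhds_zero_nat
  rw [← integral_sub (integrable_ESD (hA N ω) _) (integrable_ESD (hA N ω) _)]
  exact abs_integral_ESD_le (hA N ω) (by positivity) (hηφ k)

lemma tendsto_integral_poissonSmooth_ESD (hA : ∀ N ω, (A N ω).IsHermitian)
    (hmeas : ∀ N i j, Measurable fun ω => A N ω i j) {M : ℂ → ℂ} {B : ℝ}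
    (hB : ∀ z : ℂ, 0 < z.im → ‖M z‖ ≤ B)
    (hM : ∀ z : ℂ, 0 < z.im → Tendsto (fun N : ℕ =>
      ∫ ω, ‖(N : ℂ)⁻¹ * (matResolvent (A N ω) z).trace - M z‖ ∂P) atTop (𝓝 0))
    {φ : ℝ → ℝ} (hφm : Measurable φ) (hφ : Integrable φ) {η : ℝ} (hη : 0 < η) :
    Tendsto (fun N => ∫ ω, |∫ x, poissonSmooth φ η x ∂(ESD (A N ω)) -
      π⁻¹ * ∫ E, φ E * (M (E + η * Complex.I)).im| ∂P) atTop (𝓝 0) := by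
  have him : ∀ E : ℝ, 0 < ((E : ℂ) + η * Complex.I).im := fun E => by simpa using hη
  have hjoint : ∀ N : ℕ, Measurable fun p : ℝ × Ω =>
      (N : ℂ)⁻¹ * (matResolvent (A N p.2) (p.1 + η * Complex.I)).trace := fun N =>
    (measurable_trace_matResolvent (fun i j => (hmeas N i j).comp measurable_snd)
      ((Complex.measurable_ofReal.comp measurable_fst).add_const _)).const_mul _
  have hmN : ∀ (N : ℕ) (E : ℝ), Integrable (fun ω =>
      (N : ℂ)⁻¹ * (matResolvent (A N ω) (E + η * Complex.I)).trace) P := fun N E =>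
    Integrable.of_bound ((hjoint N).comp measurable_prodMk_left).aestronglyMeasurable η⁻¹
      (Eventually.of_forall fun ω => by simpa using norm_normalized_trace_le (hA N ω) (him E))
  have hMmeas : Measurable fun E : ℝ => M (E + η * Complex.I) := by
    refine measurable_of_tendsto_metrizable (f := fun (N : ℕ) (E : ℝ) =>
      ∫ ω, (N : ℂ)⁻¹ * (matResolvent (A N ω) (E + η * Complex.I)).trace ∂P)
      (fun N => (hjoint N).stronglyMeasurable.integral_prod_right.measurable) ?_
    rw [tendsto_pi_nhds]
    intro E
    rw [tendsto_iff_norm_sub_tendsto_zero]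
    refine squeeze_zero (fun k => norm_nonneg _) (fun k => ?_) (hM _ (him E))
    have : M (E + η * Complex.I) = ∫ _ω, M (E + η * Complex.I) ∂P := by simp
    conv_lhs => rw [this]
    rw [← integral_sub (hmN k E) (integrable_const _)]
    exact norm_integral_le_integral_norm _
  have hB0 : 0 ≤ B := (norm_nonneg _).trans (hB Complex.I (by simp))
  have hφM : Integrable fun E : ℝ => φ E * (M (E + η * Complex.I)).im :=
    hφ.mul_bdd (c := B) (Complex.measurable_im.comp hMmeas).aestronglyMeasurable
      (Eventually.of_forall fun E => (Complex.abs_im_le_norm _).trans (hB _ (him E)))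
  have hφN : ∀ (N : ℕ) ω, Integrable fun E : ℝ =>
      φ E * ((N : ℂ)⁻¹ * (matResolvent (A N ω) (E + η * Complex.I)).trace).im := fun N ω =>
    hφ.mul_bdd (c := η⁻¹) (Complex.measurable_im.comp
        ((hjoint N).comp measurable_prodMk_right)).aestronglyMeasurable
      (Eventually.of_forall fun E => (Complex.abs_im_le_norm _).trans
        (by simpa using norm_normalized_trace_le (hA N ω) (him E)))
  set D : ℕ → ℝ → Ω → ℝ := fun N E ω => |φ E| *
    ‖(N : ℂ)⁻¹ * (matResolvent (A N ω) (E + η * Complex.I)).trace - M (E + η * Complex.I)‖ with hD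
  have hDb : ∀ N E ω, ‖D N E ω‖ ≤ |φ E| * (η⁻¹ + B) := by
    intro N E ω
    simp only [hD]
    rw [Real.norm_of_nonneg (by positivity)]
    refine mul_le_mul_of_nonneg_left ?_ (abs_nonneg _)
    refine (norm_sub_le _ _).trans (add_le_add ?_ (hB _ (him E)))
    simpa using norm_normalized_trace_le (hA N ω) (him E)
  have hDm : ∀ N, Measurable (Function.uncurry (D N)) := fun N =>
    ((continuous_abs.measurable.comp hφm).comp measurable_fst).mul
      ((hjoint N).sub (hMmeas.comp measurable_fst)).norm
  have hbi : Integrable fun E : ℝ => |φ E| * (η⁻¹ + B) := hφ.abs.mul_const _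
  have hDi : ∀ N, Integrable (Function.uncurry (D N)) (volume.prod P) := by
    intro N
    refine Integrable.mono' (hbi.mul_prod (integrable_const (1 : ℝ) (μ := P)))
      (hDm N).aestronglyMeasurable (Eventually.of_forall fun p => ?_)
    rw [mul_one]
    exact hDb N p.1 p.2
  have hlim : Tendsto (fun N => ∫ E, ∫ ω, D N E ω ∂P) atTop (𝓝 (∫ _E : ℝ, (0 : ℝ))) := by
    refine tendsto_integral_of_dominated_convergence (fun E => |φ E| * (η⁻¹ + B))
      (fun N => (hDm N).stronglyMeasurable.integral_prod_right.aestronglyMeasurable) hbi ?_ ?_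
    · intro N
      refine Eventually.of_forall fun E => ?_
      refine (norm_integral_le_of_norm_le_const (Eventually.of_forall (hDb N E))).trans ?_
      simp
    · refine Eventually.of_forall fun E => ?_
      simp only [hD, integral_const_mul]
      simpa using (hM _ (him E)).const_mul |φ E|
  rw [integral_zero] at hlim
  refine squeeze_zero (fun N => integral_nonneg fun ω => abs_nonneg _) (fun N => ?_)
    (by simpa using hlim.const_mul π⁻¹)
  rw [integral_integral_swap (hDi N), ← integral_const_mul π⁻¹ (fun ω => ∫ E, D N E ω)]
  refine integral_mono_of_nonneg (Eventually.of_forall fun ω => abs_nonneg _) ?_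
    (Eventually.of_forall fun ω => ?_)
  · exact (hDi N).integral_prod_right.const_mul _
  · dsimp only
    rw [integral_poissonSmooth_ESD (hA N ω) hφ hη, ← mul_sub, ← integral_sub (hφN N ω) hφM, abs_mul,
      abs_of_pos (inv_pos.2 Real.pi_pos)]
    refine mul_le_mul_of_nonneg_left ?_ (inv_pos.2 Real.pi_pos).le
    rw [← Real.norm_eq_abs]
    refine (norm_integral_le_integral_norm _).trans ?_
    refine integral_mono_of_nonneg (Eventually.of_forall fun _ => norm_nonneg _) ?_
      (Eventually.of_forall fun E => ?_)
    · exact hbi.mono' ((hDm N).comp measurable_prodMk_right).aestronglyMeasurable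
        (Eventually.of_forall fun E => hDb N E ω)
    · dsimp only [hD]
      rw [← mul_sub, ← Complex.sub_im, norm_mul, Real.norm_eq_abs]
      refine mul_le_mul_of_nonneg_left ?_ (abs_nonneg _)
      exact Complex.abs_im_le_norm _

end LimitFunctional

section RieszDensity

open scoped Topology CompactlySupported

/-- A positive functional on compactly supported continuous functions that is dominated by a
multiple of the Lebesgue integral and has total mass one is given by an absolutely continuous
probability measure. -/
lemma exists_absolutelyContinuous_of_functional (Λ : C_c(ℝ, ℝ) →ₗ[ℝ] ℝ)
    (hpos : ∀ φ : C_c(ℝ, ℝ), 0 ≤ φ → 0 ≤ Λ φ) {B : ℝ}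
    (hB : ∀ φ : C_c(ℝ, ℝ), 0 ≤ φ → Λ φ ≤ B * ∫ x, φ x)
    (hle : ∀ φ : C_c(ℝ, ℝ), (∀ x, φ x ≤ 1) → Λ φ ≤ 1)
    (hge : ∀ ε > 0, ∃ φ : C_c(ℝ, ℝ), (∀ x, φ x ∈ Set.Icc (0 : ℝ) 1) ∧ 1 - ε ≤ Λ φ) :
    ∃ ν : Measure ℝ, IsProbabilityMeasure ν ∧ ν ≪ volume ∧
      ∀ φ : C_c(ℝ, ℝ), ∫ x, φ x ∂ν = Λ φ := by
  set Λ' := PositiveLinearMap.mk₀ Λ hpos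
  set ν := RealRMK.rieszMeasure Λ' with hν
  have hφint : ∀ φ : C_c(ℝ, ℝ), ∫ x, φ x ∂ν = Λ φ := RealRMK.integral_rieszMeasure Λ'
  have hK1 : ∀ K : Set ℝ, IsCompact K → ∀ V : Set ℝ, IsOpen V → K ⊆ V →
      ∃ f : C_c(ℝ, ℝ), (∀ x, f x ∈ Set.Icc (0 : ℝ) 1) ∧ (∀ x, f x ≤ V.indicator 1 x) ∧
        ν.real K ≤ Λ f := by
    intro K hK V hV hKV
    obtain ⟨f, hf1, hf2, hf3⟩ := exists_continuousMap_one_of_isCompact_subset_isOpen hK hV hKV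
    refine ⟨⟨f, hasCompactSupport_def.mpr hf2⟩, hf3.2, fun x => ?_, ?_⟩
    · by_cases hx : x ∈ V
      · simpa [hx] using (hf3.2 x).2
      · have : f x = 0 := image_eq_zero_of_notMem_tsupport fun h => hx (hf3.1 h)
        simp [hx, this]
    · rw [← hφint, ← integral_indicator_one hK.measurableSet]
      refine integral_mono ?_ (CompactlySupportedContinuousMap.integrable _) fun x => ?_
      · exact (continuousOn_const.integrableOn_compact hK).integrable_indicator hK.measurableSet
      · by_cases hx : x ∈ K
        · simpa [hx] using (hf1 hx).ge
        · simpa [hx] using (hf3.2 x).1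
  have hKle : ∀ K : Set ℝ, IsCompact K → ν K ≤ 1 := by
    intro K hK
    obtain ⟨f, hf1, -, hf3⟩ := hK1 K hK Set.univ isOpen_univ (Set.subset_univ _)
    have : ν.real K ≤ 1 := hf3.trans (hle f fun x => (hf1 x).2)
    rw [← ENNReal.ofReal_toReal hK.measure_lt_top.ne]
    exact ENNReal.ofReal_le_one.2 this
  have huniv : ν Set.univ ≤ 1 := by
    rw [isOpen_univ.measure_eq_iSup_isCompact]
    exact iSup_le fun K => iSup_le fun _ => iSup_le fun hK => hKle K hK
  have : IsFiniteMeasure ν := ⟨huniv.trans_lt ENNReal.one_lt_top⟩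
  refine ⟨ν, ⟨le_antisymm huniv ?_⟩, ?_, hφint⟩
  · have : 1 ≤ ν.real Set.univ := by
      refine le_of_forall_pos_le_add fun ε hε => ?_
      obtain ⟨φ, hφ, h⟩ := hge ε hε
      have h2 : Λ φ ≤ ν.real Set.univ := by
        rw [← hφint]
        calc ∫ x, φ x ∂ν ≤ ∫ _x, (1 : ℝ) ∂ν :=
              integral_mono φ.integrable (integrable_const _) fun x => (hφ x).2
          _ = _ := by simp
      linarith
    rw [← ENNReal.ofReal_toReal (measure_ne_top ν Set.univ)]
    exact ENNReal.one_le_ofReal.2 this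
  · refine Measure.AbsolutelyContinuous.mk fun S hS hS0 => ?_
    rw [hS.measure_eq_iSup_isCompact_of_ne_top (measure_ne_top ν S)]
    simp only [ENNReal.iSup_eq_zero]
    intro K hKS hK
    have hK0 : volume K = 0 := measure_mono_null hKS hS0
    have hB' : 0 < |B| + 1 := by positivity
    have : ν.real K ≤ 0 := by
      refine le_of_forall_pos_le_add fun ε hε => ?_
      obtain ⟨V, hKV, hV, hVε⟩ := Set.exists_isOpen_lt_of_lt K (ENNReal.ofReal (ε / (|B| + 1)))
        (μ := volume) (by rw [hK0]; exact ENNReal.ofReal_pos.2 (by positivity))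
      obtain ⟨f, hf1, hf2, hf3⟩ := hK1 K hK V hV hKV
      have h1 : ∫ x, f x ≤ ε / (|B| + 1) := by
        calc ∫ x, f x ≤ ∫ x, V.indicator 1 x :=
              integral_mono f.integrable (IntegrableOn.integrable_indicator
                (integrableOn_const (hVε.trans_le le_top).ne) hV.measurableSet) hf2
          _ = volume.real V := integral_indicator_one hV.measurableSet
          _ ≤ _ := ENNReal.toReal_le_of_le_ofReal (by positivity) hVε.le
      have h0 : 0 ≤ ∫ x, f x := integral_nonneg fun x => (hf1 x).1
      calc ν.real K ≤ Λ f := hf3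
        _ ≤ B * ∫ x, f x := hB f fun x => (hf1 x).1
        _ ≤ (|B| + 1) * ∫ x, f x := by
          gcongr
          linarith [le_abs_self B]
        _ ≤ (|B| + 1) * (ε / (|B| + 1)) := by gcongr
        _ = 0 + ε := by field_simp; simp
    exact (measureReal_eq_zero_iff).1 (le_antisymm this measureReal_nonneg)

end RieszDensity

section LimitMeasure

open scoped Topology CompactlySupported

variable {Ω : Type*} [MeasurableSpace Ω] {P : Measure Ω} [IsProbabilityMeasure P]
  {A : (N : ℕ) → Ω → Matrix (Fin N) (Fin N) ℝ}

lemma integrable_integral_ESD (hA : ∀ N ω, (A N ω).IsHermitian)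
    (hmeas : ∀ N i j, Measurable fun ω => A N ω i j) {φ : ℝ → ℝ} (hc : Continuous φ)
    (hs : HasCompactSupport φ) (N : ℕ) : Integrable (fun ω => ∫ x, φ x ∂(ESD (A N ω))) P := by
  obtain ⟨C, hC⟩ := hs.exists_bound_of_continuous hc
  exact Integrable.of_bound (measurable_integral_ESD hA hmeas hc hs N).aestronglyMeasurable C
    (Eventually.of_forall fun ω =>
      abs_integral_ESD_le (hA N ω) ((norm_nonneg _).trans (hC 0)) hC)

lemma exists_limit_integral_ESD (hA : ∀ N ω, (A N ω).IsHermitian)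
    (hmeas : ∀ N i j, Measurable fun ω => A N ω i j) {M : ℂ → ℂ} {B : ℝ}
    (hB : ∀ z : ℂ, 0 < z.im → ‖M z‖ ≤ B)
    (hM : ∀ z : ℂ, 0 < z.im → Tendsto (fun N : ℕ =>
      ∫ ω, ‖(N : ℂ)⁻¹ * (matResolvent (A N ω) z).trace - M z‖ ∂P) atTop (𝓝 0))
    {φ : ℝ → ℝ} (hc : Continuous φ) (hs : HasCompactSupport φ) :
    ∃ L : ℝ, Tendsto (fun N => ∫ ω, |∫ x, φ x ∂(ESD (A N ω)) - L| ∂P) atTop (𝓝 0) ∧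
      Tendsto (fun N => ∫ ω, ∫ x, φ x ∂(ESD (A N ω)) ∂P) atTop (𝓝 L) ∧
      |L| ≤ B * ∫ x, |φ x| := by
  have hφi : Integrable φ := hc.integrable_of_hasCompactSupport hs
  have hB0 : 0 ≤ B := (norm_nonneg _).trans (hB Complex.I (by simp))
  have hZi := fun N => integrable_integral_ESD (P := P) hA hmeas hc hs N
  have key : ∀ ε > 0, ∃ l : ℝ, |l| ≤ B * ∫ x, |φ x| ∧
      ∀ᶠ N in atTop, ∫ ω, |∫ x, φ x ∂(ESD (A N ω)) - l| ∂P ≤ ε := by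
    intro ε hε
    obtain ⟨η, hη, hηφ⟩ := exists_poissonSmooth_near hc hs (half_pos hε)
    refine ⟨π⁻¹ * ∫ E, φ E * (M (E + η * Complex.I)).im, ?_, ?_⟩
    · rw [abs_mul, abs_of_pos (inv_pos.2 Real.pi_pos)]
      have h1 : |∫ E, φ E * (M (E + η * Complex.I)).im| ≤ ∫ E, |φ E| * B := by
        rw [← Real.norm_eq_abs]
        refine norm_integral_le_of_norm_le (hφi.abs.mul_const B) (Eventually.of_forall fun E => ?_)
        rw [norm_mul, Real.norm_eq_abs]
        refine mul_le_mul_of_nonneg_left ?_ (abs_nonneg _)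
        exact (Complex.abs_im_le_norm _).trans (hB _ (by simpa using hη))
      have h2 : π⁻¹ ≤ 1 := inv_le_one_of_one_le₀ (by linarith [Real.pi_gt_three])
      have h3 : 0 ≤ ∫ E, |φ E| * B := integral_nonneg fun E => by positivity
      calc π⁻¹ * |∫ E, φ E * (M (E + η * Complex.I)).im| ≤ 1 * ∫ E, |φ E| * B := by gcongr
        _ = _ := by rw [one_mul, integral_mul_const, mul_comm]
    · have hD := tendsto_integral_poissonSmooth_ESD hA hmeas hB hM hc.measurable hφi hη
      filter_upwards [hD.eventually (gt_mem_nhds (half_pos hε))] with N hN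
      set l := π⁻¹ * ∫ E, φ E * (M (E + η * Complex.I)).im
      have hPi : Integrable (fun ω => ∫ x, poissonSmooth φ η x ∂(ESD (A N ω))) P := by
        obtain ⟨C, hC⟩ := hs.exists_bound_of_continuous hc
        refine Integrable.of_bound (measurable_integral_poissonSmooth_ESD hA hmeas hc.measurable hφi
          hη N).aestronglyMeasurable (C + ε / 2) (Eventually.of_forall fun ω => ?_)
        have hC0 : 0 ≤ C := (norm_nonneg _).trans (hC 0)
        refine abs_integral_ESD_le (hA N ω) (by positivity) fun x => ?_
        have h1 := hηφ x
        have h2 := hC x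
        rw [Real.norm_eq_abs] at h2
        have h3 := abs_sub_abs_le_abs_sub (poissonSmooth φ η x) (φ x)
        linarith
      calc ∫ ω, |∫ x, φ x ∂(ESD (A N ω)) - l| ∂P
          ≤ ∫ ω, (ε / 2 + |∫ x, poissonSmooth φ η x ∂(ESD (A N ω)) - l|) ∂P := by
            refine integral_mono ((hZi N).sub (integrable_const _)).abs
              ((integrable_const _).add (hPi.sub (integrable_const _)).abs) fun ω => ?_
            have h4 : |∫ x, poissonSmooth φ η x ∂(ESD (A N ω)) - ∫ x, φ x ∂(ESD (A N ω))|
                ≤ ε / 2 := by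
              rw [← integral_sub (integrable_ESD (hA N ω) _) (integrable_ESD (hA N ω) _)]
              exact abs_integral_ESD_le (hA N ω) (by positivity) hηφ
            rw [abs_sub_comm] at h4
            exact (abs_sub_le _ (∫ x, poissonSmooth φ η x ∂(ESD (A N ω))) _).trans
              (add_le_add h4 le_rfl)
        _ = ε / 2 + ∫ ω, |∫ x, poissonSmooth φ η x ∂(ESD (A N ω)) - l| ∂P := by
            have hPl : Integrable (fun ω => |∫ x, poissonSmooth φ η x ∂(ESD (A N ω)) - l|) P :=
              (hPi.sub (integrable_const _)).abs
            rw [integral_add (integrable_const _) hPl]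
            simp
        _ ≤ ε := by linarith
  have hmean : ∀ N (l : ℝ), |∫ ω, ∫ x, φ x ∂(ESD (A N ω)) ∂P - l| ≤
      ∫ ω, |∫ x, φ x ∂(ESD (A N ω)) - l| ∂P := by
    intro N l
    have : l = ∫ _ω, l ∂P := by simp
    conv_lhs => rw [this]
    rw [← integral_sub (hZi N) (integrable_const _), ← Real.norm_eq_abs]
    exact norm_integral_le_integral_norm _
  have hcs : CauchySeq fun N => ∫ ω, ∫ x, φ x ∂(ESD (A N ω)) ∂P := by
    refine Metric.cauchySeq_iff'.2 fun ε hε => ?_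
    obtain ⟨l, -, hl⟩ := key (ε / 3) (by positivity)
    obtain ⟨N0, hN0⟩ := eventually_atTop.1 hl
    refine ⟨N0, fun N hN => ?_⟩
    have h1 := (hmean N l).trans (hN0 N hN)
    have h2 := (hmean N0 l).trans (hN0 N0 le_rfl)
    rw [Real.dist_eq]
    have := abs_sub_le (∫ ω, ∫ x, φ x ∂(ESD (A N ω)) ∂P) l (∫ ω, ∫ x, φ x ∂(ESD (A N0 ω)) ∂P)
    rw [abs_sub_comm l] at this
    linarith
  obtain ⟨L, hL⟩ := cauchySeq_tendsto_of_complete hcs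
  have hLl : ∀ ε > 0, ∃ l : ℝ, |l| ≤ B * ∫ x, |φ x| ∧ |l - L| ≤ ε ∧
      ∀ᶠ N in atTop, ∫ ω, |∫ x, φ x ∂(ESD (A N ω)) - l| ∂P ≤ ε := by
    intro ε hε
    obtain ⟨l, hl1, hl2⟩ := key ε hε
    refine ⟨l, hl1, ?_, hl2⟩
    rw [abs_sub_comm]
    refine le_of_tendsto ((hL.sub_const l).abs) ?_
    filter_upwards [hl2] with N hN
    exact (hmean N l).trans hN
  refine ⟨L, ?_, hL, ?_⟩
  · rw [Metric.tendsto_atTop]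
    intro ε hε
    obtain ⟨l, -, hl2, hl3⟩ := hLl (ε / 3) (by positivity)
    obtain ⟨N0, hN0⟩ := eventually_atTop.1 hl3
    refine ⟨N0, fun N hN => ?_⟩
    rw [Real.dist_eq, sub_zero, abs_of_nonneg (integral_nonneg fun _ => abs_nonneg _)]
    calc ∫ ω, |∫ x, φ x ∂(ESD (A N ω)) - L| ∂P
        ≤ ∫ ω, (|∫ x, φ x ∂(ESD (A N ω)) - l| + ε / 3) ∂P := by
          refine integral_mono ((hZi N).sub (integrable_const _)).abs
            (((hZi N).sub (integrable_const _)).abs.add (integrable_const _)) fun ω => ?_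
          exact (abs_sub_le _ l _).trans (add_le_add le_rfl hl2)
      _ = ∫ ω, |∫ x, φ x ∂(ESD (A N ω)) - l| ∂P + ε / 3 := by
          have hZl : Integrable (fun ω => |∫ x, φ x ∂(ESD (A N ω)) - l|) P :=
            ((hZi N).sub (integrable_const _)).abs
          rw [integral_add hZl (integrable_const _)]
          simp
      _ ≤ ε / 3 + ε / 3 := by
          have := hN0 N hN
          gcongr
      _ < ε := by linarith
  · refine le_of_forall_pos_le_add fun ε hε => ?_
    obtain ⟨l, hl1, hl2, -⟩ := hLl ε hε
    rw [abs_sub_comm] at hl2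
    have := abs_sub_abs_le_abs_sub L l
    linarith

/-- Random symmetric matrices whose Stieltjes transforms converge in `L¹` to a bounded limit, and
whose second moments stay bounded, have an absolutely continuous limiting spectral distribution. -/
theorem exists_limit_ESD (hA : ∀ N ω, (A N ω).IsHermitian)
    (hmeas : ∀ N i j, Measurable fun ω => A N ω i j) {C : ℝ}
    (hq : ∀ N : ℕ, Integrable (fun ω => (N : ℝ)⁻¹ * ∑ i, ∑ j, A N ω i j ^ 2) P)
    (hqC : ∀ N : ℕ, ∫ ω, (N : ℝ)⁻¹ * ∑ i, ∑ j, A N ω i j ^ 2 ∂P ≤ C)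
    {M : ℂ → ℂ} {B : ℝ} (hB : ∀ z : ℂ, 0 < z.im → ‖M z‖ ≤ B)
    (hM : ∀ z : ℂ, 0 < z.im → Tendsto (fun N : ℕ =>
      ∫ ω, ‖(N : ℂ)⁻¹ * (matResolvent (A N ω) z).trace - M z‖ ∂P) atTop (𝓝 0)) :
    ∃ ν : Measure ℝ, IsProbabilityMeasure ν ∧ ν ≪ volume ∧
      ∀ φ : BoundedContinuousFunction ℝ ℝ,
        TendstoInMeasure P (fun N ω => ∫ x, φ x ∂(ESD (A N ω))) atTop (fun _ => ∫ x, φ x ∂ν) := by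
  have hC0 : 0 ≤ C := (integral_nonneg fun ω => by positivity).trans (hqC 0)
  have hZi := fun (φ : C_c(ℝ, ℝ)) N =>
    integrable_integral_ESD (P := P) hA hmeas φ.continuous φ.hasCompactSupport N
  choose Λ hΛ1 hΛ2 hΛ3 using fun φ : C_c(ℝ, ℝ) =>
    exists_limit_integral_ESD hA hmeas hB hM φ.continuous φ.hasCompactSupport
  set χ : ℝ → C_c(ℝ, ℝ) := fun R => if hR : 0 < R then
    ⟨⟨trapezoid R, continuous_trapezoid R⟩, hasCompactSupport_trapezoid hR⟩ else 0 with hχ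
  have hχa : ∀ R, 0 < R → ∀ x, χ R x = trapezoid R x := fun R hR x => by
    simp [hχ, hR]
  have htail : ∀ R, 0 < R → ∀ N ω, ∫ x, (1 - trapezoid R x) ∂(ESD (A N ω)) ≤
      (R ^ 2)⁻¹ * ((N : ℝ)⁻¹ * ∑ i, ∑ j, A N ω i j ^ 2) := by
    intro R hR N ω
    rw [← integral_sq_ESD (hA N ω), ← integral_const_mul]
    exact integral_mono (integrable_ESD (hA N ω) _) (integrable_ESD (hA N ω) _)
      fun x => one_sub_trapezoid_le hR x
  have hχΛ : ∀ R, 0 < R → 1 - (R ^ 2)⁻¹ * C ≤ Λ (χ R) := by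
    intro R hR
    refine ge_of_tendsto (hΛ2 (χ R)) ?_
    filter_upwards [eventually_ge_atTop 1] with N hN
    have : NeZero N := ⟨by omega⟩
    have h1 : ∫ ω, (1 - (R ^ 2)⁻¹ * ((N : ℝ)⁻¹ * ∑ i, ∑ j, A N ω i j ^ 2)) ∂P ≤
        ∫ ω, ∫ x, χ R x ∂(ESD (A N ω)) ∂P := by
      refine integral_mono ((integrable_const _).sub ((hq N).const_mul _)) (hZi _ N) fun ω => ?_
      have := isProbabilityMeasure_ESD (hA N ω)
      have h2 := htail R hR N ω
      rw [integral_sub (integrable_const _) (integrable_ESD (hA N ω) _)] at h2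
      simp only [integral_const, probReal_univ, one_smul] at h2
      simp only [hχa R hR]
      linarith
    rw [integral_sub (integrable_const _) ((hq N).const_mul _), integral_const_mul] at h1
    simp only [integral_const, probReal_univ, one_smul] at h1
    refine le_trans ?_ h1
    have := hqC N
    gcongr
  obtain ⟨ν, hν1, hν2, hν3⟩ := exists_absolutelyContinuous_of_functional
    { toFun := Λ
      map_add' := fun φ ψ => by
        refine tendsto_nhds_unique (hΛ2 (φ + ψ)) (((hΛ2 φ).add (hΛ2 ψ)).congr fun N => ?_)
        rw [← integral_add (hZi φ N) (hZi ψ N)]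
        congr 1
        funext ω
        rw [← integral_add (integrable_ESD (hA N ω) _) (integrable_ESD (hA N ω) _)]
        rfl
      map_smul' := fun c φ => by
        refine tendsto_nhds_unique (hΛ2 (c • φ)) (((hΛ2 φ).const_mul c).congr fun N => ?_)
        rw [← integral_const_mul]
        congr 1
        funext ω
        rw [← integral_const_mul]
        rfl }
    (fun φ hφ => ge_of_tendsto (hΛ2 φ) (Eventually.of_forall fun N =>
      integral_nonneg fun ω => integral_nonneg fun x => hφ x))
    (B := B) (fun φ hφ => by
      refine (le_abs_self _).trans ((hΛ3 φ).trans_eq ?_)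
      congr 2
      funext x
      exact abs_of_nonneg (hφ x))
    (fun φ hφ => by
      refine le_of_tendsto (hΛ2 φ) (Eventually.of_forall fun N => ?_)
      refine (integral_mono (hZi φ N) (integrable_const (1 : ℝ)) fun ω => ?_).trans (by simp)
      refine (integral_mono (integrable_ESD (hA N ω) _) (integrable_ESD (hA N ω) _) hφ).trans ?_
      exact (le_abs_self _).trans (abs_integral_ESD_le (hA N ω) zero_le_one (by simp)))
    (fun ε hε => by
      refine ⟨χ √((C + 1) / ε), fun x => ?_, ?_⟩
      · rw [hχa _ (by positivity)]
        exact ⟨trapezoid_nonneg _ _, trapezoid_le_one _ _⟩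
      · refine le_trans ?_ (hχΛ √((C + 1) / ε) (by positivity))
        rw [Real.sq_sqrt (by positivity), inv_div]
        have : ε / (C + 1) * C ≤ ε := by
          rw [div_mul_eq_mul_div, div_le_iff₀ (by positivity)]
          nlinarith
        linarith)
  refine ⟨ν, hν1, hν2, fun φ => ?_⟩
  rw [tendstoInMeasure_iff_norm]
  intro ε hε
  rw [← ENNReal.tendsto_toReal_zero_iff fun N => measure_ne_top P _]
  rw [Metric.tendsto_atTop]
  intro δ hδ
  set K : ℝ := ‖φ‖ * C + 1 with hK
  have hφ0 : 0 ≤ ‖φ‖ := norm_nonneg φ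
  have hK0 : 0 < K := by positivity
  set t : ℝ := min (ε / (4 * K)) (δ * ε / (8 * K)) with ht
  have ht0 : 0 < t := by positivity
  set R : ℝ := √t⁻¹ with hR
  have hR0 : 0 < R := by positivity
  have hRt : (R ^ 2)⁻¹ = t := by rw [hR, Real.sq_sqrt (by positivity), inv_inv]
  have htK1 : t * K ≤ ε / 4 := by
    calc t * K ≤ ε / (4 * K) * K := by gcongr; exact min_le_left _ _
      _ = ε / 4 := by field_simp
  have htK2 : t * K ≤ δ * ε / 8 := by
    calc t * K ≤ δ * ε / (8 * K) * K := by gcongr; exact min_le_right _ _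
      _ = δ * ε / 8 := by field_simp
  have htC : ‖φ‖ * (t * C) ≤ t * K := by
    rw [hK]; nlinarith
  set ψ : C_c(ℝ, ℝ) := ⟨φ.toContinuousMap * (χ R).toContinuousMap,
    (χ R).hasCompactSupport.mul_left⟩ with hψ
  have hψa : ∀ x, ψ x = φ x * trapezoid R x := fun x => by
    rw [← hχa R hR0 x]
    rfl
  have hφi : ∀ μ : Measure ℝ, IsFiniteMeasure μ → Integrable φ μ := fun μ _ => φ.integrable μ
  have hνψ : |∫ x, φ x ∂ν - Λ ψ| ≤ ε / 4 := by
    have h1 : ∫ x, ψ x ∂ν = Λ ψ := hν3 ψ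
    have h2 : ∫ x, χ R x ∂ν = Λ (χ R) := hν3 (χ R)
    rw [← h1, ← integral_sub (hφi ν inferInstance) ψ.integrable, ← Real.norm_eq_abs]
    have h3 : Integrable (fun x => ‖φ‖ * (1 - χ R x)) ν :=
      ((integrable_const _).sub (χ R).integrable).const_mul _
    refine (norm_integral_le_of_norm_le h3 (Eventually.of_forall fun x => ?_)).trans ?_
    · rw [hψa, hχa R hR0, ← mul_one_sub, norm_mul,
        Real.norm_of_nonneg (sub_nonneg.2 (trapezoid_le_one R x))]
      exact mul_le_mul_of_nonneg_right (φ.norm_coe_le_norm x)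
        (sub_nonneg.2 (trapezoid_le_one R x))
    · rw [integral_const_mul, integral_sub (integrable_const _) (χ R).integrable, h2]
      simp only [integral_const, probReal_univ, one_smul]
      have h4 := hχΛ R hR0
      rw [hRt] at h4
      calc ‖φ‖ * (1 - Λ (χ R)) ≤ ‖φ‖ * (t * C) := by gcongr; linarith
        _ ≤ ε / 4 := htC.trans htK1
  obtain ⟨N0, hN0⟩ := Metric.tendsto_atTop.1 (hΛ1 ψ) (δ * ε / 8) (by positivity)
  refine ⟨N0 + 1, fun N hN => ?_⟩
  rw [dist_zero_right, Real.norm_of_nonneg ENNReal.toReal_nonneg]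
  have hE1 := hN0 N (by omega)
  rw [Real.dist_eq, sub_zero, abs_of_nonneg (integral_nonneg fun _ => abs_nonneg _)] at hE1
  have hsub : {ω | ε ≤ ‖∫ x, φ x ∂(ESD (A N ω)) - ∫ x, φ x ∂ν‖} ⊆
      {ω | ε / 4 ≤ |∫ x, ψ x ∂(ESD (A N ω)) - Λ ψ|} ∪
      {ω | ε / 4 ≤ ‖φ‖ * (t * ((N : ℝ)⁻¹ * ∑ i, ∑ j, A N ω i j ^ 2))} := by
    intro ω hω
    by_contra hcon
    simp only [Set.mem_union, Set.mem_ofPred_eq, not_or, not_le] at hcon hω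
    have h1 : |∫ x, φ x ∂(ESD (A N ω)) - ∫ x, ψ x ∂(ESD (A N ω))| ≤
        ‖φ‖ * (t * ((N : ℝ)⁻¹ * ∑ i, ∑ j, A N ω i j ^ 2)) := by
      rw [← integral_sub (integrable_ESD (hA N ω) _) (integrable_ESD (hA N ω) _),
        ← Real.norm_eq_abs]
      refine (norm_integral_le_of_norm_le (integrable_ESD (hA N ω)
        (fun x => ‖φ‖ * (1 - trapezoid R x))) (Eventually.of_forall fun x => ?_)).trans ?_
      · rw [hψa, ← mul_one_sub, norm_mul,
          Real.norm_of_nonneg (sub_nonneg.2 (trapezoid_le_one R x))]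
        exact mul_le_mul_of_nonneg_right (φ.norm_coe_le_norm x)
          (sub_nonneg.2 (trapezoid_le_one R x))
      · rw [integral_const_mul, ← hRt]
        exact mul_le_mul_of_nonneg_left (htail R hR0 N ω) hφ0
    rw [Real.norm_eq_abs] at hω
    have h2 := abs_sub_le (∫ x, φ x ∂(ESD (A N ω))) (∫ x, ψ x ∂(ESD (A N ω))) (Λ ψ)
    have h3 := abs_sub_le (∫ x, φ x ∂(ESD (A N ω))) (Λ ψ) (∫ x, φ x ∂ν)
    rw [abs_sub_comm (Λ ψ)] at h3
    linarith [hcon.1, hcon.2]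
  have hM1 := mul_meas_ge_le_integral_of_nonneg (μ := P) (ε := ε / 4)
    (f := fun ω => |∫ x, ψ x ∂(ESD (A N ω)) - Λ ψ|)
    (Eventually.of_forall fun ω => abs_nonneg _) ((hZi ψ N).sub (integrable_const _)).abs
  have hM2 := mul_meas_ge_le_integral_of_nonneg (μ := P) (ε := ε / 4)
    (f := fun ω => ‖φ‖ * (t * ((N : ℝ)⁻¹ * ∑ i, ∑ j, A N ω i j ^ 2)))
    (Eventually.of_forall fun ω => by positivity) (((hq N).const_mul _).const_mul _)
  rw [integral_const_mul, integral_const_mul] at hM2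
  have hM3 : ‖φ‖ * (t * ∫ ω, (N : ℝ)⁻¹ * ∑ i, ∑ j, A N ω i j ^ 2 ∂P) ≤ δ * ε / 8 := by
    refine le_trans ?_ (htC.trans htK2)
    have := hqC N
    gcongr
  have hfin := (measureReal_mono (μ := P) hsub).trans (measureReal_union_le _ _)
  change P.real _ < δ
  refine hfin.trans_lt ?_
  have h5 : ε / 4 * (P.real {ω | ε / 4 ≤ |∫ x, ψ x ∂(ESD (A N ω)) - Λ ψ|} +
      P.real {ω | ε / 4 ≤ ‖φ‖ * (t * ((N : ℝ)⁻¹ * ∑ i, ∑ j, A N ω i j ^ 2))}) < ε / 4 * δ := by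
    have hE2 : ∫ ω, |∫ x, ψ x ∂(ESD (A N ω)) - Λ ψ| ∂P < δ * ε / 8 := hE1
    have hM4 : ε / 4 * P.real {ω | ε / 4 ≤ |∫ x, ψ x ∂(ESD (A N ω)) - Λ ψ|} ≤
        ∫ ω, |∫ x, ψ x ∂(ESD (A N ω)) - Λ ψ| ∂P := hM1
    have hM5 : ε / 4 * P.real {ω | ε / 4 ≤ ‖φ‖ * (t * ((N : ℝ)⁻¹ * ∑ i, ∑ j, A N ω i j ^ 2))} ≤
        ‖φ‖ * (t * ∫ ω, (N : ℝ)⁻¹ * ∑ i, ∑ j, A N ω i j ^ 2 ∂P) := hM2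
    have h6 : 0 < δ * ε := by positivity
    rw [mul_add]
    linarith
  exact lt_of_mul_lt_mul_left h5 (by positivity)

end LimitMeasure

section GaussianTools

open ProbabilityTheory Topology

lemma integrable_id_gaussianReal : Integrable (fun x : ℝ => x) (gaussianReal 0 1) :=
  (memLp_id_gaussianReal' 1 (by simp)).integrable le_rfl

lemma integral_sq_gaussianReal : ∫ x, x ^ 2 ∂(gaussianReal 0 1) = 1 := by
  have h := variance_fun_id_gaussianReal (μ := 0) (v := 1)
  rw [variance_eq_integral (by fun_prop)] at h
  simpa using h

lemma integrable_sq_gaussianReal : Integrable (fun x : ℝ => x ^ 2) (gaussianReal 0 1) :=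
  (memLp_id_gaussianReal' 2 (by simp)).integrable_sq

/-- Gaussian integration by parts on the line. -/
lemma integral_mul_gaussianReal_eq {F F' : ℝ → ℂ} (hF : ∀ x, HasDerivAt F (F' x) x) {C D : ℝ}
    (hC : ∀ x, ‖F x‖ ≤ C) (hD : ∀ x, ‖F' x‖ ≤ D) :
    ∫ x, (x : ℂ) * F x ∂(gaussianReal 0 1) = ∫ x, F' x ∂(gaussianReal 0 1) := by
  have hFm : Measurable F :=
    (continuous_iff_continuousAt.2 fun x => (hF x).continuousAt).measurable
  have hF'm : Measurable F' := by
    have : F' = deriv F := funext fun x => (hF x).deriv.symm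
    rw [this]; exact measurable_deriv F
  have hi1 : Integrable (fun x : ℝ => (x : ℂ) * F x) (gaussianReal 0 1) := by
    refine Integrable.mul_bdd (c := C) ?_ hFm.aestronglyMeasurable (Eventually.of_forall hC)
    exact integrable_id_gaussianReal.ofReal
  have hi2 : Integrable F' (gaussianReal 0 1) :=
    Integrable.of_bound hF'm.aestronglyMeasurable D (Eventually.of_forall hD)
  have hi3 : Integrable F (gaussianReal 0 1) :=
    Integrable.of_bound hFm.aestronglyMeasurable C (Eventually.of_forall hC)
  have key : ∀ g : ℝ → ℂ, Integrable g (gaussianReal 0 1) →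
      Integrable (fun x => (gaussianPDFReal 0 1 x : ℂ) * g x) := by
    intro g hg
    rw [gaussianReal_of_var_ne_zero 0 one_ne_zero,
      integrable_withDensity_iff_integrable_smul' (by fun_prop)
        (Eventually.of_forall fun _ => gaussianPDF_lt_top)] at hg
    simpa [toReal_gaussianPDF] using hg
  have hder : ∀ x : ℝ, HasDerivAt (fun x => (gaussianPDFReal 0 1 x : ℂ))
      (-((x : ℂ) * gaussianPDFReal 0 1 x)) x := by
    intro x
    have h1 : HasDerivAt (fun x => gaussianPDFReal 0 1 x) (-(x * gaussianPDFReal 0 1 x)) x := by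
      simp only [gaussianPDFReal, NNReal.coe_one, sub_zero, mul_one]
      have h2 : HasDerivAt (fun x : ℝ => -x ^ 2 / 2) (-x) x := by
        have := ((hasDerivAt_pow 2 x).neg).div_const 2
        refine this.congr_deriv ?_
        simp
        ring
      refine (h2.exp.const_mul (√(2 * π))⁻¹).congr_deriv ?_
      ring
    exact_mod_cast h1.ofReal_comp
  rw [integral_gaussianReal_eq_integral_smul one_ne_zero,
    integral_gaussianReal_eq_integral_smul one_ne_zero]
  have h := integral_mul_deriv_eq_deriv_mul_of_integrable (A := ℂ)
    (u := fun x => (gaussianPDFReal 0 1 x : ℂ)) (v := F) (v' := F')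
    (u' := fun x => -((x : ℂ) * gaussianPDFReal 0 1 x)) (fun x _ => hder x) (fun x _ => hF x)
    (key _ hi2) (by
      have := (key _ hi1).neg
      refine this.congr (Eventually.of_forall fun x => ?_)
      simp only [Pi.neg_apply, Pi.mul_apply]; ring) (key _ hi3)
  simp only [Complex.real_smul]
  rw [h, ← integral_neg]
  congr 1
  ext x
  ring

variable {Q : Type*} [Fintype Q] [DecidableEq Q]

/-- Resampling one coordinate of a product measure preserves it. -/
lemma measurePreserving_update (μ : Measure ℝ) [IsProbabilityMeasure μ] (q : Q) :
    MeasurePreserving (fun p : (Q → ℝ) × ℝ => Function.update p.1 q p.2)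
      ((Measure.pi fun _ : Q => μ).prod μ) (Measure.pi fun _ : Q => μ) := by
  have hm : Measurable fun p : (Q → ℝ) × ℝ => Function.update p.1 q p.2 := by
    refine measurable_pi_iff.2 fun i => ?_
    by_cases h : i = q
    · subst h; simpa using measurable_snd
    · simp only [Function.update_of_ne h]
      exact (measurable_pi_apply i).comp measurable_fst
  refine ⟨hm, (Measure.pi_eq fun s hs => ?_).symm⟩
  rw [Measure.map_apply hm (MeasurableSet.univ_pi hs)]
  have : (fun p : (Q → ℝ) × ℝ => Function.update p.1 q p.2) ⁻¹' (Set.univ.pi s) =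
      (Set.univ.pi (Function.update s q Set.univ)) ×ˢ s q := by
    ext p
    simp only [Set.mem_preimage, Set.mem_univ_pi, Set.mem_prod]
    constructor
    · intro h
      refine ⟨fun i => ?_, by simpa using h q⟩
      by_cases hi : i = q
      · subst hi; simp
      · simpa [Function.update_of_ne hi] using h i
    · rintro ⟨h1, h2⟩ i
      by_cases hi : i = q
      · subst hi; simpa using h2
      · simpa [Function.update_of_ne hi] using h1 i
  rw [this, Measure.prod_prod, Measure.pi_pi, ← Finset.mul_prod_erase _ _ (Finset.mem_univ q),
    ← Finset.mul_prod_erase Finset.univ (fun i => μ (s i)) (Finset.mem_univ q)]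
  simp only [Function.update_self, measure_univ, one_mul]
  rw [mul_comm]
  congr 1
  refine Finset.prod_congr rfl fun i hi => ?_
  rw [Function.update_of_ne (Finset.ne_of_mem_erase hi)]

variable (Q) in
/-- The standard Gaussian measure on `Q → ℝ`. -/
noncomputable abbrev gaussianPi : Measure (Q → ℝ) := Measure.pi fun _ : Q => gaussianReal 0 1

omit [DecidableEq Q] in
lemma integrable_coord_gaussianPi (q : Q) : Integrable (fun ξ : Q → ℝ => ξ q) (gaussianPi Q) :=
  (measurePreserving_eval (fun _ : Q => gaussianReal 0 1) q).integrable_comp_of_integrable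
    integrable_id_gaussianReal

/-- Gaussian integration by parts in one coordinate. -/
lemma integral_coord_mul_gaussianPi {F F' : (Q → ℝ) → ℂ} (q : Q)
    (hF : ∀ ξ, HasDerivAt (fun x : ℝ => F (Function.update ξ q x)) (F' ξ) (ξ q)) {C D : ℝ}
    (hFm : Measurable F) (hF'm : Measurable F')
    (hC : ∀ ξ, ‖F ξ‖ ≤ C) (hD : ∀ ξ, ‖F' ξ‖ ≤ D) :
    ∫ ξ, (ξ q : ℂ) * F ξ ∂(gaussianPi Q) = ∫ ξ, F' ξ ∂(gaussianPi Q) := by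
  have hu : MeasurePreserving (fun p : (Q → ℝ) × ℝ => Function.update p.1 q p.2)
      ((gaussianPi Q).prod (gaussianReal 0 1)) (gaussianPi Q) :=
    measurePreserving_update (gaussianReal 0 1) q
  have hi1 : Integrable (fun ξ : Q → ℝ => (ξ q : ℂ) * F ξ) (gaussianPi Q) :=
    Integrable.mul_bdd (c := C) (integrable_coord_gaussianPi q).ofReal
      hFm.aestronglyMeasurable (Eventually.of_forall hC)
  have hi2 : Integrable F' (gaussianPi Q) :=
    Integrable.of_bound hF'm.aestronglyMeasurable D (Eventually.of_forall hD)
  have e1 := hu.integrable_comp_of_integrable hi1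
  have e2 := hu.integrable_comp_of_integrable hi2
  rw [← hu.map_eq, integral_map hu.measurable.aemeasurable (by rw [hu.map_eq]; exact hi1.1),
    integral_map hu.measurable.aemeasurable (by rw [hu.map_eq]; exact hi2.1),
    integral_prod (fun p : (Q → ℝ) × ℝ =>
      ((Function.update p.1 q p.2 q : ℝ) : ℂ) * F (Function.update p.1 q p.2)) e1,
    integral_prod (fun p : (Q → ℝ) × ℝ => F' (Function.update p.1 q p.2)) e2]
  congr 1
  ext ξ
  simp only [Function.update_self]
  refine integral_mul_gaussianReal_eq (fun x => ?_) (fun x => hC _) (fun x => hD _)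
  have := hF (Function.update ξ q x)
  simpa using this

lemma integral_norm_sub_sq_eq {α : Type*} [MeasurableSpace α] {μ : Measure α}
    [IsProbabilityMeasure μ] {f : α → ℂ} (hf : MemLp f 2 μ) (c : ℂ) :
    ∫ x, ‖f x - c‖ ^ 2 ∂μ = ∫ x, ‖f x - ∫ y, f y ∂μ‖ ^ 2 ∂μ + ‖(∫ y, f y ∂μ) - c‖ ^ 2 := by
  set m := ∫ y, f y ∂μ with hm
  have hfi : Integrable f μ := hf.integrable (by norm_num)
  have h1 : ∀ x, ‖f x - c‖ ^ 2 = ‖f x - m‖ ^ 2 + 2 * ((f x - m) * starRingEnd ℂ (m - c)).re +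
      ‖m - c‖ ^ 2 := by
    intro x
    have : f x - c = (f x - m) + (m - c) := by ring
    rw [this, ← Complex.normSq_eq_norm_sq, ← Complex.normSq_eq_norm_sq,
      ← Complex.normSq_eq_norm_sq, Complex.normSq_add]
    ring
  have hi1 : Integrable (fun x => ‖f x - m‖ ^ 2) μ := (hf.sub (memLp_const m)).integrable_norm_pow
    (by norm_num)
  have hi2 : Integrable (fun x => (f x - m) * starRingEnd ℂ (m - c)) μ :=
    (hfi.sub (integrable_const m)).mul_const _
  have hi3 : Integrable (fun x => ((f x - m) * starRingEnd ℂ (m - c)).re) μ := hi2.re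
  have h0 : ∫ x, ((f x - m) * starRingEnd ℂ (m - c)).re ∂μ = 0 := by
    have h := integral_re hi2
    have h' : ∫ x, ((f x - m) * starRingEnd ℂ (m - c)).re ∂μ =
      (∫ x, (f x - m) * starRingEnd ℂ (m - c) ∂μ).re := h
    rw [h', integral_mul_const, integral_sub hfi (integrable_const m)]
    simp [hm]
  simp_rw [h1]
  have hi4 : Integrable (fun x => ‖f x - m‖ ^ 2 + 2 * ((f x - m) * starRingEnd ℂ (m - c)).re) μ :=
    hi1.add (hi3.const_mul 2)
  rw [integral_add hi4 (integrable_const _),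
    integral_add hi1 (hi3.const_mul 2), integral_const_mul, h0]
  simp

/-- The Gaussian Efron-Stein inequality for coordinatewise Lipschitz functions on `Fin n → ℝ`. -/
lemma integral_norm_sub_sq_le_fin : ∀ {n : ℕ} {F : (Fin n → ℝ) → ℂ} {C : ℝ} {L : Fin n → ℝ}
    (_ : Measurable F) (_ : ∀ ξ, ‖F ξ‖ ≤ C)
    (_ : ∀ q ξ x y, ‖F (Function.update ξ q x) - F (Function.update ξ q y)‖ ≤ L q * |x - y|),
    ∫ ξ, ‖F ξ - ∫ ζ, F ζ ∂(gaussianPi (Fin n))‖ ^ 2 ∂(gaussianPi (Fin n)) ≤ ∑ q, L q ^ 2 := by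
  intro n
  induction n with
  | zero =>
    intro F C L hFm hC hL
    have : ∀ ξ : Fin 0 → ℝ, F ξ = F 0 := fun ξ => congrArg F (Subsingleton.elim _ _)
    simp_rw [this]
    simp
  | succ n ih =>
    intro F C L hFm hC hL
    set e := MeasurableEquiv.piFinSuccAbove (fun _ : Fin (n + 1) => ℝ) 0 with he
    have hmp : MeasurePreserving e (gaussianPi (Fin (n + 1)))
        ((gaussianReal 0 1).prod (gaussianPi (Fin n))) :=
      measurePreserving_piFinSuccAbove (fun _ : Fin (n + 1) => gaussianReal 0 1) 0
    set f : ℝ × (Fin n → ℝ) → ℂ := fun p => F (e.symm p) with hf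
    have hes : ∀ x η, e.symm (x, η) = Fin.cons x η := by
      intro x η
      simp [he, MeasurableEquiv.piFinSuccAbove, Fin.insertNthEquiv]
    have hfF : ∀ ξ, F ξ = f (e ξ) := fun ξ => by simp [hf]
    have hfm : Measurable f := hFm.comp e.symm.measurable
    have hfC : ∀ p, ‖f p‖ ≤ C := fun p => hC _
    have hfi : Integrable f ((gaussianReal 0 1).prod (gaussianPi (Fin n))) :=
      Integrable.of_bound hfm.aestronglyMeasurable C (Eventually.of_forall hfC)
    have hm : ∫ ζ, F ζ ∂(gaussianPi (Fin (n + 1))) =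
        ∫ p, f p ∂((gaussianReal 0 1).prod (gaussianPi (Fin n))) := by
      rw [← hmp.integral_comp e.measurableEmbedding]
      exact integral_congr_ae (Eventually.of_forall hfF)
    set m := ∫ p, f p ∂((gaussianReal 0 1).prod (gaussianPi (Fin n))) with hmdef
    set g : ℝ → ℂ := fun x => ∫ η, f (x, η) ∂(gaussianPi (Fin n)) with hg
    have hgm : m = ∫ x, g x ∂(gaussianReal 0 1) := integral_prod _ hfi
    have hslice : ∀ x, Measurable fun η => f (x, η) := fun x => hfm.comp measurable_prodMk_left
    have hgmeas : Measurable g := by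
      exact (hfm.stronglyMeasurable.integral_prod_right).measurable
    have hgC : ∀ x, ‖g x‖ ≤ C := fun x => by
      have := norm_integral_le_of_norm_le_const (μ := gaussianPi (Fin n))
        (f := fun η => f (x, η)) (C := C) (Eventually.of_forall fun η => hfC _)
      simpa using this
    have hslmem : ∀ x, MemLp (fun η => f (x, η)) 2 (gaussianPi (Fin n)) := fun x =>
      MemLp.of_bound (hslice x).aestronglyMeasurable C (Eventually.of_forall fun η => hfC _)
    have hgmem : MemLp g 2 (gaussianReal 0 1) :=
      MemLp.of_bound hgmeas.aestronglyMeasurable C (Eventually.of_forall hgC)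
    rw [hm]
    have h1 : ∫ ξ, ‖F ξ - m‖ ^ 2 ∂(gaussianPi (Fin (n + 1))) =
        ∫ p, ‖f p - m‖ ^ 2 ∂((gaussianReal 0 1).prod (gaussianPi (Fin n))) := by
      rw [← hmp.integral_comp e.measurableEmbedding]
      exact integral_congr_ae (Eventually.of_forall fun ξ => by simp only [hfF ξ])
    have hmem : MemLp f 2 ((gaussianReal 0 1).prod (gaussianPi (Fin n))) :=
      MemLp.of_bound hfm.aestronglyMeasurable C (Eventually.of_forall hfC)
    have hsqi : Integrable (fun p => ‖f p - m‖ ^ 2)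
        ((gaussianReal 0 1).prod (gaussianPi (Fin n))) :=
      (hmem.sub (memLp_const m)).integrable_norm_pow (by norm_num)
    have hin : ∀ x, ∫ η, ‖f (x, η) - g x‖ ^ 2 ∂(gaussianPi (Fin n)) ≤
        ∑ q : Fin n, L q.succ ^ 2 := by
      intro x
      refine ih (L := fun q => L q.succ) (hslice x) (fun η => hfC _) fun q η a b => ?_
      have := hL q.succ (Fin.cons x η) a b
      simp only [← Fin.cons_update] at this
      simpa only [hf, hes] using this
    have hlip : ∀ x y, ‖g x - g y‖ ≤ L 0 * |x - y| := by
      intro x y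
      rw [hg]
      simp only
      rw [← integral_sub ((hslmem x).integrable (by norm_num))
        ((hslmem y).integrable (by norm_num))]
      have := norm_integral_le_of_norm_le_const (μ := gaussianPi (Fin n))
        (f := fun η => f (x, η) - f (y, η)) (C := L 0 * |x - y|)
        (Eventually.of_forall fun η => by
          have := hL 0 (Fin.cons x η) x y
          simpa only [Fin.update_cons_zero, hf, hes] using this)
      simpa using this
    have hvar0 : ∫ x, ‖g x - m‖ ^ 2 ∂(gaussianReal 0 1) ≤ L 0 ^ 2 := by
      have h2 := integral_norm_sub_sq_eq hgmem (g 0)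
      rw [← hgm] at h2
      have h3 : ∫ x, ‖g x - g 0‖ ^ 2 ∂(gaussianReal 0 1) ≤
          ∫ x, L 0 ^ 2 * x ^ 2 ∂(gaussianReal 0 1) := by
        refine integral_mono ((hgmem.sub (memLp_const _)).integrable_norm_pow (by norm_num))
          (integrable_sq_gaussianReal.const_mul _) fun x => ?_
        have := pow_le_pow_left₀ (norm_nonneg _) (hlip x 0) 2
        simpa [mul_pow] using this
      rw [integral_const_mul, integral_sq_gaussianReal, mul_one] at h3
      nlinarith [sq_nonneg ‖m - g 0‖]
    rw [h1, integral_prod _ hsqi, Fin.sum_univ_succ]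
    have h4 : ∀ x, ∫ η, ‖f (x, η) - m‖ ^ 2 ∂(gaussianPi (Fin n)) ≤
        (∑ q : Fin n, L q.succ ^ 2) + ‖g x - m‖ ^ 2 := fun x => by
      rw [integral_norm_sub_sq_eq (hslmem x) m]
      have := hin x
      simp only [hg] at this ⊢
      linarith
    have h5 : Integrable (fun x => ‖g x - m‖ ^ 2) (gaussianReal 0 1) :=
      (hgmem.sub (memLp_const m)).integrable_norm_pow (by norm_num)
    refine (integral_mono hsqi.integral_prod_left ((integrable_const _).add h5) h4).trans ?_
    simp only [Pi.add_apply]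
    rw [integral_add (integrable_const _) h5]
    simp only [integral_const, probReal_univ, one_smul]
    linarith

/-- The Gaussian Efron-Stein inequality for coordinatewise Lipschitz functions. -/
lemma integral_norm_sub_sq_le {F : (Q → ℝ) → ℂ} {C : ℝ} {L : Q → ℝ}
    (hFm : Measurable F) (hC : ∀ ξ, ‖F ξ‖ ≤ C)
    (hL : ∀ q ξ x y, ‖F (Function.update ξ q x) - F (Function.update ξ q y)‖ ≤ L q * |x - y|) :
    ∫ ξ, ‖F ξ - ∫ ζ, F ζ ∂(gaussianPi Q)‖ ^ 2 ∂(gaussianPi Q) ≤ ∑ q, L q ^ 2 := by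
  set f := (Fintype.equivFin Q).symm with hf
  set e := MeasurableEquiv.piCongrLeft (fun _ : Q => ℝ) f with he
  have hmp : MeasurePreserving e (gaussianPi (Fin (Fintype.card Q))) (gaussianPi Q) :=
    measurePreserving_piCongrLeft (fun _ : Q => gaussianReal 0 1) f
  rw [← hmp.integral_comp e.measurableEmbedding, ← hmp.integral_comp e.measurableEmbedding,
    ← f.sum_comp]
  have hes : ∀ ζ, e ζ = fun q => ζ (f.symm q) := by
    intro ζ
    ext q
    obtain ⟨i, rfl⟩ := f.surjective q
    simp [he, MeasurableEquiv.piCongrLeft]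
  refine integral_norm_sub_sq_le_fin (F := fun ζ => F (e ζ)) (hFm.comp e.measurable)
    (fun ζ => hC _) fun i ζ x y => ?_
  have hupd : ∀ x, e (Function.update ζ i x) = Function.update (e ζ) (f i) x := by
    intro x
    ext q
    obtain ⟨j, rfl⟩ := f.surjective q
    by_cases h : j = i
    · subst h; simp [hes]
    · have : f j ≠ f i := fun h' => h (f.injective h')
      simp [hes, Function.update_of_ne h, Function.update_of_ne this]
  simp only [hupd]
  exact hL (f i) (e ζ) x y

end GaussianTools

section GaussianMatrix

open ProbabilityTheory Topology
open scoped Matrix.Norms.L2Operator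

variable {n Q : Type*} [Fintype n] [DecidableEq n] [Fintype Q]

/-- The matrix `∑ q, ξ q • A q`. -/
def linComb (A : Q → Matrix n n ℝ) (ξ : Q → ℝ) : Matrix n n ℝ := ∑ q, ξ q • A q

omit [Fintype n] [DecidableEq n] in
lemma isHermitian_linComb {A : Q → Matrix n n ℝ} (hA : ∀ q, (A q).IsHermitian) (ξ : Q → ℝ) :
    (linComb A ξ).IsHermitian := by
  unfold linComb Matrix.IsHermitian
  rw [Matrix.conjTranspose_sum]
  refine Finset.sum_congr rfl fun q _ => ?_
  rw [Matrix.conjTranspose_smul, (hA q).eq]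
  simp

omit [Fintype n] [DecidableEq n] in
lemma linComb_apply (A : Q → Matrix n n ℝ) (ξ : Q → ℝ) (i j : n) :
    linComb A ξ i j = ∑ q, ξ q * A q i j := by
  simp [linComb, Matrix.sum_apply]

omit [Fintype n] [DecidableEq n] in
lemma linComb_update_sub [DecidableEq Q] (A : Q → Matrix n n ℝ) (ξ : Q → ℝ) (q : Q) (x y : ℝ) :
    linComb A (Function.update ξ q x) - linComb A (Function.update ξ q y) = (x - y) • A q := by
  unfold linComb
  rw [← Finset.sum_sub_distrib, Finset.sum_eq_single q]
  · simp [sub_smul]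
  · intro b _ hb
    simp [Function.update_of_ne hb]
  · simp

lemma norm_trace_le (M : Matrix n n ℂ) : ‖M.trace‖ ≤ Fintype.card n * ‖M‖ := by
  refine (norm_sum_le _ _).trans ?_
  refine (Finset.sum_le_sum fun i _ => norm_entry_le_l2_opNorm M i i).trans ?_
  simp

lemma norm_trace_mul_ofReal_le (M : Matrix n n ℂ) (A : Matrix n n ℝ) :
    ‖(M * A.map Complex.ofReal).trace‖ ≤ ‖M‖ * ∑ i, ∑ j, |A i j| := by
  simp only [Matrix.trace, Matrix.diag_apply, Matrix.mul_apply]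
  rw [Finset.sum_comm, Finset.mul_sum]
  refine (norm_sum_le _ _).trans (Finset.sum_le_sum fun i _ => ?_)
  rw [Finset.mul_sum]
  refine (norm_sum_le _ _).trans (Finset.sum_le_sum fun j _ => ?_)
  rw [norm_mul]
  simp only [Matrix.map_apply, Complex.norm_real, Real.norm_eq_abs]
  exact mul_le_mul_of_nonneg_right (norm_entry_le_l2_opNorm M _ _) (abs_nonneg _)

variable {A : Q → Matrix n n ℝ} {z : ℂ}

lemma measurable_trace_mul_matResolvent_linComb (B : Matrix n n ℂ) :
    Measurable fun ξ => (B * matResolvent (linComb A ξ) z).trace := by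
  simp only [Matrix.trace, Matrix.diag_apply, Matrix.mul_apply]
  refine Finset.measurable_fun_sum _ fun i _ => Finset.measurable_fun_sum _ fun j _ => ?_
  refine Measurable.const_mul ?_ _
  refine measurable_matResolvent_apply (fun k l => ?_) measurable_const _ _
  simp only [linComb_apply]
  fun_prop

lemma measurable_trace_mul_mul_matResolvent_linComb (B D : Matrix n n ℂ) :
    Measurable fun ξ => (B * matResolvent (linComb A ξ) z * D *
      matResolvent (linComb A ξ) z).trace := by
  have h : ∀ i j, Measurable fun ξ => matResolvent (linComb A ξ) z i j := fun i j => by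
    refine measurable_matResolvent_apply (fun k l => ?_) measurable_const _ _
    simp only [linComb_apply]
    fun_prop
  simp only [Matrix.trace, Matrix.diag_apply, Matrix.mul_apply]
  fun_prop

lemma norm_trace_mul_matResolvent_linComb_le (hA : ∀ q, (A q).IsHermitian) (hz : 0 < z.im)
    (B : Matrix n n ℂ) (ξ : Q → ℝ) :
    ‖(B * matResolvent (linComb A ξ) z).trace‖ ≤ Fintype.card n * (‖B‖ * z.im⁻¹) := by
  refine (norm_trace_le _).trans ?_
  gcongr
  exact (norm_mul_le _ _).trans (by gcongr; exact norm_matResolvent_le (isHermitian_linComb hA _) hz)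

lemma norm_trace_mul_mul_matResolvent_linComb_le (hA : ∀ q, (A q).IsHermitian) (hz : 0 < z.im)
    (B D : Matrix n n ℂ) (ξ : Q → ℝ) :
    ‖(B * matResolvent (linComb A ξ) z * D * matResolvent (linComb A ξ) z).trace‖ ≤
      Fintype.card n * (‖B‖ * z.im⁻¹ * ‖D‖ * z.im⁻¹) := by
  have h := norm_matResolvent_le (isHermitian_linComb hA ξ) hz
  refine (norm_trace_le _).trans ?_
  gcongr
  refine (norm_mul_le _ _).trans ?_
  gcongr
  refine (norm_mul_le _ _).trans ?_
  gcongr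
  refine (norm_mul_le _ _).trans ?_
  gcongr

variable [DecidableEq Q]

lemma matResolvent_linComb_update_sub (hA : ∀ q, (A q).IsHermitian) (hz : 0 < z.im)
    (ξ : Q → ℝ) (q : Q) (x y : ℝ) :
    matResolvent (linComb A (Function.update ξ q x)) z -
      matResolvent (linComb A (Function.update ξ q y)) z =
    -((x - y : ℝ) : ℂ) • (matResolvent (linComb A (Function.update ξ q x)) z *
      (A q).map Complex.ofReal * matResolvent (linComb A (Function.update ξ q y)) z) := by
  rw [matResolvent_sub (isHermitian_linComb hA _) (isHermitian_linComb hA _) hz,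
    linComb_update_sub]
  have : ((x - y) • A q).map Complex.ofReal = ((x - y : ℝ) : ℂ) • (A q).map Complex.ofReal := by
    ext i j; simp
  rw [this, Matrix.mul_smul, Matrix.smul_mul, neg_smul]

lemma hasDerivAt_trace_mul_matResolvent_linComb (hA : ∀ q, (A q).IsHermitian) (hz : 0 < z.im)
    (B : Matrix n n ℂ) (ξ : Q → ℝ) (q : Q) :
    HasDerivAt (fun x : ℝ => (B * matResolvent (linComb A (Function.update ξ q x)) z).trace)
      (-(B * matResolvent (linComb A ξ) z * (A q).map Complex.ofReal *
        matResolvent (linComb A ξ) z).trace) (ξ q) := by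
  set D := (A q).map Complex.ofReal with hD
  set R : ℝ → Matrix n n ℂ := fun x => matResolvent (linComb A (Function.update ξ q x)) z with hR
  have hR0 : matResolvent (linComb A ξ) z = R (ξ q) := by simp [hR]
  have hRn : ∀ x, ‖R x‖ ≤ z.im⁻¹ := fun x => norm_matResolvent_le (isHermitian_linComb hA _) hz
  have hsub : ∀ x y, R x - R y = -((x - y : ℝ) : ℂ) • (R x * D * R y) :=
    fun x y => matResolvent_linComb_update_sub hA hz ξ q x y
  have hcont : Tendsto R (𝓝 (ξ q)) (𝓝 (R (ξ q))) := by
    rw [tendsto_iff_norm_sub_tendsto_zero]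
    refine squeeze_zero (g := fun x => |x - ξ q| * (z.im⁻¹ * ‖D‖ * z.im⁻¹))
      (fun x => norm_nonneg _) (fun x => ?_) ?_
    · rw [hsub, norm_smul, norm_neg, Complex.norm_real, Real.norm_eq_abs]
      gcongr
      refine (norm_mul_le _ _).trans ?_
      have := hRn x
      have := hRn (ξ q)
      gcongr
      refine (norm_mul_le _ _).trans ?_
      gcongr
    · have : Tendsto (fun x => |x - ξ q| * (z.im⁻¹ * ‖D‖ * z.im⁻¹)) (𝓝 (ξ q))
          (𝓝 (|ξ q - ξ q| * (z.im⁻¹ * ‖D‖ * z.im⁻¹))) :=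
        (Continuous.tendsto (by fun_prop) _)
      simpa using this
  rw [hasDerivAt_iff_tendsto_slope, hR0]
  have h1 : Tendsto (fun x => -(B * R x * D * R (ξ q)).trace) (𝓝[≠] (ξ q))
      (𝓝 (-(B * R (ξ q) * D * R (ξ q)).trace)) := by
    rw [tendsto_iff_norm_sub_tendsto_zero]
    have h2 := (tendsto_iff_norm_sub_tendsto_zero.1 hcont).const_mul
      (Fintype.card n * (‖B‖ * ‖D‖ * ‖R (ξ q)‖))
    rw [mul_zero] at h2
    refine squeeze_zero (fun _ => norm_nonneg _) (fun x => ?_) (h2.mono_left nhdsWithin_le_nhds)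
    have h3 : -(B * R x * D * R (ξ q)).trace - -(B * R (ξ q) * D * R (ξ q)).trace =
        -(B * (R x - R (ξ q)) * D * R (ξ q)).trace := by
      rw [Matrix.mul_sub, Matrix.sub_mul, Matrix.sub_mul, Matrix.trace_sub]
      ring
    rw [h3, norm_neg]
    refine (norm_trace_le _).trans ?_
    rw [mul_assoc (Fintype.card n : ℝ)]
    refine mul_le_mul_of_nonneg_left ?_ (Nat.cast_nonneg _)
    calc ‖B * (R x - R (ξ q)) * D * R (ξ q)‖ ≤ ‖B * (R x - R (ξ q)) * D‖ * ‖R (ξ q)‖ :=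
          norm_mul_le _ _
      _ ≤ ‖B * (R x - R (ξ q))‖ * ‖D‖ * ‖R (ξ q)‖ := by gcongr; exact norm_mul_le _ _
      _ ≤ ‖B‖ * ‖R x - R (ξ q)‖ * ‖D‖ * ‖R (ξ q)‖ := by gcongr; exact norm_mul_le _ _
      _ = _ := by ring
  refine h1.congr' ?_
  filter_upwards [self_mem_nhdsWithin] with x hx
  have hx' : ((x - ξ q : ℝ) : ℂ) ≠ 0 := by
    exact_mod_cast sub_ne_zero.2 hx
  rw [slope_def_module, ← Matrix.trace_sub, ← Matrix.mul_sub]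
  change _ = (x - ξ q)⁻¹ • (B * (R x - R (ξ q))).trace
  rw [hsub, Matrix.mul_smul, Matrix.trace_smul, Complex.real_smul, smul_eq_mul]
  simp only [Matrix.mul_assoc]
  push_cast at hx' ⊢
  field_simp

/-- Gaussian integration by parts for the resolvent. -/
lemma integral_trace_mul_linComb_mul_matResolvent (hA : ∀ q, (A q).IsHermitian) (hz : 0 < z.im)
    (B : Matrix n n ℂ) :
    ∫ ξ, (B * (linComb A ξ).map Complex.ofReal * matResolvent (linComb A ξ) z).trace
        ∂(gaussianPi Q) =
      -∫ ξ, ∑ q, (B * (A q).map Complex.ofReal * matResolvent (linComb A ξ) z *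
        (A q).map Complex.ofReal * matResolvent (linComb A ξ) z).trace ∂(gaussianPi Q) := by
  have h1 : ∀ ξ, (B * (linComb A ξ).map Complex.ofReal * matResolvent (linComb A ξ) z).trace =
      ∑ q, (ξ q : ℂ) * (B * (A q).map Complex.ofReal * matResolvent (linComb A ξ) z).trace := by
    intro ξ
    have : (linComb A ξ).map Complex.ofReal = ∑ q, (ξ q : ℂ) • (A q).map Complex.ofReal := by
      ext i j
      simp [linComb_apply, Matrix.sum_apply]
    rw [this, Matrix.mul_sum, Matrix.sum_mul, Matrix.trace_sum]
    simp [Matrix.trace_smul]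
  simp_rw [h1]
  rw [integral_finsetSum, integral_finsetSum, ← Finset.sum_neg_distrib]
  · refine Finset.sum_congr rfl fun q _ => ?_
    rw [integral_coord_mul_gaussianPi q
      (fun ξ => hasDerivAt_trace_mul_matResolvent_linComb hA hz _ ξ q)
      (measurable_trace_mul_matResolvent_linComb _)
      (measurable_trace_mul_mul_matResolvent_linComb _ _).neg
      (norm_trace_mul_matResolvent_linComb_le hA hz _)
      (fun ξ => (norm_neg _).le.trans (norm_trace_mul_mul_matResolvent_linComb_le hA hz _ _ ξ)),
      ← integral_neg]
    rfl
  · intro q _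
    exact Integrable.of_bound (measurable_trace_mul_mul_matResolvent_linComb _ _).aestronglyMeasurable
      _ (Eventually.of_forall (norm_trace_mul_mul_matResolvent_linComb_le hA hz _ _))
  · intro q _
    exact Integrable.mul_bdd (integrable_coord_gaussianPi q).ofReal
      (measurable_trace_mul_matResolvent_linComb _).aestronglyMeasurable
      (Eventually.of_forall (norm_trace_mul_matResolvent_linComb_le hA hz _))

/-- Variance bound for linear statistics of the resolvent. -/
lemma integral_norm_trace_sub_sq_le (hA : ∀ q, (A q).IsHermitian) (hz : 0 < z.im)
    (B : Matrix n n ℂ) :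
    ∫ ξ, ‖(B * matResolvent (linComb A ξ) z).trace -
        ∫ ζ, (B * matResolvent (linComb A ζ) z).trace ∂(gaussianPi Q)‖ ^ 2 ∂(gaussianPi Q) ≤
      ∑ q, (‖B‖ * z.im⁻¹ ^ 2 * ∑ i, ∑ j, |A q i j|) ^ 2 := by
  refine integral_norm_sub_sq_le (measurable_trace_mul_matResolvent_linComb _)
    (norm_trace_mul_matResolvent_linComb_le hA hz B) fun q ξ x y => ?_
  rw [← Matrix.trace_sub, ← Matrix.mul_sub, matResolvent_linComb_update_sub hA hz,
    Matrix.mul_smul, Matrix.trace_smul, norm_smul, norm_neg, Complex.norm_real,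
    Real.norm_eq_abs, mul_comm _ |x - y|]
  gcongr
  set R1 := matResolvent (linComb A (Function.update ξ q x)) z with hR1
  set R2 := matResolvent (linComb A (Function.update ξ q y)) z with hR2
  have h1 : ‖R1‖ ≤ z.im⁻¹ := norm_matResolvent_le (isHermitian_linComb hA _) hz
  have h2 : ‖R2‖ ≤ z.im⁻¹ := norm_matResolvent_le (isHermitian_linComb hA _) hz
  have h3 : (B * (R1 * (A q).map Complex.ofReal * R2)).trace =
      (R2 * B * R1 * (A q).map Complex.ofReal).trace := by
    rw [← Matrix.mul_assoc, Matrix.trace_mul_comm]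
    simp only [Matrix.mul_assoc]
  rw [h3]
  refine (norm_trace_mul_ofReal_le _ _).trans ?_
  gcongr
  refine (norm_mul_le _ _).trans ?_
  calc ‖R2 * B‖ * ‖R1‖ ≤ (z.im⁻¹ * ‖B‖) * z.im⁻¹ := by
        gcongr
        exact (norm_mul_le _ _).trans (by gcongr)
    _ = ‖B‖ * z.im⁻¹ ^ 2 := by ring

end GaussianMatrix

section Circulant

open ProbabilityTheory Topology
open scoped Matrix.Norms.L2Operator

lemma trace_mul_single_mul_single {n : Type*} [Fintype n] [DecidableEq n] (B R : Matrix n n ℂ)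
    (a b c d : n) :
    (B * Matrix.single a b 1 * R * Matrix.single c d 1 * R).trace = (R * B) d a * R b c := by
  have : (B * Matrix.single a b 1 * R * Matrix.single c d 1 * R).trace =
      (Matrix.single a b 1 * R * Matrix.single c d 1 * (R * B)).trace := by
    rw [← Matrix.mul_assoc, Matrix.trace_mul_comm _ B]
    simp only [Matrix.mul_assoc]
  rw [this, Matrix.single_mul_mul_single, Matrix.trace_single_mul]
  ring

lemma sum_norm_sq_mul_le {n : Type*} [Fintype n] [DecidableEq n] (R B : Matrix n n ℂ) :
    ∑ i, ∑ j, ‖(R * B) i j‖ ^ 2 ≤ ‖R‖ ^ 2 * ∑ i, ∑ j, ‖B i j‖ ^ 2 := by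
  rw [Finset.sum_comm, Finset.sum_comm (f := fun i j => ‖B i j‖ ^ 2), Finset.mul_sum]
  refine Finset.sum_le_sum fun j _ => ?_
  have h := Matrix.l2_opNorm_mulVec R (WithLp.toLp 2 (fun i => B i j))
  have h3 := pow_le_pow_left₀ (norm_nonneg _) h 2
  rw [mul_pow, EuclideanSpace.norm_sq_eq, EuclideanSpace.norm_sq_eq] at h3
  exact h3

variable {Z J : Type*} [AddCommGroup Z] [Fintype Z] [DecidableEq Z] [Fintype J]

/-- The contribution of one noise variable to the symmetrized circulant moving average. -/
noncomputable def circMat (p : J → ℝ) (s t : J → Z) (q : Z × Z) : Matrix Z Z ℝ :=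
  ∑ j, p j • (Matrix.single (q.1 - s j) (q.2 - t j) 1 + Matrix.single (q.2 - t j) (q.1 - s j) 1)

variable (p : J → ℝ) (s t : J → Z)

omit [Fintype Z] in
lemma map_circMat (q : Z × Z) : (circMat p s t q).map Complex.ofReal =
    ∑ j, (p j : ℂ) • (Matrix.single (q.1 - s j) (q.2 - t j) 1 +
      Matrix.single (q.2 - t j) (q.1 - s j) 1) := by
  ext a b
  simp only [circMat, Matrix.map_apply, Matrix.sum_apply, Matrix.smul_apply, Matrix.add_apply,
    smul_eq_mul, Complex.ofReal_sum, Complex.ofReal_mul, Complex.ofReal_add, Matrix.single_apply]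
  congr! <;> split_ifs <;> simp

omit [Fintype Z] in
lemma isHermitian_circMat (q : Z × Z) : (circMat p s t q).IsHermitian := by
  unfold circMat Matrix.IsHermitian
  rw [Matrix.conjTranspose_sum]
  refine Finset.sum_congr rfl fun j _ => ?_
  rw [Matrix.conjTranspose_smul, Matrix.conjTranspose_add, Matrix.conjTranspose_single,
    Matrix.conjTranspose_single, add_comm]
  simp

lemma sum_abs_circMat_le (q : Z × Z) : ∑ a, ∑ b, |circMat p s t q a b| ≤ 2 * ∑ j, |p j| := by
  have h1 : ∀ a b, |circMat p s t q a b| ≤ ∑ j, |p j| *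
      (Matrix.single (q.1 - s j) (q.2 - t j) (1 : ℝ) a b +
        Matrix.single (q.2 - t j) (q.1 - s j) (1 : ℝ) a b) := by
    intro a b
    simp only [circMat, Matrix.sum_apply, Matrix.smul_apply, Matrix.add_apply, smul_eq_mul]
    refine (Finset.abs_sum_le_sum_abs _ _).trans (Finset.sum_le_sum fun j _ => ?_)
    rw [abs_mul]
    refine le_of_eq ?_
    congr 1
    refine abs_of_nonneg (add_nonneg ?_ ?_) <;> rw [Matrix.single_apply] <;> split_ifs <;> simp
  have h2 : ∀ c d : Z, ∑ a, ∑ b, Matrix.single c d (1 : ℝ) a b = 1 := by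
    intro c d
    rw [Finset.sum_eq_single c, Finset.sum_eq_single d]
    · simp
    · intro b _ hb; simp [hb.symm]
    · simp
    · intro a _ ha; simp [ha.symm]
    · simp
  refine (Finset.sum_le_sum fun a _ => Finset.sum_le_sum fun b _ => h1 a b).trans (le_of_eq ?_)
  simp_rw [Finset.sum_comm (s := Finset.univ (α := Z)) (t := Finset.univ (α := J)),
      ← Finset.mul_sum,
    Finset.sum_add_distrib, h2]
  rw [← Finset.sum_mul]
  ring

lemma sum_trace_circMat (B R : Matrix Z Z ℂ) :
    ∑ q, (B * (circMat p s t q).map Complex.ofReal * R *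
      (circMat p s t q).map Complex.ofReal * R).trace =
    ∑ j, ∑ k, (p j : ℂ) * p k * ∑ a, ∑ b,
      ((R * B) (b + (t j - t k)) a * R b (a + (s j - s k)) +
      (R * B) (a + (s j - s k)) a * R b (b + (t j - t k)) +
      (R * B) (b + (t j - t k)) b * R a (a + (s j - s k)) +
      (R * B) (a + (s j - s k)) b * R a (b + (t j - t k))) := by
  have h1 : ∀ q : Z × Z, (B * (circMat p s t q).map Complex.ofReal * R *
      (circMat p s t q).map Complex.ofReal * R).trace = ∑ j, ∑ k, (p j : ℂ) * p k *
      ((R * B) (q.2 - t k) (q.1 - s j) * R (q.2 - t j) (q.1 - s k) +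
      (R * B) (q.1 - s k) (q.1 - s j) * R (q.2 - t j) (q.2 - t k) +
      (R * B) (q.2 - t k) (q.2 - t j) * R (q.1 - s j) (q.1 - s k) +
      (R * B) (q.1 - s k) (q.2 - t j) * R (q.1 - s j) (q.2 - t k)) := by
    intro q
    rw [map_circMat]
    simp only [Matrix.mul_sum, Matrix.sum_mul, Matrix.trace_sum]
    rw [Finset.sum_comm]
    refine Finset.sum_congr rfl fun j _ => Finset.sum_congr rfl fun k _ => ?_
    simp only [Matrix.mul_smul, Matrix.smul_mul, Matrix.trace_smul, Matrix.mul_add,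
      Matrix.add_mul, Matrix.trace_add, trace_mul_single_mul_single, smul_eq_mul]
    ring
  simp_rw [h1]
  rw [Finset.sum_comm]
  refine Finset.sum_congr rfl fun j _ => ?_
  rw [Finset.sum_comm]
  refine Finset.sum_congr rfl fun k _ => ?_
  rw [← Finset.mul_sum, Fintype.sum_prod_type, ← Equiv.sum_comp (Equiv.addRight (s j))]
  congr 1
  refine Finset.sum_congr rfl fun a _ => ?_
  rw [← Equiv.sum_comp (Equiv.addRight (t j))]
  refine Finset.sum_congr rfl fun b _ => ?_
  simp only [Equiv.coe_addRight, add_sub_cancel_right, add_sub_assoc]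


/-- The rank one matrix `χ(x - y) / |Z|`. -/
noncomputable def charMat (χ : AddChar Z ℂ) : Matrix Z Z ℂ :=
  Matrix.of fun x y => (Fintype.card Z : ℂ)⁻¹ * χ (x - y)

omit [DecidableEq Z] in
lemma card_pos_real : (0 : ℝ) < Fintype.card Z :=
  Nat.cast_pos.2 Fintype.card_pos

omit [DecidableEq Z] in
lemma trace_charMat (χ : AddChar Z ℂ) : (charMat χ).trace = 1 := by
  simp [charMat, Matrix.trace]

omit [DecidableEq Z] in
lemma sum_norm_sq_charMat (χ : AddChar Z ℂ) : ∑ a, ∑ b, ‖charMat χ a b‖ ^ 2 = 1 := by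
  have := (card_pos_real (Z := Z)).ne'
  simp [charMat]
  field_simp

omit [DecidableEq Z] in
lemma trace_charMat_mul (χ : AddChar Z ℂ) (R : Matrix Z Z ℂ) :
    (charMat χ * R).trace = (Fintype.card Z : ℂ)⁻¹ * ∑ a, ∑ b, χ (b - a) * R a b := by
  simp only [Matrix.trace, Matrix.diag_apply, Matrix.mul_apply, charMat, Matrix.of_apply]
  rw [Finset.sum_comm, Finset.mul_sum]
  refine Finset.sum_congr rfl fun a _ => ?_
  rw [Finset.mul_sum]
  refine Finset.sum_congr rfl fun b _ => ?_
  ring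

omit [DecidableEq Z] in
lemma sum_mul_charMat_shift (χ : AddChar Z ℂ) (R : Matrix Z Z ℂ) (u : Z) :
    ∑ a, (R * charMat χ) (a + u) a = χ u * (charMat χ * R).trace := by
  have h := (Equiv.sum_comp (Equiv.addRight u) (fun a => ∑ b, χ (b - a) * R a b)).symm
  rw [trace_charMat_mul, h, Finset.mul_sum, Finset.mul_sum]
  refine Finset.sum_congr rfl fun a _ => ?_
  simp only [Matrix.mul_apply, charMat, Matrix.of_apply, Equiv.coe_addRight]
  rw [Finset.mul_sum, Finset.mul_sum]
  refine Finset.sum_congr rfl fun b _ => ?_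
  have : b - a = u + (b - (a + u)) := by abel
  rw [this, AddChar.map_add_eq_mul]
  ring

/-- The normalized sum of `R` along a cyclic diagonal. -/
noncomputable def diagAvg (R : Matrix Z Z ℂ) (u : Z) : ℂ :=
  (Fintype.card Z : ℂ)⁻¹ * ∑ b, R b (b + u)

omit [DecidableEq Z] in
lemma trace_charMat_mul_eq_sum (χ : AddChar Z ℂ) (R : Matrix Z Z ℂ) :
    (charMat χ * R).trace = ∑ u, χ u * diagAvg R u := by
  rw [trace_charMat_mul]
  have : ∀ a, ∑ b, χ (b - a) * R a b = ∑ u, χ u * R a (a + u) := by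
    intro a
    rw [← Equiv.sum_comp (Equiv.addLeft a)]
    simp
  simp_rw [this, diagAvg]
  rw [Finset.sum_comm, Finset.mul_sum]
  refine Finset.sum_congr rfl fun u _ => ?_
  rw [← Finset.mul_sum]
  ring

omit [DecidableEq Z] in
lemma trace_charMat_mul_eq_dotProduct (χ : AddChar Z ℂ) (R : Matrix Z Z ℂ) :
    (charMat χ * R).trace = (Fintype.card Z : ℂ)⁻¹ * (star (⇑χ) ⬝ᵥ R.mulVec χ) := by
  rw [trace_charMat_mul]
  congr 1
  simp only [dotProduct, Matrix.mulVec, Pi.star_apply, Finset.mul_sum]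
  refine Finset.sum_congr rfl fun a _ => Finset.sum_congr rfl fun b _ => ?_
  have h : star (χ a) = χ (-a) := by
    rw [AddChar.map_neg_eq_inv, Complex.inv_def, Complex.normSq_eq_norm_sq, AddChar.norm_apply]
    simp
  rw [h, sub_eq_add_neg, AddChar.map_add_eq_mul]
  ring

lemma norm_trace_charMat_mul_le (χ : AddChar Z ℂ) (R : Matrix Z Z ℂ) :
    ‖(charMat χ * R).trace‖ ≤ ‖R‖ := by
  rw [trace_charMat_mul_eq_dotProduct, norm_mul, norm_inv, Complex.norm_natCast]
  set v : EuclideanSpace ℂ Z := WithLp.toLp 2 (⇑χ) with hv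
  have hvn : ‖v‖ ^ 2 = Fintype.card Z := by
    rw [EuclideanSpace.norm_sq_eq]
    simp [hv]
  have h1 : star (⇑χ) ⬝ᵥ R.mulVec χ = inner ℂ v (WithLp.toLp 2 (R.mulVec χ)) := by
    rw [EuclideanSpace.inner_eq_star_dotProduct, dotProduct_comm]
  have h2 : ‖star (⇑χ) ⬝ᵥ R.mulVec χ‖ ≤ Fintype.card Z * ‖R‖ := by
    rw [h1]
    refine (norm_inner_le_norm _ _).trans ?_
    have := Matrix.l2_opNorm_mulVec R v
    calc ‖v‖ * ‖WithLp.toLp 2 (R.mulVec χ)‖ ≤ ‖v‖ * (‖R‖ * ‖v‖) := by gcongr; exact this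
      _ = ‖v‖ ^ 2 * ‖R‖ := by ring
      _ = _ := by rw [hvn]
  rw [inv_mul_le_iff₀ card_pos_real]
  exact h2

lemma norm_diagAvg_le (R : Matrix Z Z ℂ) (u : Z) : ‖diagAvg R u‖ ≤ ‖R‖ := by
  unfold diagAvg
  rw [norm_mul, norm_inv, Complex.norm_natCast, inv_mul_le_iff₀ card_pos_real]
  refine (norm_sum_le _ _).trans ((Finset.sum_le_sum fun b _ =>
    norm_entry_le_l2_opNorm R b (b + u)).trans ?_)
  simp

lemma norm_sum_mul_comp_le {X : Type*} [Fintype X] (f g : X → ℂ) (e e' : X ≃ X) :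
    ‖∑ x, f (e x) * g (e' x)‖ ≤ √(∑ x, ‖f x‖ ^ 2) * √(∑ x, ‖g x‖ ^ 2) := by
  refine (norm_sum_le _ _).trans ?_
  simp only [norm_mul]
  refine (Real.sum_mul_le_sqrt_mul_sqrt _ _ _).trans (le_of_eq ?_)
  rw [Equiv.sum_comp e (fun x => ‖f x‖ ^ 2), Equiv.sum_comp e' (fun x => ‖g x‖ ^ 2)]

omit [DecidableEq Z] in
lemma norm_sum_shift_mul_shift_le (M R : Matrix Z Z ℂ) (u v : Z) :
    ‖∑ a, ∑ b, M (b + v) a * R b (a + u)‖ ≤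
      √(∑ a, ∑ b, ‖M a b‖ ^ 2) * √(∑ a, ∑ b, ‖R a b‖ ^ 2) := by
  have h := norm_sum_mul_comp_le (fun x : Z × Z => M x.1 x.2) (fun x : Z × Z => R x.1 x.2)
    ((Equiv.prodComm Z Z).trans ((Equiv.addRight v).prodCongr (Equiv.refl Z)))
    ((Equiv.prodComm Z Z).trans ((Equiv.refl Z).prodCongr (Equiv.addRight u)))
  simpa [Fintype.sum_prod_type] using h

omit [DecidableEq Z] in
lemma norm_sum_shift_mul_shift_le' (M R : Matrix Z Z ℂ) (u v : Z) :
    ‖∑ a, ∑ b, M (a + u) b * R a (b + v)‖ ≤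
      √(∑ a, ∑ b, ‖M a b‖ ^ 2) * √(∑ a, ∑ b, ‖R a b‖ ^ 2) := by
  have h := norm_sum_mul_comp_le (fun x : Z × Z => M x.1 x.2) (fun x : Z × Z => R x.1 x.2)
    ((Equiv.addRight u).prodCongr (Equiv.refl Z)) ((Equiv.refl Z).prodCongr (Equiv.addRight v))
  simpa [Fintype.sum_prod_type] using h

/-- The self-energy term of the Schwinger-Dyson equation. -/
noncomputable def selfEnergy (χ : AddChar Z ℂ) (ρ : Z → ℂ) : ℂ :=
  ∑ j, ∑ k, (p j : ℂ) * p k * (χ (s j - s k) * ρ (t j - t k) + χ (t j - t k) * ρ (s j - s k))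

lemma norm_sum_trace_circMat_sub_le (χ : AddChar Z ℂ) (R : Matrix Z Z ℂ) :
    ‖(Fintype.card Z : ℂ)⁻¹ * ∑ q, (charMat χ * (circMat p s t q).map Complex.ofReal * R *
      (circMat p s t q).map Complex.ofReal * R).trace -
      selfEnergy p s t χ (diagAvg R) * (charMat χ * R).trace‖ ≤
    2 * (∑ j, |p j|) ^ 2 * ‖R‖ ^ 2 / √(Fintype.card Z) := by
  set n : ℝ := ((Fintype.card Z : ℕ) : ℝ) with hn
  have hn0 : 0 < n := card_pos_real
  set M := R * charMat χ with hM
  have hF : √(∑ a, ∑ b, ‖M a b‖ ^ 2) * √(∑ a, ∑ b, ‖R a b‖ ^ 2) ≤ √n * ‖R‖ ^ 2 := by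
    have h1 : √(∑ a, ∑ b, ‖M a b‖ ^ 2) ≤ ‖R‖ := by
      refine Real.sqrt_le_iff.2 ⟨norm_nonneg _, (sum_norm_sq_mul_le _ _).trans ?_⟩
      rw [sum_norm_sq_charMat, mul_one]
    have h2 : √(∑ a, ∑ b, ‖R a b‖ ^ 2) ≤ √n * ‖R‖ := by
      refine Real.sqrt_le_iff.2 ⟨by positivity, (sum_norm_sq_le_card_mul _).trans ?_⟩
      rw [mul_pow, Real.sq_sqrt hn0.le]
    calc _ ≤ ‖R‖ * (√n * ‖R‖) := by gcongr
      _ = _ := by ring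
  set E1 : J → J → ℂ := fun j k => ∑ a, ∑ b, M (b + (t j - t k)) a * R b (a + (s j - s k)) with hE1
  set E2 : J → J → ℂ := fun j k => ∑ a, ∑ b, M (a + (s j - s k)) b * R a (b + (t j - t k)) with hE2
  have hE : ∀ j k, ‖E1 j k + E2 j k‖ ≤ 2 * (√n * ‖R‖ ^ 2) := by
    intro j k
    refine (norm_add_le _ _).trans ?_
    have h1 := (norm_sum_shift_mul_shift_le M R (s j - s k) (t j - t k)).trans hF
    have h2 := (norm_sum_shift_mul_shift_le' M R (s j - s k) (t j - t k)).trans hF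
    linarith
  have key : (Fintype.card Z : ℂ)⁻¹ * ∑ q, (charMat χ * (circMat p s t q).map Complex.ofReal * R *
      (circMat p s t q).map Complex.ofReal * R).trace -
      selfEnergy p s t χ (diagAvg R) * (charMat χ * R).trace =
      (Fintype.card Z : ℂ)⁻¹ * ∑ j, ∑ k, (p j : ℂ) * p k * (E1 j k + E2 j k) := by
    rw [sum_trace_circMat, selfEnergy, Finset.sum_mul, Finset.mul_sum, Finset.mul_sum,
      ← Finset.sum_sub_distrib]
    refine Finset.sum_congr rfl fun j _ => ?_
    rw [Finset.sum_mul, Finset.mul_sum, Finset.mul_sum, ← Finset.sum_sub_distrib]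
    refine Finset.sum_congr rfl fun k _ => ?_
    have e1 : ∑ a, ∑ b, M (a + (s j - s k)) a * R b (b + (t j - t k)) =
        χ (s j - s k) * (charMat χ * R).trace * ∑ b, R b (b + (t j - t k)) := by
      rw [← sum_mul_charMat_shift, Finset.sum_mul_sum]
    have e2 : ∑ a, ∑ b, M (b + (t j - t k)) b * R a (a + (s j - s k)) =
        χ (t j - t k) * (charMat χ * R).trace * ∑ b, R b (b + (s j - s k)) := by
      rw [← sum_mul_charMat_shift, Finset.sum_mul_sum, Finset.sum_comm]
    simp only [Finset.sum_add_distrib]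
    rw [← hM, e1, e2, diagAvg, diagAvg]
    simp only [hE1, hE2]
    ring
  rw [key, norm_mul, norm_inv, Complex.norm_natCast]
  have h3 : ‖∑ j, ∑ k, (p j : ℂ) * p k * (E1 j k + E2 j k)‖ ≤
      (∑ j, |p j|) ^ 2 * (2 * (√n * ‖R‖ ^ 2)) := by
    rw [sq, Finset.sum_mul_sum, Finset.sum_mul]
    refine (norm_sum_le _ _).trans (Finset.sum_le_sum fun j _ => ?_)
    rw [Finset.sum_mul]
    refine (norm_sum_le _ _).trans (Finset.sum_le_sum fun k _ => ?_)
    rw [norm_mul, norm_mul, Complex.norm_real, Complex.norm_real, Real.norm_eq_abs,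
      Real.norm_eq_abs]
    gcongr
    exact hE j k
  calc n⁻¹ * _ ≤ n⁻¹ * ((∑ j, |p j|) ^ 2 * (2 * (√n * ‖R‖ ^ 2))) := by gcongr
    _ = 2 * (∑ j, |p j|) ^ 2 * ‖R‖ ^ 2 * (√n / n) := by ring
    _ = _ := by rw [Real.sqrt_div_self']; ring

end Circulant

section SchwingerDyson

open ProbabilityTheory Topology
open scoped Matrix.Norms.L2Operator

variable {Z J : Type*} [AddCommGroup Z] [Fintype Z] [DecidableEq Z] [Fintype J]
variable (p : J → ℝ) (s t : J → Z) {z : ℂ}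

/-- The normalized circulant coefficients, one matrix for every noise variable. -/
noncomputable def circEnsemble (q : Z × Z) : Matrix Z Z ℝ :=
  (√(Fintype.card Z))⁻¹ • circMat p s t q

lemma isHermitian_circEnsemble (q : Z × Z) : (circEnsemble p s t q).IsHermitian := by
  unfold circEnsemble Matrix.IsHermitian
  rw [Matrix.conjTranspose_smul, (isHermitian_circMat p s t q).eq]
  simp

lemma sum_abs_circEnsemble_le (q : Z × Z) :
    ∑ a, ∑ b, |circEnsemble p s t q a b| ≤ (√(Fintype.card Z))⁻¹ * (2 * ∑ j, |p j|) := by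
  simp only [circEnsemble, Matrix.smul_apply, smul_eq_mul, abs_mul, ← Finset.mul_sum]
  rw [abs_of_nonneg (inv_nonneg.2 (Real.sqrt_nonneg _))]
  gcongr
  exact sum_abs_circMat_le p s t q

/-- The resolvent of the circulant ensemble, as a function of the noise. -/
noncomputable def circResolvent (z : ℂ) (ξ : Z × Z → ℝ) : Matrix Z Z ℂ :=
  matResolvent (linComb (circEnsemble p s t) ξ) z

/-- The mean cyclic diagonal averages of the resolvent. -/
noncomputable def meanDiag (z : ℂ) (u : Z) : ℂ :=
  ∫ ξ, diagAvg (circResolvent p s t z ξ) u ∂(gaussianPi (Z × Z))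

/-- The mean diagonal entries of the resolvent in the basis of characters. -/
noncomputable def meanChar (z : ℂ) (χ : AddChar Z ℂ) : ℂ :=
  ∫ ξ, (charMat χ * circResolvent p s t z ξ).trace ∂(gaussianPi (Z × Z))

variable {p s t}

lemma norm_circResolvent_le (hz : 0 < z.im) (ξ : Z × Z → ℝ) :
    ‖circResolvent p s t z ξ‖ ≤ z.im⁻¹ :=
  norm_matResolvent_le (isHermitian_linComb (isHermitian_circEnsemble p s t) _) hz

lemma diagAvg_eq_trace (R : Matrix Z Z ℂ) (u : Z) :
    diagAvg R u = (((Fintype.card Z : ℂ)⁻¹ •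
      Equiv.Perm.permMatrix ℂ (Equiv.subRight u : Equiv.Perm Z)) * R).trace := by
  rw [Matrix.smul_mul, Matrix.trace_smul, diagAvg, smul_eq_mul]
  congr 1
  simp only [Matrix.trace, Matrix.diag_apply]
  have : ∀ i, (Equiv.Perm.permMatrix ℂ (Equiv.subRight u : Equiv.Perm Z) * R) i i =
      R (i - u) i := by
    intro i
    rw [Equiv.Perm.permMatrix, PEquiv.toMatrix_toPEquiv_mul, Matrix.submatrix_apply]
    rfl
  have h := (Equiv.sum_comp (Equiv.addRight u) (fun i => R (i - u) i)).symm
  simp_rw [this, h]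
  simp

lemma norm_smul_permMatrix_le (u : Z) : ‖(Fintype.card Z : ℂ)⁻¹ •
      Equiv.Perm.permMatrix ℂ (Equiv.subRight u : Equiv.Perm Z)‖ ≤ (Fintype.card Z : ℝ)⁻¹ := by
  rw [norm_smul, norm_inv, Complex.norm_natCast]
  exact mul_le_of_le_one_right (by positivity) (Matrix.permMatrix_l2_opNorm_le _)

lemma integrable_of_norm_le {X E : Type*} [MeasurableSpace X] [NormedAddCommGroup E]
    {μ : Measure X} [IsFiniteMeasure μ] {F : X → E} (hF : AEStronglyMeasurable F μ) {C : ℝ}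
    (h : ∀ x, ‖F x‖ ≤ C) : Integrable F μ :=
  Integrable.of_bound hF C (Eventually.of_forall h)

lemma measurable_diagAvg_circResolvent (u : Z) :
    Measurable fun ξ => diagAvg (circResolvent p s t z ξ) u := by
  simp_rw [diagAvg_eq_trace]
  exact measurable_trace_mul_matResolvent_linComb _

lemma measurable_trace_charMat_mul_circResolvent (χ : AddChar Z ℂ) :
    Measurable fun ξ => (charMat χ * circResolvent p s t z ξ).trace :=
  measurable_trace_mul_matResolvent_linComb _

lemma integrable_diagAvg_circResolvent (hz : 0 < z.im) (u : Z) :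
    Integrable (fun ξ => diagAvg (circResolvent p s t z ξ) u) (gaussianPi (Z × Z)) :=
  integrable_of_norm_le (measurable_diagAvg_circResolvent u).aestronglyMeasurable
    fun ξ => (norm_diagAvg_le _ u).trans (norm_circResolvent_le hz ξ)

lemma integrable_trace_charMat_mul_circResolvent (hz : 0 < z.im) (χ : AddChar Z ℂ) :
    Integrable (fun ξ => (charMat χ * circResolvent p s t z ξ).trace) (gaussianPi (Z × Z)) :=
  integrable_of_norm_le (measurable_trace_charMat_mul_circResolvent χ).aestronglyMeasurable
    fun ξ => (norm_trace_charMat_mul_le _ _).trans (norm_circResolvent_le hz ξ)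

lemma norm_meanDiag_le (hz : 0 < z.im) (u : Z) : ‖meanDiag p s t z u‖ ≤ z.im⁻¹ := by
  refine (norm_integral_le_of_norm_le_const (Eventually.of_forall fun ξ =>
    (norm_diagAvg_le _ u).trans (norm_circResolvent_le hz ξ))).trans ?_
  simp

lemma meanChar_eq_sum (hz : 0 < z.im) (χ : AddChar Z ℂ) :
    meanChar p s t z χ = ∑ u, χ u * meanDiag p s t z u := by
  unfold meanChar meanDiag
  simp_rw [trace_charMat_mul_eq_sum]
  rw [integral_finsetSum _ fun u _ => (integrable_diagAvg_circResolvent hz u).const_mul _]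
  simp_rw [integral_const_mul]

lemma im_meanChar_nonneg (hz : 0 < z.im) (χ : AddChar Z ℂ) : 0 ≤ (meanChar p s t z χ).im := by
  have h := integral_im (integrable_trace_charMat_mul_circResolvent (p := p) (s := s) (t := t) hz χ)
  simp only [RCLike.im_eq_complex_im] at h
  unfold meanChar
  rw [← h]
  refine integral_nonneg fun ξ => ?_
  simp only [Pi.zero_apply]
  rw [trace_charMat_mul_eq_dotProduct]
  have h2 := im_matResolvent_nonneg (isHermitian_linComb (isHermitian_circEnsemble p s t) ξ) hz χ
  have h3 : (Fintype.card Z : ℂ)⁻¹ = (((Fintype.card Z : ℝ)⁻¹ : ℝ) : ℂ) := by push_cast; rfl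
  rw [h3, Complex.im_ofReal_mul]
  exact mul_nonneg (by positivity) h2

lemma integral_norm_diagAvg_sub_sq_le (hz : 0 < z.im) (u : Z) :
    ∫ ξ, ‖diagAvg (circResolvent p s t z ξ) u - meanDiag p s t z u‖ ^ 2 ∂(gaussianPi (Z × Z)) ≤
      (2 * (∑ j, |p j|) * z.im⁻¹ ^ 2) ^ 2 / Fintype.card Z := by
  have hn : (0 : ℝ) < Fintype.card Z := card_pos_real
  unfold meanDiag
  simp_rw [diagAvg_eq_trace]
  refine (integral_norm_trace_sub_sq_le (isHermitian_circEnsemble p s t) hz _).trans ?_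
  have h : ∀ q ∈ (Finset.univ : Finset (Z × Z)), (‖(Fintype.card Z : ℂ)⁻¹ •
      Equiv.Perm.permMatrix ℂ (Equiv.subRight u : Equiv.Perm Z)‖ * z.im⁻¹ ^ 2 *
      ∑ i, ∑ j, |circEnsemble p s t q i j|) ^ 2 ≤ ((Fintype.card Z : ℝ)⁻¹ * z.im⁻¹ ^ 2 *
      ((√(Fintype.card Z))⁻¹ * (2 * ∑ j, |p j|))) ^ 2 := by
    intro q _
    gcongr
    · exact norm_smul_permMatrix_le u
    · exact sum_abs_circEnsemble_le p s t q
  refine (Finset.sum_le_sum h).trans (le_of_eq ?_)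
  rw [Finset.sum_const, Finset.card_univ, Fintype.card_prod, nsmul_eq_mul]
  push_cast
  simp only [mul_pow, inv_pow, Real.sq_sqrt hn.le]
  field_simp

lemma sq_integral_le {X : Type*} [MeasurableSpace X] {μ : Measure X} [IsProbabilityMeasure μ]
    {F : X → ℝ} (hF : MemLp F 2 μ) : (∫ x, F x ∂μ) ^ 2 ≤ ∫ x, F x ^ 2 ∂μ := by
  have h := variance_nonneg F μ
  rw [variance_eq_sub hF] at h
  simpa using h

lemma integral_norm_diagAvg_sub_le (hz : 0 < z.im) (u : Z) :
    ∫ ξ, ‖diagAvg (circResolvent p s t z ξ) u - meanDiag p s t z u‖ ∂(gaussianPi (Z × Z)) ≤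
      2 * (∑ j, |p j|) * z.im⁻¹ ^ 2 / √(Fintype.card Z) := by
  set D := fun ξ => ‖diagAvg (circResolvent p s t z ξ) u - meanDiag p s t z u‖ with hD
  have hDm : AEStronglyMeasurable D (gaussianPi (Z × Z)) :=
    ((measurable_diagAvg_circResolvent u).sub_const _).norm.aestronglyMeasurable
  have hDb : ∀ ξ, ‖D ξ‖ ≤ z.im⁻¹ + z.im⁻¹ := fun ξ => by
    rw [norm_norm]
    exact (norm_sub_le _ _).trans (add_le_add ((norm_diagAvg_le _ u).trans
      (norm_circResolvent_le hz ξ)) (norm_meanDiag_le hz u))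
  have hsq : (∫ ξ, D ξ ∂(gaussianPi (Z × Z))) ^ 2 ≤ ∫ ξ, D ξ ^ 2 ∂(gaussianPi (Z × Z)) := by
    exact sq_integral_le (MemLp.of_bound hDm _ (Eventually.of_forall hDb))
  have h := hsq.trans (integral_norm_diagAvg_sub_sq_le hz u)
  have hnn : 0 ≤ 2 * (∑ j, |p j|) * z.im⁻¹ ^ 2 / √(Fintype.card Z) :=
    div_nonneg (mul_nonneg (mul_nonneg zero_le_two (Finset.sum_nonneg fun j _ => abs_nonneg _))
      (by positivity)) (Real.sqrt_nonneg _)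
  refine (abs_le_of_sq_le_sq' ?_ hnn).2
  rwa [div_pow, Real.sq_sqrt (Nat.cast_nonneg _)]

omit [Fintype Z] [DecidableEq Z] in
lemma selfEnergy_sub (χ : AddChar Z ℂ) (ρ ρ' : Z → ℂ) :
    selfEnergy p s t χ ρ - selfEnergy p s t χ ρ' = selfEnergy p s t χ (fun u => ρ u - ρ' u) := by
  unfold selfEnergy
  simp_rw [← Finset.sum_sub_distrib]
  refine Finset.sum_congr rfl fun j _ => Finset.sum_congr rfl fun k _ => ?_
  ring

omit [DecidableEq Z] in
lemma norm_selfEnergy_le (χ : AddChar Z ℂ) (ρ : Z → ℂ) : ‖selfEnergy p s t χ ρ‖ ≤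
    ∑ j, ∑ k, |p j| * |p k| * (‖ρ (t j - t k)‖ + ‖ρ (s j - s k)‖) := by
  refine (norm_sum_le _ _).trans (Finset.sum_le_sum fun j _ =>
    (norm_sum_le _ _).trans (Finset.sum_le_sum fun k _ => ?_))
  rw [norm_mul, norm_mul, Complex.norm_real, Complex.norm_real, Real.norm_eq_abs, Real.norm_eq_abs]
  gcongr
  refine (norm_add_le _ _).trans ?_
  simp

lemma integral_norm_selfEnergy_sub_le (hz : 0 < z.im) (χ : AddChar Z ℂ) :
    ∫ ξ, ‖selfEnergy p s t χ (diagAvg (circResolvent p s t z ξ)) -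
      selfEnergy p s t χ (meanDiag p s t z)‖ ∂(gaussianPi (Z × Z)) ≤
      4 * (∑ j, |p j|) ^ 3 * z.im⁻¹ ^ 2 / √(Fintype.card Z) := by
  set D := fun u ξ => ‖diagAvg (circResolvent p s t z ξ) u - meanDiag p s t z u‖ with hD
  have hDi : ∀ u, Integrable (D u) (gaussianPi (Z × Z)) := fun u =>
    ((integrable_diagAvg_circResolvent hz u).sub (integrable_const _)).norm
  set δ := 2 * (∑ j, |p j|) * z.im⁻¹ ^ 2 / √(Fintype.card Z) with hδ
  calc _ ≤ ∫ ξ, ∑ j, ∑ k, |p j| * |p k| * (D (t j - t k) ξ + D (s j - s k) ξ)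
        ∂(gaussianPi (Z × Z)) := by
        refine integral_mono_of_nonneg (Eventually.of_forall fun _ => norm_nonneg _) ?_
          (Eventually.of_forall fun ξ => ?_)
        · exact integrable_finsetSum _ fun j _ => integrable_finsetSum _ fun k _ =>
            ((hDi _).add (hDi _)).const_mul _
        · simp only [selfEnergy_sub]
          exact norm_selfEnergy_le _ _
    _ = ∑ j, ∑ k, |p j| * |p k| * ((∫ ξ, D (t j - t k) ξ ∂(gaussianPi (Z × Z))) +
        ∫ ξ, D (s j - s k) ξ ∂(gaussianPi (Z × Z))) := by
        have hi : ∀ j k, Integrable (fun ξ => |p j| * |p k| * (D (t j - t k) ξ + D (s j - s k) ξ))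
            (gaussianPi (Z × Z)) := fun j k => ((hDi _).add (hDi _)).const_mul _
        rw [integral_finsetSum _ fun j _ => integrable_finsetSum _ fun k _ => hi j k]
        refine Finset.sum_congr rfl fun j _ => ?_
        rw [integral_finsetSum _ fun k _ => hi j k]
        refine Finset.sum_congr rfl fun k _ => ?_
        rw [integral_const_mul, integral_add (hDi _) (hDi _)]
    _ ≤ ∑ j, ∑ k, |p j| * |p k| * (δ + δ) := by
        gcongr
        · exact integral_norm_diagAvg_sub_le hz _
        · exact integral_norm_diagAvg_sub_le hz _
    _ = _ := by
        simp_rw [← Finset.sum_mul, ← Finset.mul_sum, ← Finset.sum_mul, hδ]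
        ring

/-- The approximate Schwinger-Dyson equation for the circulant ensemble. -/
lemma norm_schwingerDyson_le (hz : 0 < z.im) (χ : AddChar Z ℂ) :
    ‖1 + (z + selfEnergy p s t χ (meanDiag p s t z)) * meanChar p s t z χ‖ ≤
      (2 * (∑ j, |p j|) ^ 2 * z.im⁻¹ ^ 2 + 4 * (∑ j, |p j|) ^ 3 * z.im⁻¹ ^ 3) /
        √(Fintype.card Z) := by
  have hA := isHermitian_circEnsemble p s t
  set μ := gaussianPi (Z × Z) with hμ
  set R := circResolvent p s t z with hR
  set S := fun ξ => selfEnergy p s t χ (diagAvg (R ξ)) with hS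
  set r := fun ξ => (charMat χ * R ξ).trace with hr
  set Sbar := selfEnergy p s t χ (meanDiag p s t z) with hSbar
  have hri : Integrable r μ := integrable_trace_charMat_mul_circResolvent hz χ
  have hrb : ∀ ξ, ‖r ξ‖ ≤ z.im⁻¹ := fun ξ =>
    (norm_trace_charMat_mul_le _ _).trans (norm_circResolvent_le hz ξ)
  have hSi : Integrable S μ := by
    refine integrable_finsetSum _ fun j _ => integrable_finsetSum _ fun k _ => ?_
    exact (((integrable_diagAvg_circResolvent hz _).const_mul _).add
      ((integrable_diagAvg_circResolvent hz _).const_mul _)).const_mul _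
  have hSr : Integrable (fun ξ => S ξ * r ξ) μ :=
    hSi.mul_bdd (c := z.im⁻¹) hri.aestronglyMeasurable (Eventually.of_forall hrb)
  have e1 : ∀ ξ, (charMat χ * (linComb (circEnsemble p s t) ξ).map Complex.ofReal *
      matResolvent (linComb (circEnsemble p s t) ξ) z).trace = 1 + z * r ξ := by
    intro ξ
    have h := mul_matResolvent (isHermitian_linComb hA ξ) hz
    rw [sub_mul, Matrix.smul_mul, one_mul, sub_eq_iff_eq_add] at h
    rw [Matrix.mul_assoc, h, Matrix.mul_add, Matrix.mul_one, Matrix.trace_add, trace_charMat,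
      Matrix.mul_smul, Matrix.trace_smul]
    rfl
  set T := fun ξ => ∑ q, (charMat χ * (circEnsemble p s t q).map Complex.ofReal * R ξ *
        (circEnsemble p s t q).map Complex.ofReal * R ξ).trace with hT
  have hmap : ∀ q, (circEnsemble p s t q).map Complex.ofReal =
      ((√(Fintype.card Z) : ℝ) : ℂ)⁻¹ • (circMat p s t q).map Complex.ofReal := by
    intro q; ext a b; simp [circEnsemble]
  have hTe : ∀ ξ, T ξ = (Fintype.card Z : ℂ)⁻¹ * ∑ q, (charMat χ *
      (circMat p s t q).map Complex.ofReal * R ξ *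
      (circMat p s t q).map Complex.ofReal * R ξ).trace := by
    intro ξ
    rw [hT, Finset.mul_sum]
    refine Finset.sum_congr rfl fun q _ => ?_
    simp only [hmap, Matrix.mul_smul, Matrix.smul_mul, Matrix.trace_smul, smul_eq_mul]
    rw [← mul_assoc, ← mul_inv, ← Complex.ofReal_mul, Real.mul_self_sqrt (Nat.cast_nonneg _)]
    simp
  have hTb : ∀ ξ, ‖T ξ - S ξ * r ξ‖ ≤
      2 * (∑ j, |p j|) ^ 2 * z.im⁻¹ ^ 2 / √(Fintype.card Z) := by
    intro ξ
    rw [hTe]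
    refine (norm_sum_trace_circMat_sub_le p s t χ (R ξ)).trans ?_
    gcongr
    exact norm_circResolvent_le hz ξ
  have hTm : Measurable T := by
    refine Finset.measurable_fun_sum _ fun q _ => ?_
    have h := measurable_trace_mul_mul_matResolvent_linComb (A := circEnsemble p s t) (z := z)
      (charMat χ * (circEnsemble p s t q).map Complex.ofReal)
      ((circEnsemble p s t q).map Complex.ofReal)
    exact h
  have hTSi : Integrable (fun ξ => T ξ - S ξ * r ξ) μ :=
    integrable_of_norm_le (hTm.aestronglyMeasurable.sub hSr.aestronglyMeasurable) hTb
  have hTi : Integrable T μ := by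
    refine (hTSi.add hSr).congr (Eventually.of_forall fun ξ => ?_)
    simp
  have e2 := integral_trace_mul_linComb_mul_matResolvent hA hz (charMat χ)
  simp_rw [e1] at e2
  rw [integral_add (integrable_const _) (hri.const_mul _), integral_const_mul] at e2
  simp only [integral_const, probReal_univ, one_smul] at e2
  have e3 : 1 + (z + Sbar) * meanChar p s t z χ =
      -∫ ξ, ((T ξ - S ξ * r ξ) + (S ξ - Sbar) * r ξ) ∂μ := by
    have h1 : ∫ ξ, ((T ξ - S ξ * r ξ) + (S ξ - Sbar) * r ξ) ∂μ = ∫ ξ, (T ξ - Sbar * r ξ) ∂μ := by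
      congr 1; ext ξ; ring
    rw [h1, integral_sub hTi (hri.const_mul _), integral_const_mul]
    have h2 : meanChar p s t z χ = ∫ ξ, r ξ ∂μ := rfl
    rw [h2]
    have h3 : 1 + z * ∫ ξ, r ξ ∂μ = -∫ ξ, T ξ ∂μ := e2
    linear_combination h3
  have hSri : Integrable (fun ξ => (S ξ - Sbar) * r ξ) μ :=
    (hSi.sub (integrable_const _)).mul_bdd (c := z.im⁻¹) hri.aestronglyMeasurable
      (Eventually.of_forall hrb)
  rw [e3, norm_neg, integral_add hTSi hSri]
  refine (norm_add_le _ _).trans ?_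
  rw [add_div]
  refine add_le_add ?_ ?_
  · refine (norm_integral_le_of_norm_le_const (Eventually.of_forall hTb)).trans ?_
    simp
  · refine (norm_integral_le_integral_norm _).trans ?_
    calc ∫ ξ, ‖(S ξ - Sbar) * r ξ‖ ∂μ ≤ ∫ ξ, ‖S ξ - Sbar‖ * z.im⁻¹ ∂μ := by
          refine integral_mono hSri.norm ((hSi.sub (integrable_const _)).norm.mul_const _) fun ξ => ?_
          simp only [norm_mul]
          gcongr
          exact hrb ξ
      _ ≤ 4 * (∑ j, |p j|) ^ 3 * z.im⁻¹ ^ 2 / √(Fintype.card Z) * z.im⁻¹ := by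
          rw [integral_mul_const]
          gcongr
          exact integral_norm_selfEnergy_sub_le hz χ
      _ = _ := by ring

end SchwingerDyson

section QuadraticVectorEquation

variable {X : Type*} [MeasurableSpace X] {μ : Measure X} [IsFiniteMeasure μ]
  {K : X → X → ℝ} {z : ℂ} {m m' : X → ℂ}

/-- Bounded solutions with nonnegative imaginary part of the quadratic vector equation
`-1 / m = z + K m`. -/
structure IsQVESolution (μ : Measure X) (K : X → X → ℝ) (z : ℂ) (m : X → ℂ) : Prop where
  measurable : Measurable m
  bounded : ∃ B, ∀ x, ‖m x‖ ≤ B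
  im_nonneg : ∀ x, 0 ≤ (m x).im
  mul_eq : ∀ x, m x * (z + ∫ y, (K x y : ℂ) * m y ∂μ) = -1

/-- Bounded measurable symmetric nonnegative kernels. -/
structure IsQVEKernel (K : X → X → ℝ) : Prop where
  measurable : Measurable (Function.uncurry K)
  nonneg : ∀ x y, 0 ≤ K x y
  bounded : ∃ C, ∀ x y, K x y ≤ C
  symm : ∀ x y, K x y = K y x

lemma IsQVEKernel.integrable_mul (hK : IsQVEKernel K) {g : X → ℝ} (hg : Measurable g) {B : ℝ}
    (hB : ∀ x, ‖g x‖ ≤ B) (x : X) : Integrable (fun y => K x y * g y) μ := by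
  obtain ⟨C, hC⟩ := hK.bounded
  have hm : Measurable (K x) := hK.measurable.of_uncurry_left
  refine integrable_of_norm_le (hm.mul hg).aestronglyMeasurable (C := C * B) fun y => ?_
  rw [norm_mul, Real.norm_of_nonneg (hK.nonneg x y)]
  have := hK.nonneg x y
  gcongr
  · exact this.trans (hC x y)
  · exact hC x y
  · exact hB y

lemma IsQVEKernel.integrable_ofReal_mul (hK : IsQVEKernel K) {g : X → ℂ} (hg : Measurable g) {B : ℝ}
    (hB : ∀ x, ‖g x‖ ≤ B) (x : X) : Integrable (fun y => (K x y : ℂ) * g y) μ := by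
  obtain ⟨C, hC⟩ := hK.bounded
  have hm : Measurable (K x) := hK.measurable.of_uncurry_left
  refine integrable_of_norm_le
    ((Complex.measurable_ofReal.comp hm).mul hg).aestronglyMeasurable (C := C * B) fun y => ?_
  rw [norm_mul, Complex.norm_real, Real.norm_of_nonneg (hK.nonneg x y)]
  have := hK.nonneg x y
  gcongr
  · exact this.trans (hC x y)
  · exact hC x y
  · exact hB y

lemma IsQVESolution.im_eq (hK : IsQVEKernel K) (hm : IsQVESolution μ K z m) (x : X) :
    (m x).im = ‖m x‖ ^ 2 * (z.im + ∫ y, K x y * (m y).im ∂μ) := by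
  obtain ⟨B, hB⟩ := hm.bounded
  have hi := hK.integrable_ofReal_mul (μ := μ) hm.measurable hB x
  have h1 : (∫ y, (K x y : ℂ) * m y ∂μ).im = ∫ y, K x y * (m y).im ∂μ := by
    have h := integral_im hi
    simp only [RCLike.im_eq_complex_im, Complex.im_ofReal_mul] at h
    exact h.symm
  set w := z + ∫ y, (K x y : ℂ) * m y ∂μ with hw
  have h2 : ((‖m x‖ ^ 2 : ℝ) : ℂ) * w = -(starRingEnd ℂ) (m x) := by
    have h3 : (starRingEnd ℂ) (m x) * (m x * w) = -(starRingEnd ℂ) (m x) := by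
      rw [hm.mul_eq x]; ring
    rw [← h3, ← mul_assoc, ← Complex.normSq_eq_conj_mul_self, Complex.normSq_eq_norm_sq]
  have h4 := congrArg Complex.im h2
  rw [Complex.im_ofReal_mul, hw, Complex.add_im, h1] at h4
  simpa using h4.symm

omit [IsFiniteMeasure μ] in
lemma IsQVESolution.ne_zero (hm : IsQVESolution μ K z m) (x : X) : m x ≠ 0 := by
  intro h
  have := hm.mul_eq x
  rw [h, zero_mul] at this
  norm_num at this

lemma IsQVESolution.exists_im_ge (hK : IsQVEKernel K) (hz : 0 < z.im)
    (hm : IsQVESolution μ K z m) : ∃ δ > 0, ∀ x, δ ≤ (m x).im := by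
  obtain ⟨B, hB⟩ := hm.bounded
  obtain ⟨C, hC⟩ := hK.bounded
  set L := ‖z‖ + |C * B| * μ.real Set.univ with hL
  have hz0 : 0 < ‖z‖ := norm_pos_iff.2 fun h => by simp [h] at hz
  have hL0 : 0 < L := add_pos_of_pos_of_nonneg hz0 (by positivity)
  refine ⟨(L⁻¹) ^ 2 * z.im, by positivity, fun x => ?_⟩
  have h1 : ‖z + ∫ y, (K x y : ℂ) * m y ∂μ‖ ≤ L := by
    refine (norm_add_le _ _).trans (add_le_add le_rfl ?_)
    refine norm_integral_le_of_norm_le_const (Eventually.of_forall fun y => ?_)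
    rw [norm_mul, Complex.norm_real, Real.norm_of_nonneg (hK.nonneg x y)]
    refine le_trans ?_ (le_abs_self _)
    have := hK.nonneg x y
    gcongr
    · exact this.trans (hC x y)
    · exact hC x y
    · exact hB y
  have h2 : L⁻¹ ≤ ‖m x‖ := by
    have h := congrArg norm (hm.mul_eq x)
    rw [norm_mul, norm_neg, norm_one] at h
    rw [inv_le_iff_one_le_mul₀ hL0, ← h]
    gcongr
  rw [hm.im_eq hK x]
  have h3 : 0 ≤ ∫ y, K x y * (m y).im ∂μ :=
    integral_nonneg fun y => mul_nonneg (hK.nonneg x y) (hm.im_nonneg y)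
  gcongr
  linarith

lemma IsQVESolution.integral_norm_sq_le {a : ℝ} (ha : 0 < a) [NeZero μ] (hK : IsQVEKernel K)
    (hKa : ∀ x y, a ≤ K x y) (hz : 0 < z.im) (hm : IsQVESolution μ K z m) :
    ∫ x, ‖m x‖ ^ 2 ∂μ ≤ a⁻¹ := by
  obtain ⟨B, hB⟩ := hm.bounded
  obtain ⟨δ, hδ, hδm⟩ := hm.exists_im_ge hK hz
  have hvm : Measurable fun x => (m x).im := Complex.measurable_im.comp hm.measurable
  have hvb : ∀ x, ‖(m x).im‖ ≤ B := fun x => (Complex.abs_im_le_norm _).trans (hB x)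
  have hvi : Integrable (fun x => (m x).im) μ :=
    integrable_of_norm_le hvm.aestronglyMeasurable hvb
  have hsi : Integrable (fun x => ‖m x‖ ^ 2) μ :=
    integrable_of_norm_le (hm.measurable.norm.pow_const 2).aestronglyMeasurable (C := B ^ 2)
      fun x => by
        rw [norm_pow, norm_norm]
        exact pow_le_pow_left₀ (norm_nonneg _) (hB x) 2
  set V := ∫ x, (m x).im ∂μ with hV
  have hVpos : 0 < V := by
    have h : ∫ x, δ ∂μ ≤ V := integral_mono (integrable_const _) hvi hδm
    rw [integral_const, smul_eq_mul] at h
    have : 0 < μ.real Set.univ := by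
      rw [measureReal_def]
      exact ENNReal.toReal_pos (by simpa using NeZero.ne μ) (measure_ne_top _ _)
    exact lt_of_lt_of_le (by positivity) h
  have h1 : ∀ x, ‖m x‖ ^ 2 * (a * V) ≤ (m x).im := by
    intro x
    rw [hm.im_eq hK x]
    gcongr
    have : a * V ≤ ∫ y, K x y * (m y).im ∂μ := by
      rw [hV, ← integral_const_mul]
      refine integral_mono (hvi.const_mul _) (hK.integrable_mul hvm hvb x) fun y => ?_
      exact mul_le_mul_of_nonneg_right (hKa x y) (hm.im_nonneg y)
    linarith
  have h2 : (∫ x, ‖m x‖ ^ 2 ∂μ) * (a * V) ≤ V := by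
    rw [← integral_mul_const]
    exact integral_mono (hsi.mul_const _) hvi h1
  have h3 : (∫ x, ‖m x‖ ^ 2 ∂μ) * a ≤ 1 := by
    refine le_of_mul_le_mul_right ?_ hVpos
    linarith
  rwa [← one_div, le_div_iff₀ ha]

omit [IsFiniteMeasure μ] in
lemma integral_kernel_sqrt_add_le {v v' k : X → ℝ} {η : ℝ} (hη : 0 ≤ η) (hv : ∀ x, 0 ≤ v x)
    (hv' : ∀ x, 0 ≤ v' x) (hk : ∀ x, 0 ≤ k x) (hi : Integrable (fun y => k y * v y) μ)
    (hi' : Integrable (fun y => k y * v' y) μ) (ha : 0 < η + ∫ y, k y * v y ∂μ)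
    (ha' : 0 < η + ∫ y, k y * v' y ∂μ) :
    η + ∫ y, k y * √(v y * v' y) ∂μ ≤
      √((η + ∫ y, k y * v y ∂μ) * (η + ∫ y, k y * v' y ∂μ)) := by
  set a := η + ∫ y, k y * v y ∂μ with ha_def
  set a' := η + ∫ y, k y * v' y ∂μ with ha'_def
  set l := √a' / √a with hl
  have hsa := Real.sqrt_pos.2 ha
  have hsa' := Real.sqrt_pos.2 ha'
  have hlpos : 0 < l := div_pos hsa' hsa
  have key : ∀ x y : ℝ, 0 ≤ x → 0 ≤ y → √(x * y) ≤ l / 2 * x + l⁻¹ / 2 * y := by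
    intro x y hx hy
    refine Real.sqrt_le_iff.2 ⟨by positivity, ?_⟩
    have h : (l / 2 * x + l⁻¹ / 2 * y) ^ 2 - x * y = (l / 2 * x - l⁻¹ / 2 * y) ^ 2 := by
      field_simp
      ring
    nlinarith [sq_nonneg (l / 2 * x - l⁻¹ / 2 * y)]
  have h1 : ∫ y, k y * √(v y * v' y) ∂μ ≤
      l / 2 * (∫ y, k y * v y ∂μ) + l⁻¹ / 2 * ∫ y, k y * v' y ∂μ := by
    rw [← integral_const_mul, ← integral_const_mul, ← integral_add (hi.const_mul _)
      (hi'.const_mul _)]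
    refine integral_mono_of_nonneg (Eventually.of_forall fun y =>
      mul_nonneg (hk y) (Real.sqrt_nonneg _)) ((hi.const_mul _).add (hi'.const_mul _))
      (Eventually.of_forall fun y => ?_)
    have := mul_le_mul_of_nonneg_left (key _ _ (hv y) (hv' y)) (hk y)
    simp only
    linarith
  have h2 : η ≤ l / 2 * η + l⁻¹ / 2 * η := by
    have h := key η η hη hη
    rwa [Real.sqrt_mul_self hη] at h
  have h3 : √(a * a') = l / 2 * a + l⁻¹ / 2 * a' := by
    rw [Real.sqrt_mul ha.le, hl]
    have e1 := Real.sq_sqrt ha.le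
    have e2 := Real.sq_sqrt ha'.le
    field_simp
    rw [e1, e2]
    ring
  rw [h3, ha_def, ha'_def]
  linarith

lemma IsQVEKernel.exists_integral_bound (hK : IsQVEKernel K) {h : X → ℝ} {B : ℝ}
    (hB : ∀ x, ‖h x‖ ≤ B) : ∃ C', ∀ x, ‖∫ y, K x y * h y ∂μ‖ ≤ C' := by
  obtain ⟨C, hC⟩ := hK.bounded
  refine ⟨C * B * μ.real Set.univ, fun x => ?_⟩
  refine norm_integral_le_of_norm_le_const (Eventually.of_forall fun y => ?_)
  rw [norm_mul, Real.norm_of_nonneg (hK.nonneg x y)]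
  have := hK.nonneg x y
  gcongr
  · exact this.trans (hC x y)
  · exact hC x y
  · exact hB y

lemma IsQVEKernel.measurable_integral (hK : IsQVEKernel K) {h : X → ℝ} (hh : Measurable h) :
    Measurable fun x => ∫ y, K x y * h y ∂μ := by
  have h1 : Measurable (Function.uncurry fun x y => K x y * h y) :=
    hK.measurable.mul (hh.comp measurable_snd)
  exact h1.stronglyMeasurable.integral_prod_right'.measurable

lemma IsQVEKernel.integrable_form (hK : IsQVEKernel K) {g h : X → ℝ} (hg : Measurable g)
    (hh : Measurable h) {A B : ℝ} (hA : ∀ x, ‖g x‖ ≤ A) (hB : ∀ x, ‖h x‖ ≤ B) :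
    Integrable (fun x => g x * ∫ y, K x y * h y ∂μ) μ := by
  obtain ⟨C', hC'⟩ := hK.exists_integral_bound (μ := μ) hB
  refine integrable_of_norm_le (hg.mul (hK.measurable_integral hh)).aestronglyMeasurable
    (C := A * C') fun x => ?_
  rw [norm_mul]
  have := norm_nonneg (g x)
  gcongr
  · exact this.trans (hA x)
  · exact hA x
  · exact hC' x

lemma IsQVEKernel.form_comm (hK : IsQVEKernel K) {g h : X → ℝ} (hg : Measurable g)
    (hh : Measurable h) {A B : ℝ} (hA : ∀ x, ‖g x‖ ≤ A) (hB : ∀ x, ‖h x‖ ≤ B) :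
    ∫ x, g x * ∫ y, K x y * h y ∂μ ∂μ = ∫ x, h x * ∫ y, K x y * g y ∂μ ∂μ := by
  obtain ⟨C, hC⟩ := hK.bounded
  simp_rw [← integral_const_mul]
  rw [integral_integral_swap]
  · refine integral_congr_ae (Eventually.of_forall fun x =>
      integral_congr_ae (Eventually.of_forall fun y => ?_))
    simp only
    rw [hK.symm y x]
    ring
  · refine integrable_of_norm_le (C := A * (C * B)) ?_ fun x => ?_
    · exact ((hg.comp measurable_fst).mul
        (hK.measurable.mul (hh.comp measurable_snd))).aestronglyMeasurable
    · simp only [Function.uncurry]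
      rw [norm_mul, norm_mul, Real.norm_of_nonneg (hK.nonneg _ _)]
      have h1 := norm_nonneg (g x.1)
      have h2 := hK.nonneg x.1 x.2
      gcongr
      · exact h1.trans (hA _)
      · exact hA _
      · exact h2.trans (hC _ _)
      · exact hC _ _
      · exact hB _

/-- Bounded solutions of the quadratic vector equation are unique. -/
theorem IsQVESolution.unique (hK : IsQVEKernel K) (hz : 0 < z.im) (hm : IsQVESolution μ K z m)
    (hm' : IsQVESolution μ K z m') : m = m' := by
  obtain ⟨B, hB⟩ := hm.bounded
  obtain ⟨B', hB'⟩ := hm'.bounded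
  obtain ⟨δ, hδ, hδm⟩ := hm.exists_im_ge hK hz
  obtain ⟨δ', hδ', hδm'⟩ := hm'.exists_im_ge hK hz
  set d : X → ℝ := fun x => ‖m x - m' x‖ with hd
  set α : X → ℝ := fun x => √((m x).im * (m' x).im) with hα
  set g : X → ℝ := fun x => d x ^ 2 / α x with hg
  have hdm : Measurable d := (hm.measurable.sub hm'.measurable).norm
  have hαm : Measurable α := ((Complex.measurable_im.comp hm.measurable).mul
    (Complex.measurable_im.comp hm'.measurable)).sqrt
  have hgm : Measurable g := (hdm.pow_const 2).div hαm
  have hv : ∀ x, ‖(m x).im‖ ≤ B := fun x => (Complex.abs_im_le_norm _).trans (hB x)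
  have hv' : ∀ x, ‖(m' x).im‖ ≤ B' := fun x => (Complex.abs_im_le_norm _).trans (hB' x)
  have hvm : Measurable fun x => (m x).im := Complex.measurable_im.comp hm.measurable
  have hvm' : Measurable fun x => (m' x).im := Complex.measurable_im.comp hm'.measurable
  have hdB : ∀ x, ‖d x‖ ≤ B + B' := fun x => by
    rw [hd, norm_norm]
    exact (norm_sub_le _ _).trans (add_le_add (hB x) (hB' x))
  have hαlow : ∀ x, √(δ * δ') ≤ α x := fun x => by
    exact Real.sqrt_le_sqrt (mul_le_mul (hδm x) (hδm' x) hδ'.le (hm.im_nonneg x))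
  have hα0 : 0 < √(δ * δ') := Real.sqrt_pos.2 (by positivity)
  have hαpos : ∀ x, 0 < α x := fun x => hα0.trans_le (hαlow x)
  have hαB : ∀ x, ‖α x‖ ≤ √(B * B') := fun x => by
    rw [Real.norm_of_nonneg (hαpos x).le]
    refine Real.sqrt_le_sqrt ?_
    have h1 := (le_abs_self _).trans (hv x)
    have h2 := (le_abs_self _).trans (hv' x)
    have h3 := hm.im_nonneg x
    have h4 := hm'.im_nonneg x
    exact mul_le_mul h1 h2 h4 (h3.trans h1)
  have hgnn : ∀ x, 0 ≤ g x := fun x => div_nonneg (sq_nonneg _) (hαpos x).le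
  have hgB : ∀ x, ‖g x‖ ≤ (B + B') ^ 2 / √(δ * δ') := fun x => by
    rw [Real.norm_of_nonneg (hgnn x)]
    have h1 := hdB x
    rw [Real.norm_eq_abs] at h1
    have h2 : d x ^ 2 ≤ (B + B') ^ 2 := sq_le_sq' (by linarith [neg_abs_le (d x)])
      ((le_abs_self _).trans h1)
    exact div_le_div₀ (sq_nonneg _) h2 hα0 (hαlow x)
  have hdle : ∀ x, d x ≤ ‖m x‖ * ‖m' x‖ * ∫ y, K x y * d y ∂μ := by
    intro x
    have h1 := hm.mul_eq x
    have h2 := hm'.mul_eq x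
    have e : m x - m' x = m x * m' x * ∫ y, (K x y : ℂ) * (m y - m' y) ∂μ := by
      have h3 : ∫ y, (K x y : ℂ) * (m y - m' y) ∂μ =
          (∫ y, (K x y : ℂ) * m y ∂μ) - ∫ y, (K x y : ℂ) * m' y ∂μ := by
        rw [← integral_sub (hK.integrable_ofReal_mul hm.measurable hB x)
          (hK.integrable_ofReal_mul hm'.measurable hB' x)]
        simp_rw [mul_sub]
      rw [h3]
      linear_combination (-m' x) * h1 + m x * h2
    have h4 : ‖∫ y, (K x y : ℂ) * (m y - m' y) ∂μ‖ ≤ ∫ y, K x y * d y ∂μ := by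
      refine (norm_integral_le_integral_norm _).trans (le_of_eq ?_)
      refine integral_congr_ae (Eventually.of_forall fun y => ?_)
      simp only
      rw [norm_mul, Complex.norm_real, Real.norm_of_nonneg (hK.nonneg x y)]
    calc d x = ‖m x‖ * ‖m' x‖ * ‖∫ y, (K x y : ℂ) * (m y - m' y) ∂μ‖ := by
          rw [← norm_mul, ← norm_mul, ← e]
      _ ≤ _ := by gcongr
  have hKα : ∀ x, z.im + ∫ y, K x y * α y ∂μ ≤ α x / (‖m x‖ * ‖m' x‖) := by
    intro x
    have e1 := hm.im_eq hK x
    have e2 := hm'.im_eq hK x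
    have n1 := norm_pos_iff.2 (hm.ne_zero x)
    have n2 := norm_pos_iff.2 (hm'.ne_zero x)
    have p1 : 0 ≤ ∫ y, K x y * (m y).im ∂μ :=
      integral_nonneg fun y => mul_nonneg (hK.nonneg x y) (hm.im_nonneg y)
    have p2 : 0 ≤ ∫ y, K x y * (m' y).im ∂μ :=
      integral_nonneg fun y => mul_nonneg (hK.nonneg x y) (hm'.im_nonneg y)
    refine (integral_kernel_sqrt_add_le hz.le hm.im_nonneg hm'.im_nonneg (hK.nonneg x)
      (hK.integrable_mul hvm hv x) (hK.integrable_mul hvm' hv' x) (by linarith)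
      (by linarith)).trans (le_of_eq ?_)
    rw [eq_div_iff (by positivity), hα]
    simp only
    rw [e1, e2, ← Real.sqrt_sq (mul_nonneg n1.le n2.le), ← Real.sqrt_mul (by positivity)]
    congr 1
    ring
  have hpt : ∀ x, z.im * g x + g x * ∫ y, K x y * α y ∂μ ≤ d x * ∫ y, K x y * d y ∂μ := by
    intro x
    have n1 := norm_pos_iff.2 (hm.ne_zero x)
    have n2 := norm_pos_iff.2 (hm'.ne_zero x)
    have h1 := mul_le_mul_of_nonneg_left (hKα x) (hgnn x)
    have h2 : g x * (α x / (‖m x‖ * ‖m' x‖)) = d x * (d x / (‖m x‖ * ‖m' x‖)) := by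
      have := (hαpos x).ne'
      simp only [hg]
      field_simp
    have h3 : d x / (‖m x‖ * ‖m' x‖) ≤ ∫ y, K x y * d y ∂μ := by
      rw [div_le_iff₀' (by positivity)]
      exact hdle x
    have h4 := mul_le_mul_of_nonneg_left h3 (norm_nonneg (m x - m' x))
    change d x * _ ≤ d x * _ at h4
    linarith
  have hgi : Integrable g μ := integrable_of_norm_le hgm.aestronglyMeasurable hgB
  have h1 : z.im * ∫ x, g x ∂μ + ∫ x, g x * ∫ y, K x y * α y ∂μ ∂μ ≤
      ∫ x, d x * ∫ y, K x y * d y ∂μ ∂μ := by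
    rw [← integral_const_mul, ← integral_add (hgi.const_mul _)
      (hK.integrable_form hgm hαm hgB hαB)]
    exact integral_mono ((hgi.const_mul _).add (hK.integrable_form hgm hαm hgB hαB))
      (hK.integrable_form hdm hdm hdB hdB) hpt
  have hamgm : ∀ x y, d x * d y ≤ (g x * α y + α x * g y) / 2 := by
    intro x y
    have a1 := hαpos x
    have a2 := hαpos y
    have e : (g x * α y + α x * g y) / 2 - d x * d y =
        (d x * α y - d y * α x) ^ 2 / (2 * (α x * α y)) := by
      simp only [hg]
      field_simp
      ring
    have : 0 ≤ (d x * α y - d y * α x) ^ 2 / (2 * (α x * α y)) := by positivity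
    linarith
  have h2 : ∫ x, d x * ∫ y, K x y * d y ∂μ ∂μ ≤ ∫ x, g x * ∫ y, K x y * α y ∂μ ∂μ := by
    have e1 := hK.form_comm (μ := μ) hgm hαm hgB hαB
    have e2 : ∫ x, d x * ∫ y, K x y * d y ∂μ ∂μ ≤
        ∫ x, (1 / 2 * (g x * ∫ y, K x y * α y ∂μ) + 1 / 2 * (α x * ∫ y, K x y * g y ∂μ)) ∂μ := by
      refine integral_mono (hK.integrable_form hdm hdm hdB hdB)
        (((hK.integrable_form hgm hαm hgB hαB).const_mul _).add
          ((hK.integrable_form hαm hgm hαB hgB).const_mul _)) fun x => ?_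
      simp only [← integral_const_mul]
      rw [← integral_add]
      · refine integral_mono ((hK.integrable_mul hdm hdB x).const_mul _)
          ((((hK.integrable_mul hαm hαB x).const_mul _).const_mul _).add
          (((hK.integrable_mul hgm hgB x).const_mul _).const_mul _)) fun y => ?_
        have := mul_le_mul_of_nonneg_left (hamgm x y) (hK.nonneg x y)
        simp only
        linarith
      · exact ((hK.integrable_mul hαm hαB x).const_mul _).const_mul _
      · exact ((hK.integrable_mul hgm hgB x).const_mul _).const_mul _
    rw [integral_add ((hK.integrable_form hgm hαm hgB hαB).const_mul _)
      ((hK.integrable_form hαm hgm hαB hgB).const_mul _), integral_const_mul, integral_const_mul,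
      ← e1] at e2
    linarith
  have h3 : ∫ x, g x ∂μ = 0 := by
    refine le_antisymm ?_ (integral_nonneg hgnn)
    by_contra hcon
    push Not at hcon
    have := mul_pos hz hcon
    linarith
  have h4 : g =ᵐ[μ] 0 := (integral_eq_zero_iff_of_nonneg hgnn hgi).1 h3
  have h5 : d =ᵐ[μ] 0 := h4.mono fun x hx => by
    have hx' : d x ^ 2 / α x = 0 := hx
    rw [div_eq_zero_iff, or_iff_left (hαpos x).ne'] at hx'
    simpa using hx'
  ext1 x
  have h6 : ∫ y, K x y * d y ∂μ = 0 := by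
    rw [integral_congr_ae (g := fun _ => (0 : ℝ)) (h5.mono fun y hy => by simp [hy])]
    simp
  have h7 := hdle x
  rw [h6, mul_zero] at h7
  exact sub_eq_zero.1 (norm_le_zero_iff.1 h7)

end QuadraticVectorEquation

section RiemannSum

open Topology

lemma tendsto_riemann_sum {F : ℝ → ℂ} (hF : Continuous F) :
    Tendsto (fun n : ℕ => ((n + 1 : ℕ) : ℂ)⁻¹ * ∑ l ∈ Finset.range (n + 1),
      F ((l : ℝ) / (n + 1 : ℕ))) atTop (𝓝 (∫ x in (0 : ℝ)..1, F x)) := by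
  have huc : UniformContinuousOn F (Set.Icc 0 1) :=
    isCompact_Icc.uniformContinuousOn_of_continuous hF.continuousOn
  rw [Metric.tendsto_atTop]
  intro ε hε
  rw [Metric.uniformContinuousOn_iff] at huc
  obtain ⟨δ, hδ, hd⟩ := huc (ε / 2) (half_pos hε)
  obtain ⟨n₀, hn₀⟩ := exists_nat_one_div_lt hδ
  refine ⟨n₀, fun n hn => ?_⟩
  set N : ℕ := n + 1 with hN
  have hN0 : (0 : ℝ) < N := by positivity
  have hNδ : 1 / (N : ℝ) < δ := by
    refine lt_of_le_of_lt ?_ hn₀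
    rw [hN]
    push_cast
    gcongr
  have hsum : ∫ x in (0 : ℝ)..1, F x =
      ∑ l ∈ Finset.range N, ∫ x in ((l : ℝ) / N)..(((l + 1 : ℕ) : ℝ) / N), F x := by
    have h := intervalIntegral.sum_integral_adjacent_intervals (f := F) (μ := volume)
      (a := fun l : ℕ => (l : ℝ) / N) (n := N) fun k _ => hF.intervalIntegrable _ _
    rw [h]
    simp [hN0.ne']
  rw [dist_eq_norm, hsum, Finset.mul_sum, ← Finset.sum_sub_distrib]
  have hterm : ∀ l ∈ Finset.range N, ‖((N : ℕ) : ℂ)⁻¹ * F ((l : ℝ) / N) -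
      ∫ x in ((l : ℝ) / N)..(((l + 1 : ℕ) : ℝ) / N), F x‖ ≤ ε / 2 * (1 / N) := by
    intro l hl
    have hl' : ((l : ℝ) + 1) ≤ N := by exact_mod_cast Finset.mem_range.1 hl
    have e1 : ((N : ℕ) : ℂ)⁻¹ * F ((l : ℝ) / N) =
        ∫ x in ((l : ℝ) / N)..(((l + 1 : ℕ) : ℝ) / N), F ((l : ℝ) / N) := by
      rw [intervalIntegral.integral_const, ← sub_div]
      push_cast
      rw [add_sub_cancel_left, one_div, Complex.real_smul]
      push_cast
      rfl
    rw [e1, ← intervalIntegral.integral_sub (by simp) (hF.intervalIntegrable _ _)]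
    have hlen : (((l + 1 : ℕ) : ℝ) / N) - (l : ℝ) / N = 1 / N := by
      push_cast; ring
    refine (intervalIntegral.norm_integral_le_of_norm_le_const (C := ε / 2) fun x hx => ?_).trans ?_
    · rw [Set.uIoc_of_le (by gcongr; simp)] at hx
      have hx1 : x ≤ 1 := hx.2.trans (by rw [div_le_one hN0]; push_cast; exact hl')
      have hx0 : 0 ≤ x := le_trans (by positivity) hx.1.le
      have hl1 : (l : ℝ) / N ∈ Set.Icc (0 : ℝ) 1 := ⟨by positivity, hx.1.le.trans hx1⟩
      have h := hd _ hl1 x ⟨hx0, hx1⟩ ?_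
      · rw [dist_eq_norm] at h
        exact h.le
      · rw [dist_comm, Real.dist_eq, abs_of_nonneg (by linarith [hx.1])]
        linarith [hx.2]
    · rw [hlen, abs_of_nonneg (by positivity)]
  calc _ ≤ ∑ l ∈ Finset.range N, ε / 2 * (1 / (N : ℝ)) :=
        (norm_sum_le _ _).trans (Finset.sum_le_sum hterm)
    _ = ε / 2 := by
        rw [Finset.sum_const, Finset.card_range, nsmul_eq_mul]
        field_simp
    _ < ε := half_lt_self hε

end RiemannSum

section TrigKernel

/-- The additive character `x ↦ exp(2πix)`. -/
noncomputable def expTwoPi (x : ℝ) : ℂ := Complex.exp (2 * π * Complex.I * x)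

lemma expTwoPi_add (x y : ℝ) : expTwoPi (x + y) = expTwoPi x * expTwoPi y := by
  unfold expTwoPi
  rw [← Complex.exp_add]
  push_cast
  ring_nf

@[simp] lemma norm_expTwoPi (x : ℝ) : ‖expTwoPi x‖ = 1 := by
  unfold expTwoPi
  rw [show 2 * (π : ℂ) * Complex.I * x = ((2 * π * x : ℝ) : ℂ) * Complex.I by push_cast; ring]
  exact Complex.norm_exp_ofReal_mul_I _

@[simp] lemma expTwoPi_zero : expTwoPi 0 = 1 := by simp [expTwoPi]

lemma conj_expTwoPi (x : ℝ) : (starRingEnd ℂ) (expTwoPi x) = expTwoPi (-x) := by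
  unfold expTwoPi
  rw [← Complex.exp_conj]
  congr 1
  simp only [map_mul, Complex.conj_ofReal, Complex.conj_I, map_ofNat]
  push_cast
  ring

@[fun_prop] lemma continuous_expTwoPi : Continuous expTwoPi := by
  unfold expTwoPi
  fun_prop

variable {J : Type*} [Fintype J] (p : J → ℝ) (s t : J → ℕ)

/-- The trigonometric polynomial with coefficients `p` and frequencies `(s, t)`. -/
noncomputable def trigSum (x y : ℝ) : ℂ := ∑ j, (p j : ℂ) * expTwoPi (s j * x + t j * y)

/-- The covariance kernel of the limiting quadratic vector equation. -/
noncomputable def trigKernel (x y : ℝ) : ℝ := ‖trigSum p s t x (-y)‖ ^ 2 +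
    ‖trigSum p s t (-y) x‖ ^ 2

/-- The self-energy in terms of the Fourier coefficients `ρ`. -/
noncomputable def energy (ρ : ℤ → ℂ) (x : ℝ) : ℂ :=
  ∑ j, ∑ k, (p j : ℂ) * p k * (expTwoPi (((s j : ℤ) - s k : ℤ) * x) * ρ ((t j : ℤ) - t k) +
    expTwoPi (((t j : ℤ) - t k : ℤ) * x) * ρ ((s j : ℤ) - s k))

lemma continuous_energy (ρ : ℤ → ℂ) : Continuous (energy p s t ρ) := by
  unfold energy
  fun_prop

lemma continuous_trigKernel : Continuous (Function.uncurry (trigKernel p s t)) := by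
  unfold trigKernel trigSum Function.uncurry
  fun_prop

lemma ofReal_norm_sq_trigSum (x y : ℝ) : ((‖trigSum p s t x y‖ ^ 2 : ℝ) : ℂ) =
    ∑ j, ∑ k, (p j : ℂ) * p k * (expTwoPi (((s j : ℤ) - s k : ℤ) * x) *
      expTwoPi (((t j : ℤ) - t k : ℤ) * y)) := by
  rw [← Complex.normSq_eq_norm_sq, Complex.normSq_eq_conj_mul_self, mul_comm, trigSum, map_sum,
    Finset.sum_mul_sum]
  refine Finset.sum_congr rfl fun j _ => Finset.sum_congr rfl fun k _ => ?_
  rw [map_mul, conj_expTwoPi, Complex.conj_ofReal]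
  have : expTwoPi (((s j : ℤ) - s k : ℤ) * x) * expTwoPi (((t j : ℤ) - t k : ℤ) * y) =
      expTwoPi (s j * x + t j * y) * expTwoPi (-(s k * x + t k * y)) := by
    rw [← expTwoPi_add, ← expTwoPi_add]
    congr 1
    push_cast
    ring
  rw [this]
  ring

lemma ofReal_trigKernel (x y : ℝ) : (trigKernel p s t x y : ℂ) =
    ∑ j, ∑ k, (p j : ℂ) * p k * (expTwoPi (((s j : ℤ) - s k : ℤ) * x) *
      expTwoPi (-(((t j : ℤ) - t k : ℤ) * y)) + expTwoPi (((t j : ℤ) - t k : ℤ) * x) *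
      expTwoPi (-(((s j : ℤ) - s k : ℤ) * y))) := by
  rw [trigKernel, Complex.ofReal_add, ofReal_norm_sq_trigSum, ofReal_norm_sq_trigSum,
    ← Finset.sum_add_distrib]
  refine Finset.sum_congr rfl fun j _ => ?_
  rw [← Finset.sum_add_distrib]
  refine Finset.sum_congr rfl fun k _ => ?_
  rw [mul_neg, mul_neg]
  ring

lemma norm_trigSum_le (x y : ℝ) : ‖trigSum p s t x y‖ ≤ ∑ j, |p j| := by
  refine (norm_sum_le _ _).trans (Finset.sum_le_sum fun j _ => ?_)
  simp

lemma norm_trigSum_neg (x y : ℝ) : ‖trigSum p s t (-x) (-y)‖ = ‖trigSum p s t x y‖ := by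
  rw [← Complex.norm_conj (trigSum p s t x y)]
  congr 1
  simp only [trigSum, map_sum, map_mul, conj_expTwoPi, Complex.conj_ofReal]
  refine Finset.sum_congr rfl fun j _ => ?_
  congr 2
  ring

lemma isQVEKernel_trigKernel : IsQVEKernel (trigKernel p s t) where
  measurable := (continuous_trigKernel p s t).measurable
  nonneg x y := by unfold trigKernel; positivity
  bounded := by
    refine ⟨(∑ j, |p j|) ^ 2 + (∑ j, |p j|) ^ 2, fun x y => ?_⟩
    unfold trigKernel
    gcongr <;> exact norm_trigSum_le _ _ _ _ _
  symm x y := by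
    unfold trigKernel
    rw [← norm_trigSum_neg p s t y (-x), ← norm_trigSum_neg p s t (-x) y, neg_neg, add_comm]

lemma energy_average {ι : Type*} (S : Finset ι) (r : ι → ℂ) (w : ι → ℝ) (c : ℂ) (x : ℝ) :
    energy p s t (fun u => c * ∑ l ∈ S, r l * expTwoPi (-(u * w l))) x =
      c * ∑ l ∈ S, r l * trigKernel p s t x (w l) := by
  simp_rw [ofReal_trigKernel, Finset.mul_sum]
  rw [Finset.sum_comm]
  refine Finset.sum_congr rfl fun j _ => ?_
  rw [Finset.sum_comm]
  refine Finset.sum_congr rfl fun k _ => ?_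
  simp only [Finset.mul_sum, ← Finset.sum_add_distrib]
  refine Finset.sum_congr rfl fun l _ => ?_
  ring

lemma energy_integral {m : ℝ → ℂ} (hm : Continuous m) (x : ℝ) :
    energy p s t (fun u => ∫ y in (0 : ℝ)..1, m y * expTwoPi (-(u * y))) x =
      ∫ y in (0 : ℝ)..1, (trigKernel p s t x y : ℂ) * m y := by
  have hi : ∀ F : ℝ → ℂ, Continuous F → IntervalIntegrable F volume 0 1 := fun F hF =>
    hF.intervalIntegrable _ _
  simp_rw [ofReal_trigKernel, Finset.sum_mul]
  rw [intervalIntegral.integral_finsetSum fun j _ => hi _ (by fun_prop)]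
  refine Finset.sum_congr rfl fun j _ => ?_
  rw [intervalIntegral.integral_finsetSum fun j _ => hi _ (by fun_prop)]
  refine Finset.sum_congr rfl fun k _ => ?_
  rw [← intervalIntegral.integral_const_mul, ← intervalIntegral.integral_const_mul,
    ← intervalIntegral.integral_add (hi _ (by fun_prop)) (hi _ (by fun_prop)),
    ← intervalIntegral.integral_const_mul]
  congr 1
  ext y
  ring

lemma norm_energy_sub_le (ρ ρ' : ℤ → ℂ) (x : ℝ) :
    ‖energy p s t ρ x - energy p s t ρ' x‖ ≤ ∑ j, ∑ k, |p j| * |p k| *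
      (‖ρ ((t j : ℤ) - t k) - ρ' ((t j : ℤ) - t k)‖ +
        ‖ρ ((s j : ℤ) - s k) - ρ' ((s j : ℤ) - s k)‖) := by
  unfold energy
  simp_rw [← Finset.sum_sub_distrib]
  refine (norm_sum_le _ _).trans (Finset.sum_le_sum fun j _ =>
    (norm_sum_le _ _).trans (Finset.sum_le_sum fun k _ => ?_))
  rw [← mul_sub, norm_mul, norm_mul, Complex.norm_real, Complex.norm_real, Real.norm_eq_abs,
    Real.norm_eq_abs]
  gcongr
  rw [add_sub_add_comm, ← mul_sub, ← mul_sub]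
  refine (norm_add_le _ _).trans ?_
  simp

end TrigKernel

section QVELimit

open Topology

variable {J : Type*} [Fintype J] (p : J → ℝ) (s t : J → ℕ)

lemma norm_neg_inv_sub_le {w w' : ℂ} {η : ℝ} (hη : 0 < η) (h : η ≤ w.im) (h' : η ≤ w'.im) :
    ‖-w⁻¹ - -w'⁻¹‖ ≤ η⁻¹ ^ 2 * ‖w - w'‖ := by
  have hw : w ≠ 0 := fun h0 => by rw [h0, Complex.zero_im] at h; linarith
  have hw' : w' ≠ 0 := fun h0 => by rw [h0, Complex.zero_im] at h'; linarith
  have e : -w⁻¹ - -w'⁻¹ = w⁻¹ * w'⁻¹ * (w - w') := by field_simp; ring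
  have b : ∀ v : ℂ, η ≤ v.im → ‖v⁻¹‖ ≤ η⁻¹ := fun v hv => by
    rw [norm_inv]
    exact inv_anti₀ hη (hv.trans ((le_abs_self _).trans (Complex.abs_im_le_norm v)))
  rw [e, norm_mul, norm_mul, sq]
  exact mul_le_mul_of_nonneg_right (mul_le_mul (b w h) (b w' h') (norm_nonneg _)
    (inv_nonneg.2 hη.le)) (norm_nonneg _)

/-- The data of an approximate discrete solution of the quadratic vector equation. -/
structure IsApproxQVE (z : ℂ) (C : ℝ) (n : ℕ) (ρ : ℤ → ℂ) (r : ℕ → ℂ) : Prop where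
  fourier : ∀ u : ℤ, ρ u = ((n + 1 : ℕ) : ℂ)⁻¹ * ∑ l ∈ Finset.range (n + 1),
    r l * expTwoPi (-((u : ℝ) * ((l : ℝ) / (n + 1 : ℕ))))
  im_nonneg : ∀ l : ℕ, 0 ≤ (r l).im
  approx : ∀ l : ℕ, ‖1 + (z + energy p s t ρ ((l : ℝ) / (n + 1 : ℕ))) * r l‖ ≤ C / √(n + 1 : ℕ)

variable {p s t} {z : ℂ} {C : ℝ}

lemma IsApproxQVE.im_energy_nonneg {n : ℕ} {ρ : ℤ → ℂ} {r : ℕ → ℂ}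
    (h : IsApproxQVE p s t z C n ρ r) (x : ℝ) : 0 ≤ (energy p s t ρ x).im := by
  have h1 : ρ = fun u : ℤ => ((n + 1 : ℕ) : ℂ)⁻¹ * ∑ l ∈ Finset.range (n + 1),
    r l * expTwoPi (-(u * ((l : ℝ) / (n + 1 : ℕ)))) := funext h.fourier
  rw [h1, energy_average p s t (Finset.range (n + 1)) r (fun l : ℕ => (l : ℝ) / (n + 1 : ℕ)),
    show (((n + 1 : ℕ) : ℂ)⁻¹) = (((n + 1 : ℕ) : ℝ)⁻¹ : ℝ) by push_cast; rfl,
    Complex.im_ofReal_mul, Complex.im_sum]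
  refine mul_nonneg (by positivity) (Finset.sum_nonneg fun l _ => ?_)
  rw [Complex.im_mul_ofReal]
  exact mul_nonneg (h.im_nonneg l) ((isQVEKernel_trigKernel p s t).nonneg _ _)

lemma IsApproxQVE.norm_sub_le {n : ℕ} {ρ : ℤ → ℂ} {r : ℕ → ℂ} (hz : 0 < z.im)
    (h : IsApproxQVE p s t z C n ρ r) {ρ' : ℤ → ℂ} (hρ' : ∀ x, 0 ≤ (energy p s t ρ' x).im)
    {ε : ℝ} (hε : ∀ x, ‖energy p s t ρ x - energy p s t ρ' x‖ ≤ ε) (u : ℤ) :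
    ‖ρ u - ((n + 1 : ℕ) : ℂ)⁻¹ * ∑ l ∈ Finset.range (n + 1),
      -(z + energy p s t ρ' ((l : ℝ) / (n + 1 : ℕ)))⁻¹ *
        expTwoPi (-(u * ((l : ℝ) / (n + 1 : ℕ))))‖ ≤ z.im⁻¹ * (C / √(n + 1 : ℕ)) +
      z.im⁻¹ ^ 2 * ε := by
  rw [h.fourier, ← mul_sub, ← Finset.sum_sub_distrib, norm_mul, norm_inv, Complex.norm_natCast,
    inv_mul_le_iff₀ (by positivity)]
  refine (norm_sum_le _ _).trans ((Finset.sum_le_sum (g := fun _ => z.im⁻¹ * (C / √(n + 1 : ℕ)) +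
      z.im⁻¹ ^ 2 * ε) fun l _ => ?_).trans (le_of_eq (by simp; ring)))
  rw [← sub_mul, norm_mul, norm_expTwoPi, mul_one]
  set x := (l : ℝ) / (n + 1 : ℕ)
  set w := z + energy p s t ρ x with hw
  set w' := z + energy p s t ρ' x with hw'
  have hwi : z.im ≤ w.im := by rw [hw, Complex.add_im]; linarith [h.im_energy_nonneg x]
  have hwi' : z.im ≤ w'.im := by rw [hw', Complex.add_im]; linarith [hρ' x]
  have hw0 : w ≠ 0 := fun h0 => by rw [h0, Complex.zero_im] at hwi; linarith
  have e : r l - -w'⁻¹ = w⁻¹ * (1 + w * r l) + (-w⁻¹ - -w'⁻¹) := by field_simp; ring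
  rw [e]
  refine (norm_add_le _ _).trans (add_le_add ?_ ?_)
  · rw [norm_mul, norm_inv]
    refine mul_le_mul (inv_anti₀ hz (hwi.trans ((le_abs_self _).trans (Complex.abs_im_le_norm w))))
      (h.approx l) (norm_nonneg _) (by positivity)
  · refine (norm_neg_inv_sub_le hz hwi hwi').trans ?_
    gcongr
    rw [hw, hw', add_sub_add_left_eq_sub]
    exact hε x

lemma isQVESolution_of_tendsto (hz : 0 < z.im) {ν : ℕ → ℕ} (hν : Tendsto ν atTop atTop)
    {ρ : ℕ → ℤ → ℂ} {r : ℕ → ℕ → ℂ} (h : ∀ k, IsApproxQVE p s t z C (ν k) (ρ k) (r k))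
    {ρ' : ℤ → ℂ} (hlim : Tendsto ρ atTop (𝓝 ρ')) :
    IsQVESolution (volume.restrict (Set.Ioc (0 : ℝ) 1)) (trigKernel p s t) z
      (fun x => -(z + energy p s t ρ' x)⁻¹) ∧
    ρ' 0 = ∫ x in Set.Ioc (0 : ℝ) 1, -(z + energy p s t ρ' x)⁻¹ := by
  set ε : ℕ → ℝ := fun k => ∑ i, ∑ j, |p i| * |p j| *
      (‖ρ k ((t i : ℤ) - t j) - ρ' ((t i : ℤ) - t j)‖ +
        ‖ρ k ((s i : ℤ) - s j) - ρ' ((s i : ℤ) - s j)‖) with hε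
  have hpt : ∀ u, Tendsto (fun k => ρ k u) atTop (𝓝 (ρ' u)) := fun u =>
    (tendsto_pi_nhds.1 hlim) u
  have hnorm : ∀ u, Tendsto (fun k => ‖ρ k u - ρ' u‖) atTop (𝓝 0) := fun u =>
    tendsto_iff_norm_sub_tendsto_zero.1 (hpt u)
  have hε0 : Tendsto ε atTop (𝓝 0) := by
    have : Tendsto ε atTop (𝓝 (∑ i, ∑ j, |p i| * |p j| * ((0 : ℝ) + 0))) :=
      tendsto_finsetSum _ fun i _ => tendsto_finsetSum _ fun j _ =>
        ((hnorm _).add (hnorm _)).const_mul _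
    simpa using this
  have hεle : ∀ k x, ‖energy p s t (ρ k) x - energy p s t ρ' x‖ ≤ ε k := fun k x =>
    norm_energy_sub_le p s t _ _ x
  have hen : ∀ x, Tendsto (fun k => energy p s t (ρ k) x) atTop (𝓝 (energy p s t ρ' x)) :=
    fun x => tendsto_iff_norm_sub_tendsto_zero.2
      (squeeze_zero (fun _ => norm_nonneg _) (fun k => hεle k x) hε0)
  have him : ∀ x, 0 ≤ (energy p s t ρ' x).im := fun x =>
    ge_of_tendsto' ((Complex.continuous_im.tendsto _).comp (hen x))
      fun k => (h k).im_energy_nonneg x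
  have hwi : ∀ x, z.im ≤ (z + energy p s t ρ' x).im := fun x => by
    rw [Complex.add_im]; linarith [him x]
  have hw0 : ∀ x, z + energy p s t ρ' x ≠ 0 := fun x h0 => by
    have := hwi x
    rw [h0, Complex.zero_im] at this
    linarith
  set m : ℝ → ℂ := fun x => -(z + energy p s t ρ' x)⁻¹ with hm
  have hmc : Continuous m :=
    ((continuous_const.add (continuous_energy p s t ρ')).inv₀ hw0).neg
  have hfour : ∀ u, ρ' u = ∫ y in (0 : ℝ)..1, m y * expTwoPi (-(u * y)) := by
    intro u
    have h1 : Tendsto (fun k => ((ν k + 1 : ℕ) : ℂ)⁻¹ * ∑ l ∈ Finset.range (ν k + 1),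
        m ((l : ℝ) / (ν k + 1 : ℕ)) * expTwoPi (-(u * ((l : ℝ) / (ν k + 1 : ℕ))))) atTop
        (𝓝 (∫ y in (0 : ℝ)..1, m y * expTwoPi (-(u * y)))) :=
      (tendsto_riemann_sum (F := fun y => m y * expTwoPi (-(u * y))) (by fun_prop)).comp hν
    have h2 : Tendsto (fun k => z.im⁻¹ * (C / √(ν k + 1 : ℕ)) + z.im⁻¹ ^ 2 * ε k) atTop (𝓝 0) := by
      have h3 : Tendsto (fun k => √((ν k + 1 : ℕ) : ℝ)) atTop atTop :=
        tendsto_sqrt_atTop.comp (tendsto_natCast_atTop_atTop.comp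
          ((tendsto_add_atTop_nat 1).comp hν))
      have := ((h3.const_div_atTop C).const_mul z.im⁻¹).add (hε0.const_mul (z.im⁻¹ ^ 2))
      simpa using this
    have h4 := squeeze_zero (fun k => norm_nonneg _)
      (fun k => (h k).norm_sub_le hz him (hεle k) u) h2
    have h5 := (tendsto_zero_iff_norm_tendsto_zero.2 h4).add h1
    rw [zero_add] at h5
    exact tendsto_nhds_unique (hpt u) (h5.congr fun k => sub_add_cancel _ _)
  have hmi : ∀ x, 0 ≤ (m x).im := fun x => by
    simp only [hm, Complex.neg_im, Complex.inv_im]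
    rw [neg_div, neg_neg]
    exact div_nonneg (hz.le.trans (hwi x)) (Complex.normSq_nonneg _)
  refine ⟨⟨hmc.measurable, ⟨z.im⁻¹, fun x => ?_⟩, hmi, fun x => ?_⟩, ?_⟩
  · rw [norm_neg, norm_inv]
    exact inv_anti₀ hz ((hwi x).trans ((le_abs_self _).trans (Complex.abs_im_le_norm _)))
  · have e := energy_integral p s t hmc x
    rw [← funext hfour, intervalIntegral.integral_of_le zero_le_one] at e
    change m x * (z + ∫ y in Set.Ioc (0 : ℝ) 1, (trigKernel p s t x y : ℂ) * m y) = -1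
    rw [← e]
    have := hw0 x
    simp only [hm]
    field_simp
  · have := hfour 0
    rw [intervalIntegral.integral_of_le zero_le_one] at this
    simpa using this

/-- Approximate discrete solutions of the quadratic vector equation converge. -/
theorem exists_tendsto_of_isApproxQVE {a : ℝ} (ha : 0 < a) (hK : ∀ x y, a ≤ trigKernel p s t x y)
    (hz : 0 < z.im) {ρ : ℕ → ℤ → ℂ} {r : ℕ → ℕ → ℂ}
    (h : ∀ n, IsApproxQVE p s t z C n (ρ n) (r n)) {B : ℝ} (hB : ∀ n u, ‖ρ n u‖ ≤ B) :
    ∃ M : ℂ, ‖M‖ ≤ √a⁻¹ ∧ Tendsto (fun n => ρ n 0) atTop (𝓝 M) := by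
  have hcpt : IsCompact (Set.univ.pi fun _ : ℤ => Metric.closedBall (0 : ℂ) B) :=
    isCompact_univ_pi fun _ => isCompact_closedBall _ _
  have hmem : ∀ n, ρ n ∈ Set.univ.pi fun _ : ℤ => Metric.closedBall (0 : ℂ) B := fun n u _ => by
    simpa using hB n u
  have hsub : ∀ ν : ℕ → ℕ, Tendsto ν atTop atTop → ∃ ψ : ℕ → ℕ, StrictMono ψ ∧ ∃ m,
      IsQVESolution (volume.restrict (Set.Ioc (0 : ℝ) 1)) (trigKernel p s t) z m ∧
      Tendsto (fun k => ρ (ν (ψ k)) 0) atTop (𝓝 (∫ x in Set.Ioc (0 : ℝ) 1, m x)) := by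
    intro ν hν
    obtain ⟨ρ', -, ψ, hψ, hlim⟩ := hcpt.tendsto_subseq fun k => hmem (ν k)
    obtain ⟨h1, h2⟩ := isQVESolution_of_tendsto hz (hν.comp hψ.tendsto_atTop)
      (fun k => h (ν (ψ k))) hlim
    exact ⟨ψ, hψ, _, h1, h2 ▸ (tendsto_pi_nhds.1 hlim) 0⟩
  obtain ⟨ψ₀, hψ₀, m, hm, -⟩ := hsub id tendsto_id
  have : IsProbabilityMeasure (volume.restrict (Set.Ioc (0 : ℝ) 1)) := ⟨by simp⟩
  have hKs := isQVEKernel_trigKernel p s t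
  refine ⟨∫ x in Set.Ioc (0 : ℝ) 1, m x, ?_, ?_⟩
  · obtain ⟨B', hB'⟩ := hm.bounded
    have hmemLp : MemLp (fun x => ‖m x‖) 2 (volume.restrict (Set.Ioc (0 : ℝ) 1)) :=
      MemLp.of_bound hm.measurable.norm.aestronglyMeasurable B'
        (Eventually.of_forall fun x => by rw [norm_norm]; exact hB' x)
    refine (norm_integral_le_integral_norm _).trans (Real.le_sqrt_of_sq_le ?_)
    exact (sq_integral_le hmemLp).trans (hm.integral_norm_sq_le ha hKs hK hz)
  · refine tendsto_of_subseq_tendsto fun ν hν => ?_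
    obtain ⟨ψ, -, m', hm', hlim⟩ := hsub ν hν
    rw [hm'.unique hKs hz hm] at hlim
    exact ⟨ψ, hlim⟩

end QVELimit

section CyclicGroup

open ProbabilityTheory Topology

lemma stdAddChar_eq_expTwoPi {N : ℕ} [NeZero N] (j : ℤ) :
    ZMod.stdAddChar (j : ZMod N) = expTwoPi ((j : ℝ) / N) := by
  rw [ZMod.stdAddChar_coe, expTwoPi]
  push_cast
  ring_nf

lemma sum_zmod_eq_sum_range {n : ℕ} {E : Type*} [AddCommMonoid E] (F : ZMod (n + 1) → E) :
    ∑ k, F k = ∑ l ∈ Finset.range (n + 1), F (l : ZMod (n + 1)) := by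
  have h : ∀ k : Fin (n + 1), F k = F ((k : ℕ) : ZMod (n + 1)) := fun k => by
    congr 1
    exact (ZMod.natCast_zmod_val (n := n + 1) k).symm
  rw [← Fin.sum_univ_eq_sum_range (fun l : ℕ => F (l : ZMod (n + 1)))]
  exact Finset.sum_congr rfl fun k _ => h k

variable {J : Type*} [Fintype J] (p : J → ℝ) (s t : J → ℕ)

/-- The frequencies reduced modulo `n + 1`. -/
def cyclicShift (n : ℕ) (s : J → ℕ) (j : J) : ZMod (n + 1) := s j

/-- The character of `ℤ / (n + 1)` with index `l`. -/
noncomputable def cyclicChar (n l : ℕ) : AddChar (ZMod (n + 1)) ℂ :=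
  ZMod.stdAddChar.mulShift (l : ZMod (n + 1))

lemma cyclicChar_apply_intCast (n l : ℕ) (u : ℤ) :
    cyclicChar n l (u : ZMod (n + 1)) = expTwoPi ((u : ℝ) * ((l : ℝ) / (n + 1 : ℕ))) := by
  rw [cyclicChar, AddChar.mulShift_apply]
  have := stdAddChar_eq_expTwoPi (N := n + 1) (l * u)
  push_cast at this ⊢
  rw [this]
  ring_nf

lemma cyclicChar_inversion (n : ℕ) (F : ZMod (n + 1) → ℂ) (u : ZMod (n + 1)) :
    F u = ((n + 1 : ℕ) : ℂ)⁻¹ * ∑ l ∈ Finset.range (n + 1),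
      (∑ v, cyclicChar n l v * F v) * cyclicChar n l (-u) := by
  have h1 : ∑ l ∈ Finset.range (n + 1), (∑ v, cyclicChar n l v * F v) * cyclicChar n l (-u) =
      ∑ v, F v * ∑ k : ZMod (n + 1), ZMod.stdAddChar (k * (v - u)) := by
    simp_rw [Finset.sum_mul, sum_zmod_eq_sum_range (fun k => ZMod.stdAddChar (k * (_ - u))),
      Finset.mul_sum]
    rw [Finset.sum_comm]
    refine Finset.sum_congr rfl fun v _ => Finset.sum_congr rfl fun l _ => ?_
    simp only [cyclicChar, AddChar.mulShift_apply]
    rw [sub_eq_add_neg, mul_add, AddChar.map_add_eq_mul]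
    ring
  rw [h1]
  simp_rw [AddChar.sum_mulShift _ (ZMod.isPrimitive_stdAddChar (n + 1)), sub_eq_zero]
  have : ((n : ℂ) + 1) ≠ 0 := by exact_mod_cast Nat.succ_ne_zero n
  simp [ZMod.card]
  field_simp

lemma selfEnergy_cyclicChar (n l : ℕ) (ρ : ZMod (n + 1) → ℂ) :
    selfEnergy p (cyclicShift n s) (cyclicShift n t) (cyclicChar n l) ρ =
      energy p s t (fun u : ℤ => ρ u) ((l : ℝ) / (n + 1 : ℕ)) := by
  unfold selfEnergy energy
  refine Finset.sum_congr rfl fun j _ => Finset.sum_congr rfl fun k _ => ?_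
  rw [← cyclicChar_apply_intCast, ← cyclicChar_apply_intCast]
  simp [cyclicShift]

variable {p s t} {z : ℂ}

lemma isApproxQVE_cyclic (hz : 0 < z.im) (n : ℕ) : IsApproxQVE p s t z
    (2 * (∑ j, |p j|) ^ 2 * z.im⁻¹ ^ 2 + 4 * (∑ j, |p j|) ^ 3 * z.im⁻¹ ^ 3) n
    (fun u => meanDiag p (cyclicShift n s) (cyclicShift n t) z (u : ZMod (n + 1)))
    (fun l => meanChar p (cyclicShift n s) (cyclicShift n t) z (cyclicChar n l)) where
  fourier u := by
    rw [cyclicChar_inversion n (meanDiag p (cyclicShift n s) (cyclicShift n t) z)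
      (u : ZMod (n + 1))]
    congr 1
    refine Finset.sum_congr rfl fun l _ => ?_
    have := cyclicChar_apply_intCast n l (-u)
    push_cast at this
    rw [meanChar_eq_sum hz, this]
    push_cast
    ring_nf
  im_nonneg l := im_meanChar_nonneg hz _
  approx l := by
    rw [← selfEnergy_cyclicChar]
    have := norm_schwingerDyson_le (p := p) (s := cyclicShift n s) (t := cyclicShift n t) hz
      (cyclicChar n l)
    rwa [ZMod.card] at this

lemma diagAvg_zero {Z : Type*} [AddCommGroup Z] [Fintype Z] (R : Matrix Z Z ℂ) :
    diagAvg R 0 = (Fintype.card Z : ℂ)⁻¹ * R.trace := by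
  simp [diagAvg, Matrix.trace]

/-- The normalized trace of the resolvent of the circulant model converges. -/
theorem exists_tendsto_trace_circResolvent {a : ℝ} (ha : 0 < a)
    (hK : ∀ x y, a ≤ trigKernel p s t x y) (hz : 0 < z.im) :
    ∃ M : ℂ, ‖M‖ ≤ √a⁻¹ ∧ Tendsto (fun n : ℕ => ∫ ξ, ‖((n + 1 : ℕ) : ℂ)⁻¹ *
      (circResolvent p (cyclicShift n s) (cyclicShift n t) z ξ).trace - M‖
        ∂(gaussianPi (ZMod (n + 1) × ZMod (n + 1)))) atTop (𝓝 0) := by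
  obtain ⟨M, hM, hlim⟩ := exists_tendsto_of_isApproxQVE ha hK hz
    (fun n => isApproxQVE_cyclic (p := p) (s := s) (t := t) hz n)
    (B := z.im⁻¹) fun n u => norm_meanDiag_le hz _
  refine ⟨M, hM, ?_⟩
  set ρ := fun n : ℕ => meanDiag p (cyclicShift n s) (cyclicShift n t) z (0 : ZMod (n + 1)) with hρ
  have hlim' : Tendsto (fun n => ‖ρ n - M‖) atTop (𝓝 0) := by
    simp only [Int.cast_zero] at hlim
    exact tendsto_iff_norm_sub_tendsto_zero.1 hlim
  have hb : Tendsto (fun n : ℕ => 2 * (∑ j, |p j|) * z.im⁻¹ ^ 2 / √((n + 1 : ℕ) : ℝ)) atTop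
      (𝓝 0) :=
    (tendsto_sqrt_atTop.comp (tendsto_natCast_atTop_atTop.comp
      (tendsto_add_atTop_nat 1))).const_div_atTop _
  have hsum := hb.add hlim'
  rw [add_zero] at hsum
  refine squeeze_zero (fun n => integral_nonneg fun ξ => norm_nonneg _) (fun n => ?_) hsum
  have h1 := integral_norm_diagAvg_sub_le (p := p) (s := cyclicShift n s) (t := cyclicShift n t) hz
    (0 : ZMod (n + 1))
  rw [ZMod.card] at h1
  have hi : Integrable (fun ξ => ‖diagAvg (circResolvent p (cyclicShift n s) (cyclicShift n t) z ξ) 0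
      - ρ n‖) (gaussianPi (ZMod (n + 1) × ZMod (n + 1))) :=
    ((integrable_diagAvg_circResolvent hz 0).sub (integrable_const _)).norm
  calc _ ≤ ∫ ξ, (‖diagAvg (circResolvent p (cyclicShift n s) (cyclicShift n t) z ξ) 0
        - ρ n‖ + ‖ρ n - M‖) ∂(gaussianPi (ZMod (n + 1) × ZMod (n + 1))) := by
        refine integral_mono_of_nonneg (Eventually.of_forall fun ξ => norm_nonneg _)
          (hi.add (integrable_const _)) (Eventually.of_forall fun ξ => ?_)
        simp only [diagAvg_zero, ZMod.card]
        exact norm_sub_le_norm_sub_add_norm_sub _ _ _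
    _ ≤ _ := by
        rw [integral_add hi (integrable_const _)]
        simpa using h1

end CyclicGroup

section GaussianComparison

open ProbabilityTheory
open scoped Matrix

variable {T : Type*} [MeasurableSpace T]

/-- The family `X` is jointly centered Gaussian, with the covariance of the vectors `a` in the
real Hilbert space `L²(μ; ℂ)`. -/
def IsGaussianFamily {Ω ι : Type*} [MeasurableSpace Ω] [Fintype ι] (P : Measure Ω)
    (X : ι → Ω → ℝ) (μ : Measure T) (a : ι → T → ℂ) : Prop :=
  ∀ c : ι → ℝ, P.map (fun ω => ∑ i, c i * X i ω) =
    gaussianReal 0 (∫ x, ‖∑ i, (c i : ℂ) * a i x‖ ^ 2 ∂μ).toNNReal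

lemma charFun_map_eq_charFun_inner {Ω ι : Type*} [MeasurableSpace Ω] [Fintype ι] {P : Measure Ω}
    {X : ι → Ω → ℝ} (hX : ∀ i, Measurable (X i)) (c : EuclideanSpace ℝ ι) :
    charFun (P.map fun ω => WithLp.toLp 2 fun i => X i ω) c =
      charFun (P.map fun ω => ∑ i, c i * X i ω) 1 := by
  have h1 : Measurable fun ω => (WithLp.toLp 2 fun i => X i ω : EuclideanSpace ℝ ι) := by fun_prop
  have h2 : Measurable fun ω => ∑ i, c i * X i ω := by fun_prop
  rw [charFun_apply, charFun_apply, integral_map h1.aemeasurable (by fun_prop),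
    integral_map h2.aemeasurable (by fun_prop)]
  simp [PiLp.inner_apply]

/-- Gaussian families with the same covariances have the same law. -/
lemma IsGaussianFamily.map_eq {Ω Ω' ι : Type*} [MeasurableSpace Ω] [MeasurableSpace Ω'] [Fintype ι]
    {P : Measure Ω} {P' : Measure Ω'} [IsProbabilityMeasure P] [IsProbabilityMeasure P']
    {X : ι → Ω → ℝ} {X' : ι → Ω' → ℝ} {μ : Measure T} {a : ι → T → ℂ}
    (hX : ∀ i, Measurable (X i)) (hX' : ∀ i, Measurable (X' i))
    (h : IsGaussianFamily P X μ a) (h' : IsGaussianFamily P' X' μ a) :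
    P.map (fun ω i => X i ω) = P'.map (fun ω i => X' i ω) := by
  have e : P.map (fun ω => (WithLp.toLp 2 fun i => X i ω : EuclideanSpace ℝ ι)) =
      P'.map (fun ω => WithLp.toLp 2 fun i => X' i ω) := by
    have h1 : Measurable fun ω => (WithLp.toLp 2 fun i => X i ω : EuclideanSpace ℝ ι) := by
      fun_prop
    have h2 : Measurable fun ω => (WithLp.toLp 2 fun i => X' i ω : EuclideanSpace ℝ ι) := by
      fun_prop
    have := Measure.isProbabilityMeasure_map (μ := P) h1.aemeasurable
    have := Measure.isProbabilityMeasure_map (μ := P') h2.aemeasurable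
    refine Measure.ext_of_charFun (funext fun c => ?_)
    rw [charFun_map_eq_charFun_inner hX, charFun_map_eq_charFun_inner hX', h, h']
  have e2 := congrArg (fun ρ => ρ.map (WithLp.ofLp : EuclideanSpace ℝ ι → ι → ℝ)) e
  simp only at e2
  rwa [Measure.map_map (by fun_prop) (by fun_prop), Measure.map_map (by fun_prop) (by fun_prop)]
    at e2

/-- The Gram matrix of a family of vectors in the real Hilbert space `L²(μ; ℂ)`. -/
noncomputable def gram {ι : Type*} (μ : Measure T) (a : ι → T → ℂ) : Matrix ι ι ℝ :=
  Matrix.of fun i j => ∫ x, (starRingEnd ℂ (a i x) * a j x).re ∂μ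

lemma integrable_conj_mul {μ : Measure T} {u v : T → ℂ} (hu : MemLp u 2 μ) (hv : MemLp v 2 μ) :
    Integrable (fun x => starRingEnd ℂ (u x) * v x) μ := by
  have : MemLp (fun x => starRingEnd ℂ (u x)) 2 μ := hu.star
  exact this.integrable_mul hv

lemma norm_sq_sum_eq {ι : Type*} [Fintype ι] (c : ι → ℝ) (v : ι → ℂ) :
    ‖∑ i, (c i : ℂ) * v i‖ ^ 2 = ∑ i, ∑ j, c i * c j * (starRingEnd ℂ (v i) * v j).re := by
  have : ((‖∑ i, (c i : ℂ) * v i‖ ^ 2 : ℝ) : ℂ) =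
      ∑ i, ∑ j, ((c i * c j : ℝ) : ℂ) * (starRingEnd ℂ (v i) * v j) := by
    rw [← Complex.normSq_eq_norm_sq, Complex.normSq_eq_conj_mul_self, map_sum, Finset.sum_mul_sum]
    refine Finset.sum_congr rfl fun j _ => Finset.sum_congr rfl fun k _ => ?_
    rw [map_mul, Complex.conj_ofReal]
    push_cast
    ring
  have h2 := congrArg Complex.re this
  rw [Complex.ofReal_re] at h2
  rw [h2, Complex.re_sum]
  refine Finset.sum_congr rfl fun j _ => ?_
  rw [Complex.re_sum]
  exact Finset.sum_congr rfl fun k _ => Complex.re_ofReal_mul _ _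

lemma integral_norm_sq_sum {ι : Type*} [Fintype ι] {μ : Measure T} {a : ι → T → ℂ}
    (ha : ∀ i, MemLp (a i) 2 μ) (c : ι → ℝ) :
    ∫ x, ‖∑ i, (c i : ℂ) * a i x‖ ^ 2 ∂μ = c ⬝ᵥ gram μ a *ᵥ c := by
  have hi : ∀ i j, Integrable (fun x => c i * c j * (starRingEnd ℂ (a i x) * a j x).re) μ :=
    fun i j => ((integrable_conj_mul (ha i) (ha j)).re).const_mul _
  simp_rw [norm_sq_sum_eq]
  rw [integral_finsetSum _ fun i _ => integrable_finsetSum _ fun j _ => hi i j]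
  simp only [dotProduct, Matrix.mulVec, Finset.mul_sum, gram, Matrix.of_apply]
  refine Finset.sum_congr rfl fun i _ => ?_
  rw [integral_finsetSum _ fun j _ => hi i j]
  refine Finset.sum_congr rfl fun j _ => ?_
  rw [integral_const_mul]
  ring

lemma posSemidef_gram {ι : Type*} [Fintype ι] {μ : Measure T} {a : ι → T → ℂ}
    (ha : ∀ i, MemLp (a i) 2 μ) : (gram μ a).PosSemidef := by
  refine Matrix.PosSemidef.of_dotProduct_mulVec_nonneg ?_ fun c => ?_
  · ext i j
    simp only [gram, Matrix.conjTranspose_apply, Matrix.of_apply, star_trivial]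
    refine integral_congr_ae (Eventually.of_forall fun x => ?_)
    simp
    ring
  · rw [star_trivial, ← integral_norm_sq_sum ha]
    exact integral_nonneg fun x => by positivity

/-- The existence of Gaussian families with given covariances. -/
lemma exists_isGaussianFamily {ι : Type*} [Fintype ι] [DecidableEq ι] {μ : Measure T}
    {a : ι → T → ℂ} (ha : ∀ i, MemLp (a i) 2 μ) :
    IsGaussianFamily (multivariateGaussian 0 (gram μ a)) (fun i x => x i) μ a := by
  intro c
  have hm : Measurable fun x : EuclideanSpace ℝ ι => ∑ i, c i * x i := by fun_prop
  have := Measure.isProbabilityMeasure_map (μ := multivariateGaussian 0 (gram μ a)) hm.aemeasurable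
  refine Measure.ext_of_charFun (funext fun r => ?_)
  have h1 := charFun_multivariateGaussian (μ := (0 : EuclideanSpace ℝ ι)) (posSemidef_gram ha)
    (r • WithLp.toLp 2 c)
  rw [charFun_gaussianReal, Real.coe_toNNReal _ (integral_nonneg fun x => by positivity),
    integral_norm_sq_sum ha]
  rw [charFun_apply] at h1 ⊢
  rw [integral_map hm.aemeasurable (by fun_prop)]
  refine Eq.trans ?_ (h1.trans ?_)
  · refine integral_congr_ae (Eventually.of_forall fun x => ?_)
    simp only
    congr 3
    simp only [PiLp.inner_apply, PiLp.smul_apply, smul_eq_mul]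
    simp [Finset.mul_sum, mul_assoc]
  · congr 1
    simp [Matrix.mulVec_smul]
    ring

/-- The expectations of a Lipschitz function of two Gaussian families are close when the
corresponding vectors are close. -/
theorem IsGaussianFamily.abs_integral_sub_le {Ω Ω' ι : Type*} [MeasurableSpace Ω]
    [MeasurableSpace Ω'] [Fintype ι] {P : Measure Ω} {P' : Measure Ω'} [IsProbabilityMeasure P]
    [IsProbabilityMeasure P'] {X : ι → Ω → ℝ} {X' : ι → Ω' → ℝ} {μ : Measure T}
    {a b : ι → T → ℂ} (hX : ∀ i, Measurable (X i)) (hX' : ∀ i, Measurable (X' i))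
    (ha : ∀ i, MemLp (a i) 2 μ) (hb : ∀ i, MemLp (b i) 2 μ)
    (h : IsGaussianFamily P X μ a) (h' : IsGaussianFamily P' X' μ b) {Φ : (ι → ℝ) → ℝ}
    (hΦ : Measurable Φ) {C : ℝ} (hC : ∀ x, |Φ x| ≤ C) {L : ℝ} (hL0 : 0 ≤ L)
    (hL : ∀ x y, |Φ x - Φ y| ≤ L * √(∑ i, (x i - y i) ^ 2)) :
    |∫ ω, Φ (fun i => X i ω) ∂P - ∫ ω, Φ (fun i => X' i ω) ∂P'| ≤
      L * √(∑ i, ∫ x, ‖a i x - b i x‖ ^ 2 ∂μ) := by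
  classical
  set v : ι ⊕ ι → T → ℂ := Sum.elim a b with hv
  have hvm : ∀ k, MemLp (v k) 2 μ := by
    rintro (i | i)
    exacts [ha i, hb i]
  set γ := multivariateGaussian 0 (gram μ v) with hγ
  have hG : IsGaussianFamily γ (fun k x => x k) μ v := exists_isGaussianFamily hvm
  have hl : IsGaussianFamily γ (fun i x => x (Sum.inl i)) μ a := fun c => by
    have := hG (Sum.elim c 0)
    simpa [Fintype.sum_sum_type, hv] using this
  have hr : IsGaussianFamily γ (fun i x => x (Sum.inr i)) μ b := fun c => by
    have := hG (Sum.elim 0 c)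
    simpa [Fintype.sum_sum_type, hv] using this
  have e1 : ∫ ω, Φ (fun i => X i ω) ∂P = ∫ x, Φ (fun i => x (Sum.inl i)) ∂γ := by
    have := h.map_eq hX (by fun_prop) hl
    rw [← integral_map (φ := fun ω i => X i ω) (by fun_prop) hΦ.aestronglyMeasurable, this,
      integral_map (by fun_prop) hΦ.aestronglyMeasurable]
  have e2 : ∫ ω, Φ (fun i => X' i ω) ∂P' = ∫ x, Φ (fun i => x (Sum.inr i)) ∂γ := by
    have := h'.map_eq hX' (by fun_prop) hr
    rw [← integral_map (φ := fun ω i => X' i ω) (by fun_prop) hΦ.aestronglyMeasurable, this,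
      integral_map (by fun_prop) hΦ.aestronglyMeasurable]
  have hdiff : ∀ i, γ.map (fun x => x (Sum.inl i) - x (Sum.inr i)) =
      gaussianReal 0 (∫ x, ‖a i x - b i x‖ ^ 2 ∂μ).toNNReal := fun i => by
    have := hG (Pi.single (Sum.inl i) 1 - Pi.single (Sum.inr i) 1)
    simpa [Fintype.sum_sum_type, hv, Pi.single_apply, sub_mul, Finset.sum_sub_distrib,
      sub_eq_add_neg, apply_ite Complex.ofReal] using this
  have hmem : ∀ i, MemLp (fun x : EuclideanSpace ℝ (ι ⊕ ι) => x (Sum.inl i) - x (Sum.inr i)) 2 γ :=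
    fun i => by
    have h1 := memLp_id_gaussianReal (μ := 0) (v := (∫ x, ‖a i x - b i x‖ ^ 2 ∂μ).toNNReal) 2
    rw [← hdiff i] at h1
    exact (memLp_map_measure_iff (by fun_prop) (by fun_prop)).1 h1
  have hvar : ∀ i, ∫ x, (x (Sum.inl i) - x (Sum.inr i)) ^ 2 ∂γ = ∫ x, ‖a i x - b i x‖ ^ 2 ∂μ :=
    fun i => by
    have h1 := variance_fun_id_gaussianReal (μ := 0)
      (v := (∫ x, ‖a i x - b i x‖ ^ 2 ∂μ).toNNReal)
    rw [variance_eq_integral (by fun_prop), integral_id_gaussianReal,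
      Real.coe_toNNReal _ (integral_nonneg fun x => by positivity), ← hdiff i,
      integral_map (by fun_prop) (by fun_prop)] at h1
    simpa using h1
  set S : EuclideanSpace ℝ (ι ⊕ ι) → ℝ := fun x => ∑ i, (x (Sum.inl i) - x (Sum.inr i)) ^ 2 with hS
  have hSi : Integrable S γ := integrable_finsetSum _ fun i _ => (hmem i).integrable_sq
  have hsq : MemLp (fun x => √(S x)) 2 γ := by
    rw [memLp_two_iff_integrable_sq (by fun_prop)]
    refine hSi.congr (Eventually.of_forall fun x => ?_)
    exact (Real.sq_sqrt (Finset.sum_nonneg fun i _ => sq_nonneg _)).symm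
  have hi1 : Integrable (fun x : EuclideanSpace ℝ (ι ⊕ ι) => Φ (fun i => x (Sum.inl i))) γ :=
    integrable_of_norm_le (hΦ.comp (by fun_prop)).aestronglyMeasurable fun x => hC _
  have hi2 : Integrable (fun x : EuclideanSpace ℝ (ι ⊕ ι) => Φ (fun i => x (Sum.inr i))) γ :=
    integrable_of_norm_le (hΦ.comp (by fun_prop)).aestronglyMeasurable fun x => hC _
  rw [e1, e2, ← integral_sub hi1 hi2, ← Real.norm_eq_abs]
  refine (norm_integral_le_of_norm_le ((hsq.integrable (by norm_num)).const_mul L)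
    (Eventually.of_forall fun x => hL _ _)).trans ?_
  rw [integral_const_mul]
  refine mul_le_mul_of_nonneg_left (Real.le_sqrt_of_sq_le ?_) hL0
  refine (sq_integral_le hsq).trans (le_of_eq ?_)
  rw [← Finset.sum_congr rfl fun i _ => hvar i,
    ← integral_finsetSum _ fun i _ => (hmem i).integrable_sq]
  refine integral_congr_ae (Eventually.of_forall fun x => ?_)
  exact Real.sq_sqrt (Finset.sum_nonneg fun i _ => sq_nonneg _)

end GaussianComparison

section Torus

/-- The two-dimensional torus `(ℝ / ℤ)²`. -/
abbrev Torus : Type := UnitAddTorus (Fin 2)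

/-- The Haar probability measure on the torus. -/
noncomputable def torusMeasure : Measure Torus :=
  Measure.pi fun _ => (AddCircle.haarAddCircle : Measure UnitAddCircle)

instance : IsProbabilityMeasure torusMeasure := by unfold torusMeasure; infer_instance

instance : torusMeasure.IsAddHaarMeasure := by unfold torusMeasure; infer_instance

/-- The exponential monomials on the torus. -/
noncomputable def torusChar (q : ℤ × ℤ) (θ : Torus) : ℂ := UnitAddTorus.mFourier ![q.1, q.2] θ

/-- The exchange of the two coordinates of the torus. -/
def torusSwap (θ : Torus) : Torus := ![θ 1, θ 0]

instance : torusMeasure.InnerRegular := by unfold torusMeasure; infer_instance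

lemma measurePreserving_torusSwap : MeasurePreserving torusSwap torusMeasure torusMeasure := by
  have h := measurePreserving_finTwoArrow (AddCircle.haarAddCircle : Measure UnitAddCircle)
  have := (h.symm _).comp (Measure.measurePreserving_swap.comp h)
  convert! this using 1

lemma measurePreserving_torusNeg : MeasurePreserving (fun θ : Torus => -θ) torusMeasure torusMeasure :=
  Measure.measurePreserving_neg _

@[fun_prop] lemma continuous_torusSwap : Continuous torusSwap := by
  unfold torusSwap
  fun_prop

@[fun_prop] lemma continuous_torusChar (q : ℤ × ℤ) : Continuous (torusChar q) :=
  (UnitAddTorus.mFourier _).continuous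

lemma torusChar_eq (q : ℤ × ℤ) (θ : Torus) :
    torusChar q θ = fourier q.1 (θ 0) * fourier q.2 (θ 1) := by
  simp [torusChar, UnitAddTorus.mFourier]

lemma torusChar_add (q q' : ℤ × ℤ) (θ : Torus) :
    torusChar (q + q') θ = torusChar q θ * torusChar q' θ := by
  simp only [torusChar_eq, Prod.fst_add, Prod.snd_add, fourier_add]
  ring

lemma conj_torusChar (q : ℤ × ℤ) (θ : Torus) :
    starRingEnd ℂ (torusChar q θ) = torusChar (-q) θ := by
  simp only [torusChar_eq, Prod.fst_neg, Prod.snd_neg, fourier_neg, map_mul]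

@[simp] lemma norm_torusChar (q : ℤ × ℤ) (θ : Torus) : ‖torusChar q θ‖ = 1 := by
  rw [torusChar_eq, norm_mul, fourier_apply, fourier_apply, Circle.norm_coe, Circle.norm_coe,
      one_mul]

lemma torusChar_neg (q : ℤ × ℤ) (θ : Torus) : torusChar q (-θ) = torusChar (-q) θ := by
  simp only [torusChar_eq, Prod.fst_neg, Prod.snd_neg, Pi.neg_apply, fourier_apply, smul_neg,
    neg_smul]

lemma torusChar_swap (q : ℤ × ℤ) (θ : Torus) : torusChar q (torusSwap θ) = torusChar q.swap θ := by
  simp only [torusChar_eq, torusSwap, Prod.fst_swap, Prod.snd_swap]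
  exact mul_comm _ _

lemma torusChar_coe (q : ℤ × ℤ) (x y : ℝ) :
    torusChar q ![(x : UnitAddCircle), (y : UnitAddCircle)] = expTwoPi (q.1 * x + q.2 * y) := by
  rw [torusChar_eq, expTwoPi_add]
  simp only [Matrix.cons_val_zero, Matrix.cons_val_one, expTwoPi, fourier_coe_apply]
  push_cast
  congr 2 <;> ring

lemma integral_torusChar (q : ℤ × ℤ) : ∫ θ, torusChar q θ ∂torusMeasure = if q =
    0 then 1 else 0 := by
  have h1 : ∀ n : ℤ, ∫ x, fourier n x ∂(AddCircle.haarAddCircle : Measure UnitAddCircle) =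
      if n = 0 then 1 else 0 := fun n => by
    split_ifs with h
    · simp [h]
    · have := (orthonormal_iff_ite.1 (orthonormal_fourier (T := 1))) 0 n
      rw [if_neg (fun h' => h h'.symm)] at this
      rw [ContinuousMap.inner_toLp] at this
      simpa using this
  have h2 : ∀ θ, torusChar q θ = ∏ i, fourier (![q.1, q.2] i) (θ i) := fun θ => rfl
  simp_rw [h2, torusMeasure]
  rw [integral_fintype_prod_eq_prod (fun i (x : UnitAddCircle) => fourier (![q.1, q.2] i) x)]
  simp only [h1, Fin.prod_univ_two, Matrix.cons_val_zero, Matrix.cons_val_one]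
  rcases q with ⟨a, b⟩
  by_cases ha : a = 0 <;> by_cases hb : b = 0 <;> simp [ha, hb]

/-- The representative of a point of the circle in `(-π, π]`. -/
noncomputable def circleLift (x : UnitAddCircle) : ℝ :=
  2 * π * (AddCircle.equivIoc 1 (-1 / 2) x).1

lemma circleLift_mem (x : UnitAddCircle) : circleLift x ∈ Set.Ioc (-π) π := by
  have h := (AddCircle.equivIoc 1 (-1 / 2) x).2
  have hp := Real.pi_pos
  unfold circleLift
  constructor <;> nlinarith [h.1, h.2]

lemma coe_circleLift (x : UnitAddCircle) : ((circleLift x / (2 * π) : ℝ) : UnitAddCircle) = x := by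
  have hp := Real.pi_pos.ne'
  rw [circleLift, mul_div_cancel_left₀ _ (by positivity)]
  exact AddCircle.coe_equivIoc

lemma measurePreserving_circleLift : MeasurePreserving circleLift AddCircle.haarAddCircle
    (ENNReal.ofReal (2 * π)⁻¹ • volume.restrict (Set.Ioc (-π) π)) := by
  have hm : Measurable circleLift :=
    (measurable_subtype_coe.comp (AddCircle.measurableEquivIoc 1 (-1 / 2)).measurable).const_mul _
  refine ⟨hm, ?_⟩
  have hp := Real.pi_pos
  have h1 := (UnitAddCircle.measurePreserving_mk (-1 / 2)).map_eq
  rw [AddCircle.volume_eq_smul_haarAddCircle, ENNReal.ofReal_one, one_smul] at h1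
  rw [← h1, Measure.map_map hm AddCircle.measurable_mk']
  have h2 : (circleLift ∘ ((↑) : ℝ → UnitAddCircle)) =ᵐ[volume.restrict
      (Set.Ioc (-1 / 2 : ℝ) (-1 / 2 + 1))] fun x => 2 * π * x := by
    filter_upwards [ae_restrict_mem measurableSet_Ioc] with x hx
    rw [Function.comp_apply, circleLift, AddCircle.equivIoc_coe_of_mem hx]
  rw [Measure.map_congr h2]
  have h3 : Set.Ioc (-1 / 2 : ℝ) (-1 / 2 + 1) = (fun x => 2 * π * x) ⁻¹' Set.Ioc (-π) π := by
    ext x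
    simp only [Set.mem_Ioc, Set.mem_preimage]
    constructor <;> rintro ⟨h, h'⟩ <;> constructor <;> nlinarith
  rw [h3, ← Measure.restrict_map (by fun_prop) measurableSet_Ioc,
    Real.map_volume_mul_left (by positivity), Measure.restrict_smul, abs_of_nonneg (by positivity)]

/-- The representative of a point of the torus in `(-π, π]²`. -/
noncomputable def torusLift (θ : Torus) : ℝ × ℝ := (circleLift (θ 0), circleLift (θ 1))

lemma torusLift_swap (θ : Torus) : torusLift (torusSwap θ) = (torusLift θ).swap := rfl

lemma torusLift_mem (θ : Torus) : torusLift θ ∈ Set.Icc (-π) π ×ˢ Set.Icc (-π) π :=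
  ⟨Set.Ioc_subset_Icc_self (circleLift_mem _), Set.Ioc_subset_Icc_self (circleLift_mem _)⟩

lemma measurePreserving_torusLift : MeasurePreserving torusLift torusMeasure
    (ENNReal.ofReal ((2 * π)⁻¹ ^ 2) • volume.restrict (Set.Icc (-π) π ×ˢ Set.Icc (-π) π)) := by
  have h := measurePreserving_finTwoArrow (AddCircle.haarAddCircle : Measure UnitAddCircle)
  have h2 := (measurePreserving_circleLift.prod measurePreserving_circleLift).comp h
  have hp := Real.pi_pos
  convert! h2 using 1
  rw [Measure.prod_smul_left, Measure.prod_smul_right, Measure.prod_restrict, smul_smul,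
    ← ENNReal.ofReal_mul (by positivity), ← sq, Measure.volume_eq_prod]
  congr 1
  refine Measure.restrict_congr_set (Filter.EventuallyEq.symm ?_)
  exact Measure.set_prod_ae_eq Ioc_ae_eq_Icc Ioc_ae_eq_Icc

lemma torusChar_torusLift (q : ℤ × ℤ) (θ : Torus) :
    torusChar q θ = Complex.exp (Complex.I *
      ((q.1 : ℂ) * ((torusLift θ).1 : ℂ) + (q.2 : ℂ) * ((torusLift θ).2 : ℂ))) := by
  have e : θ = ![((circleLift (θ 0) / (2 * π) : ℝ) : UnitAddCircle),
      ((circleLift (θ 1) / (2 * π) : ℝ) : UnitAddCircle)] := by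
    rw [coe_circleLift, coe_circleLift]
    ext i
    fin_cases i <;> rfl
  have hp : (π : ℂ) ≠ 0 := by exact_mod_cast Real.pi_pos.ne'
  conv_lhs => rw [e, torusChar_coe, expTwoPi]
  congr 1
  simp only [torusLift]
  push_cast
  field_simp

end Torus

section TrigApprox

/-- The trigonometric polynomial with coefficients `p` and nonnegative frequencies `(s, t)`. -/
noncomputable def trigPoly {J : Type*} [Fintype J] (p : J → ℝ) (s t : J → ℕ) (θ : Torus) : ℂ :=
  ∑ j, (p j : ℂ) * torusChar (s j, t j) θ

@[fun_prop] lemma continuous_trigPoly {J : Type*} [Fintype J] (p : J → ℝ) (s t : J → ℕ) :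
    Continuous (trigPoly p s t) := by
  unfold trigPoly
  fun_prop

lemma exists_trigPoly_sub_le (g : C(Torus, ℂ)) {ε : ℝ} (hε : 0 < ε) :
    ∃ (S : Finset (ℤ × ℤ)) (c : ℤ × ℤ → ℂ), ∀ θ, ‖∑ q ∈ S, c q * torusChar q θ - g θ‖ ≤ ε := by
  have hg : g ∈ (Submodule.span ℂ (Set.range (UnitAddTorus.mFourier (d := Fin 2)))).topologicalClosure := by
    rw [UnitAddTorus.span_mFourier_closure_eq_top]
    trivial
  obtain ⟨P, hP, hd⟩ := Metric.mem_closure_iff.1 hg ε hε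
  obtain ⟨c, hc⟩ := (Finsupp.mem_span_range_iff_exists_finsupp).1 hP
  refine ⟨c.support.map (finTwoArrowEquiv ℤ).toEmbedding, fun q => c ![q.1, q.2], fun θ => ?_⟩
  have e : ∑ q ∈ c.support.map (finTwoArrowEquiv ℤ).toEmbedding, c ![q.1, q.2] * torusChar q θ =
      P θ := by
    rw [← hc, Finset.sum_map, Finsupp.sum, ContinuousMap.sum_apply]
    refine Finset.sum_congr rfl fun x _ => ?_
    have hx : ![x 0, x 1] = x := by ext i; fin_cases i <;> rfl
    simp [torusChar, hx]
  rw [e, ← dist_eq_norm, dist_comm]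
  exact (ContinuousMap.dist_apply_le_dist θ).trans hd.le

/-- A strictly positive even square-integrable function on the torus is close in `L²` to a
trigonometric polynomial with real coefficients which is bounded away from zero. -/
lemma exists_real_trigPoly_sub_le {h : Torus → ℝ} (hh : MemLp h 2 torusMeasure)
    (heven : ∀ θ, h (-θ) = h θ) {δ : ℝ} (hδ : 0 < δ) (hpos : ∀ᵐ θ ∂torusMeasure, δ ≤ h θ)
    {ε : ℝ} (hε : 0 < ε) :
    ∃ (S : Finset (ℤ × ℤ)) (c : ℤ × ℤ → ℝ),
      (∀ θ, δ / 2 ≤ ‖∑ q ∈ S, (c q : ℂ) * torusChar q θ‖) ∧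
      ∫ θ, ‖(h θ : ℂ) - ∑ q ∈ S, (c q : ℂ) * torusChar q θ‖ ^ 2 ∂torusMeasure ≤ ε := by
  obtain ⟨g0, hg0, hg0m⟩ := hh.exists_boundedContinuous_eLpNorm_sub_le (by simp)
    (ε := ENNReal.ofReal √(ε / 4)) (by simp; positivity)
  set η := min (δ / 2) √(ε / 4) with hη
  have hη0 : 0 < η := by positivity
  have hη2 : η ^ 2 ≤ ε / 4 := by
    rw [← Real.sq_sqrt (by positivity : 0 ≤ ε / 4)]
    exact pow_le_pow_left₀ hη0.le (min_le_right _ _) 2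
  let g1 : Torus → ℝ := fun θ => max (g0 θ) δ
  have hg1c : Continuous g1 := by fun_prop
  have hg1m : MemLp (fun θ => h θ - g0 θ) 2 torusMeasure := hh.sub hg0m
  have hd : ∫ θ, (h θ - g0 θ) ^ 2 ∂torusMeasure ≤ ε / 4 := by
    have h1 := hg1m.eLpNorm_eq_integral_rpow_norm (by simp) (by simp)
    have h2 : eLpNorm (fun θ => h θ - g0 θ) 2 torusMeasure ≤ ENNReal.ofReal √(ε / 4) := hg0
    rw [h1, ENNReal.ofReal_le_ofReal_iff (by positivity)] at h2
    simp only [ENNReal.toReal_ofNat, Real.rpow_ofNat, Real.norm_eq_abs, sq_abs] at h2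
    rw [← one_div, ← Real.sqrt_eq_rpow] at h2
    exact (Real.sqrt_le_sqrt_iff (by positivity)).1 h2
  obtain ⟨S, c, hc⟩ := exists_trigPoly_sub_le ⟨fun θ => (g1 θ : ℂ), by fun_prop⟩ hη0
  simp only [ContinuousMap.coe_mk] at hc
  refine ⟨S, fun q => (c q).re, ?_⟩
  set p : Torus → ℂ := fun θ => ∑ q ∈ S, ((c q).re : ℂ) * torusChar q θ with hp
  set g : Torus → ℝ := fun θ => (g1 θ + g1 (-θ)) / 2 with hg
  have hpg : ∀ θ, ‖p θ - g θ‖ ≤ η := fun θ => by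
    have e : p θ - g θ = 2⁻¹ * ((∑ q ∈ S, c q * torusChar q θ - g1 θ) +
        starRingEnd ℂ (∑ q ∈ S, c q * torusChar q (-θ) - g1 (-θ))) := by
      simp only [map_sub, map_sum, map_mul, torusChar_neg, conj_torusChar, neg_neg,
        Complex.conj_ofReal, hg, hp]
      have : ∀ q ∈ S, ((c q).re : ℂ) * torusChar q θ = 2⁻¹ * (c q * torusChar q θ +
          starRingEnd ℂ (c q) * torusChar q θ) := fun q _ => by
        rw [← add_mul, Complex.add_conj]
        push_cast
        ring
      rw [Finset.sum_congr rfl this, ← Finset.mul_sum, Finset.sum_add_distrib]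
      push_cast
      ring
    rw [e, norm_mul]
    have h1 := norm_add_le (∑ q ∈ S, c q * torusChar q θ - g1 θ)
      (starRingEnd ℂ (∑ q ∈ S, c q * torusChar q (-θ) - g1 (-θ)))
    rw [RCLike.norm_conj] at h1
    have h2 : ‖(2⁻¹ : ℂ)‖ = 2⁻¹ := by norm_num
    rw [h2]
    linarith [hc θ, hc (-θ)]
  have hgδ : ∀ θ, δ ≤ g θ := fun θ => by
    have h1 : δ ≤ g1 θ := le_max_right _ _
    have h2 : δ ≤ g1 (-θ) := le_max_right _ _
    simp only [hg]
    linarith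
  refine ⟨fun θ => ?_, ?_⟩
  · have h1 := norm_sub_norm_le (g θ : ℂ) (p θ)
    rw [norm_sub_rev, Complex.norm_real, Real.norm_of_nonneg (hδ.le.trans (hgδ θ))] at h1
    linarith [hpg θ, hgδ θ, min_le_left (δ / 2) √(ε / 4)]
  · have hgm : Integrable (fun θ => (h θ - g0 θ) ^ 2) torusMeasure := hg1m.integrable_sq
    have hgm' : Integrable (fun θ => (h (-θ) - g0 (-θ)) ^ 2) torusMeasure := hgm.comp_neg
    have hb : ∀ᵐ θ ∂torusMeasure, ‖(h θ : ℂ) - p θ‖ ^ 2 ≤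
        (h θ - g0 θ) ^ 2 + (h (-θ) - g0 (-θ)) ^ 2 + 2 * η ^ 2 := by
      filter_upwards [hpos, measurePreserving_torusNeg.quasiMeasurePreserving.ae hpos] with θ h1 h1'
      have key : ∀ x y : ℝ, δ ≤ x → (x - max y δ) ^ 2 ≤ (x - y) ^ 2 := fun x y hx => by
        rcases le_total y δ with hy | hy
        · rw [max_eq_right hy]; nlinarith
        · rw [max_eq_left hy]
      have h2 : ‖(h θ : ℂ) - p θ‖ ≤ |h θ - g θ| + η := by
        calc ‖(h θ : ℂ) - p θ‖ = ‖((h θ - g θ : ℝ) : ℂ) - (p θ - g θ)‖ := by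
              congr 1; push_cast; ring
          _ ≤ ‖((h θ - g θ : ℝ) : ℂ)‖ + ‖p θ - g θ‖ := norm_sub_le _ _
          _ ≤ _ := by
            rw [Complex.norm_real, Real.norm_eq_abs]
            linarith [hpg θ]
      have h3 : ‖(h θ : ℂ) - p θ‖ ^ 2 ≤ 2 * (h θ - g θ) ^ 2 + 2 * η ^ 2 := by
        have := pow_le_pow_left₀ (norm_nonneg _) h2 2
        nlinarith [sq_abs (h θ - g θ), sq_nonneg (|h θ - g θ| - η)]
      have h4 := key _ (g0 θ) h1
      have h5 := key _ (g0 (-θ)) h1'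
      have h6 : h θ - g θ = ((h θ - max (g0 θ) δ) + (h (-θ) - max (g0 (-θ)) δ)) / 2 := by
        rw [heven]
        simp only [hg, g1]
        ring
      rw [h6] at h3
      nlinarith [sq_nonneg ((h θ - max (g0 θ) δ) - (h (-θ) - max (g0 (-θ)) δ))]
    have hgg : Integrable (fun θ => (h θ - g0 θ) ^ 2 + (h (-θ) - g0 (-θ)) ^ 2) torusMeasure :=
      hgm.add hgm'
    have hle := integral_mono_of_nonneg (ae_of_all _ fun θ => by positivity)
      (hgg.add (integrable_const (2 * η ^ 2))) hb
    have hI : ∫ θ, (h (-θ) - g0 (-θ)) ^ 2 ∂torusMeasure = ∫ θ, (h θ - g0 θ) ^ 2 ∂torusMeasure :=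
      integral_neg_eq_self (fun θ => (h θ - g0 θ) ^ 2) torusMeasure
    have hs : ∫ θ, ((h θ - g0 θ) ^ 2 + (h (-θ) - g0 (-θ)) ^ 2 + 2 * η ^ 2) ∂torusMeasure =
        2 * ∫ θ, (h θ - g0 θ) ^ 2 ∂torusMeasure + 2 * η ^ 2 := by
      rw [integral_add hgg (integrable_const _), integral_add hgm hgm', hI]
      simp
      ring
    refine hle.trans ?_
    simp only [Pi.add_apply]
    rw [hs]
    linarith

lemma exists_trigPoly_approx {h : Torus → ℝ} (hh : MemLp h 2 torusMeasure)
    (heven : ∀ θ, h (-θ) = h θ) {δ : ℝ} (hδ : 0 < δ) (hpos : ∀ᵐ θ ∂torusMeasure, δ ≤ h θ)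
    {ε : ℝ} (hε : 0 < ε) :
    ∃ (S : Finset (ℤ × ℤ)) (p : S → ℝ) (s t : S → ℕ) (r : ℕ),
      (∀ θ, δ / 2 ≤ ‖trigPoly p s t θ‖) ∧
      ∫ θ, ‖torusChar (r, r) θ * h θ - trigPoly p s t θ‖ ^ 2 ∂torusMeasure ≤ ε := by
  obtain ⟨S, c, h1, h2⟩ := exists_real_trigPoly_sub_le hh heven hδ hpos hε
  let r : ℕ := ∑ q ∈ S, (q.1.natAbs + q.2.natAbs)
  have hr : ∀ q ∈ S, q.1.natAbs + q.2.natAbs ≤ r := fun q hq =>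
    Finset.single_le_sum (f := fun q : ℤ × ℤ => q.1.natAbs +
        q.2.natAbs) (fun _ _ => Nat.zero_le _) hq
  have e : ∀ θ, trigPoly (fun q : S => c q) (fun q => (r + q.1.1).toNat) (fun q => (r +
      q.1.2).toNat) θ =
      torusChar (r, r) θ * ∑ q ∈ S, (c q : ℂ) * torusChar q θ := fun θ => by
    rw [trigPoly, Finset.mul_sum, ← Finset.sum_coe_sort S]
    refine Finset.sum_congr rfl fun q _ => ?_
    have hq := hr q q.2
    rw [mul_left_comm, ← torusChar_add]
    congr 2
    ext <;> simp <;> omega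
  refine ⟨S, fun q => c q, fun q => (r + q.1.1).toNat, fun q => (r + q.1.2).toNat, r,
      fun θ => ?_, ?_⟩
  · rw [e, norm_mul, norm_torusChar, one_mul]
    exact h1 θ
  · simp_rw [e, ← mul_sub, norm_mul, norm_torusChar, one_mul]
    exact h2

end TrigApprox

section CirculantFamily

open ProbabilityTheory
open scoped Matrix

/-- Linear images of independent standard Gaussian variables form a Gaussian family. -/
lemma isGaussianFamily_linear {T Q ι : Type*} [MeasurableSpace T] [Fintype Q] [Fintype ι]
    [DecidableEq Q] {μ : Measure T} {e : Q → T → ℂ} (he : ∀ q, MemLp (e q) 2 μ)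
    (horth : ∀ q q', ∫ x, starRingEnd ℂ (e q x) * e q' x ∂μ = if q = q' then 1 else 0)
    (M : Q → ι → ℝ) :
    IsGaussianFamily (gaussianPi Q) (fun i ξ => ∑ q, ξ q * M q i) μ
      (fun i x => ∑ q, (M q i : ℂ) * e q x) := by
  intro c
  set d : Q → ℝ := fun q => ∑ i, c i * M q i with hd
  have h1 : ∀ ξ : Q → ℝ, ∑ i, c i * ∑ q, ξ q * M q i = ∑ q, ξ q * d q := fun ξ => by
    simp only [hd, Finset.mul_sum]
    rw [Finset.sum_comm]
    exact Finset.sum_congr rfl fun q _ => Finset.sum_congr rfl fun i _ => by ring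
  have h2 : ∀ x, ∑ i, (c i : ℂ) * ∑ q, (M q i : ℂ) * e q x = ∑ q, (d q : ℂ) * e q x := fun x => by
    simp only [hd, Finset.mul_sum]
    rw [Finset.sum_comm]
    refine Finset.sum_congr rfl fun q _ => ?_
    push_cast
    rw [Finset.sum_mul]
    exact Finset.sum_congr rfl fun i _ => by ring
  simp_rw [h1, h2]
  have h3 : gram μ e = 1 := by
    ext q q'
    have := horth q q'
    rw [gram, Matrix.of_apply, Matrix.one_apply]
    have hre := integral_re (integrable_conj_mul (he q) (he q'))
    simp only [RCLike.re_eq_complex_re] at hre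
    rw [hre, this]
    split_ifs <;> simp
  rw [integral_norm_sq_sum he, h3, Matrix.one_mulVec]
  have hm : Measurable fun ξ : Q → ℝ => ∑ q, ξ q * d q := by fun_prop
  have := Measure.isProbabilityMeasure_map (μ := gaussianPi Q) hm.aemeasurable
  refine Measure.ext_of_charFun (funext fun u => ?_)
  have hnn : 0 ≤ d ⬝ᵥ d := Finset.sum_nonneg fun q _ => mul_self_nonneg _
  rw [charFun_gaussianReal, Real.coe_toNNReal _ hnn, charFun_apply,
    integral_map hm.aemeasurable (by fun_prop)]
  have h4 : ∀ ξ : Q → ℝ, Complex.exp (((inner ℝ (∑ q, ξ q * d q) u : ℝ) : ℂ) * Complex.I) =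
      ∏ q, Complex.exp ((((inner ℝ (ξ q) (u * d q)) : ℝ) : ℂ) * Complex.I) := fun ξ => by
    rw [← Complex.exp_sum]
    congr 1
    simp only [RCLike.inner_apply, conj_trivial]
    push_cast
    rw [Finset.mul_sum, Finset.sum_mul]
    exact Finset.sum_congr rfl fun q _ => by ring
  simp_rw [h4, gaussianPi]
  rw [integral_fintype_prod_eq_prod
    (fun q (x : ℝ) => Complex.exp (((inner ℝ x (u * d q) : ℝ) : ℂ) * Complex.I))]
  simp_rw [← charFun_apply, charFun_gaussianReal]
  rw [← Complex.exp_sum]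
  congr 1
  simp only [dotProduct]
  push_cast
  rw [mul_zero, zero_mul, zero_sub, Finset.sum_mul, Finset.sum_div, ← Finset.sum_neg_distrib]
  exact Finset.sum_congr rfl fun q _ => by ring

lemma memLp_of_continuous {u : Torus → ℂ} (hu : Continuous u) : MemLp u 2 torusMeasure :=
  hu.memLp_of_hasCompactSupport (HasCompactSupport.of_compactSpace u)

/-- The nonnegative representatives of a pair of residue classes. -/
def valPair {n : ℕ} (q : ZMod (n + 1) × ZMod (n + 1)) : ℤ × ℤ := (q.1.val, q.2.val)

lemma valPair_injective (n : ℕ) : Function.Injective (valPair (n := n)) := fun q q' h => by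
  simp only [valPair, Prod.mk.injEq, Nat.cast_inj] at h
  exact Prod.ext (ZMod.val_injective _ h.1) (ZMod.val_injective _ h.2)

lemma integral_conj_torusChar_mul (n : ℕ) (q q' : ZMod (n + 1) × ZMod (n + 1)) :
    ∫ θ, starRingEnd ℂ (torusChar (valPair q) θ) * torusChar (valPair q') θ ∂torusMeasure =
      if q = q' then 1 else 0 := by
  simp_rw [conj_torusChar, ← torusChar_add, integral_torusChar, neg_add_eq_zero,
    (valPair_injective n).eq_iff]

variable {J : Type*} [Fintype J] (p : J → ℝ) (s t : J → ℕ)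

/-- The vectors of the Gaussian family formed by the entries of the circulant ensemble. -/
noncomputable def circVec (n : ℕ) (k : ZMod (n + 1) × ZMod (n + 1)) (θ : Torus) : ℂ :=
  ∑ q, (circMat p (cyclicShift n s) (cyclicShift n t) q k.1 k.2 : ℂ) * torusChar (valPair q) θ

@[fun_prop] lemma continuous_circVec (n : ℕ) (k : ZMod (n + 1) × ZMod (n + 1)) :
    Continuous (circVec p s t n k) := by
  unfold circVec
  fun_prop

lemma isGaussianFamily_circVec (n : ℕ) :
    IsGaussianFamily (gaussianPi (ZMod (n + 1) × ZMod (n + 1)))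
      (fun k ξ => linComb (circMat p (cyclicShift n s) (cyclicShift n t)) ξ k.1 k.2) torusMeasure
      (circVec p s t n) := by
  simp_rw [linComb_apply]
  exact isGaussianFamily_linear (fun q => memLp_of_continuous (by fun_prop))
    (integral_conj_torusChar_mul n)
    fun q (k : ZMod (n + 1) × ZMod (n + 1)) => circMat p (cyclicShift n s) (cyclicShift n t) q k.1 k.2

/-- The symmetrized exponential monomials. -/
noncomputable def symChar (q : ℤ × ℤ) (θ : Torus) : ℂ := torusChar q θ + torusChar q.swap θ

@[fun_prop] lemma continuous_symChar (q : ℤ × ℤ) : Continuous (symChar q) := by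
  unfold symChar
  fun_prop

lemma norm_symChar_le (q : ℤ × ℤ) (θ : Torus) : ‖symChar q θ‖ ≤ 2 := by
  refine (norm_add_le _ _).trans ?_
  rw [norm_torusChar, norm_torusChar]
  norm_num

lemma circVec_eq (n : ℕ) (k : ZMod (n + 1) × ZMod (n + 1)) (θ : Torus) :
    circVec p s t n k θ = ∑ j, (p j : ℂ) *
      (torusChar (valPair (k.1 + cyclicShift n s j, k.2 + cyclicShift n t j)) θ +
        torusChar (valPair (k.2 + cyclicShift n s j, k.1 + cyclicShift n t j)) θ) := by
  have h : ∀ q, (circMat p (cyclicShift n s) (cyclicShift n t) q k.1 k.2 : ℂ) *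
      torusChar (valPair q) θ = ∑ j, (p j : ℂ) *
        ((if q = (k.1 + cyclicShift n s j, k.2 + cyclicShift n t j) then torusChar (valPair q) θ else 0) +
        (if q = (k.2 + cyclicShift n s j, k.1 + cyclicShift n t j) then torusChar (valPair q) θ else 0)) :=
    fun q => by
      rw [circMat, Matrix.sum_apply]
      push_cast
      rw [Finset.sum_mul]
      refine Finset.sum_congr rfl fun j _ => ?_
      simp only [Matrix.smul_apply, Matrix.add_apply, Matrix.single_apply, smul_eq_mul,
          Prod.ext_iff,
        sub_eq_iff_eq_add]
      simp only [and_comm (a := q.2 = _)]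
      split_ifs <;> push_cast <;> ring
  simp_rw [circVec, h]
  rw [Finset.sum_comm]
  refine Finset.sum_congr rfl fun j _ => ?_
  rw [← Finset.mul_sum, Finset.sum_add_distrib, Finset.sum_ite_eq', Finset.sum_ite_eq']
  simp

lemma trigPoly_mul_symChar (q : ℤ × ℤ) (θ : Torus) :
    trigPoly p s t θ * symChar q θ = ∑ j, (p j : ℂ) *
      (torusChar (q.1 + s j, q.2 + t j) θ + torusChar (q.2 + s j, q.1 + t j) θ) := by
  rw [trigPoly, Finset.sum_mul]
  refine Finset.sum_congr rfl fun j _ => ?_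
  rw [symChar, mul_assoc, mul_add, ← torusChar_add, ← torusChar_add, Prod.mk_add_mk,
      add_comm (s j : ℤ),
    add_comm (t j : ℤ)]
  congr 3
  ext <;> simp [add_comm]

lemma norm_circVec_sub_le (n : ℕ) (k : ZMod (n + 1) × ZMod (n + 1)) (θ : Torus) :
    ‖trigPoly p s t θ * symChar (valPair k) θ - circVec p s t n k θ‖ ≤ 4 * ∑ j, |p j| := by
  rw [trigPoly_mul_symChar, circVec_eq, ← Finset.sum_sub_distrib, Finset.mul_sum]
  refine (norm_sum_le _ _).trans (Finset.sum_le_sum fun j _ => ?_)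
  rw [← mul_sub, norm_mul, Complex.norm_real, Real.norm_eq_abs, mul_comm]
  gcongr
  refine (norm_sub_le _ _).trans ((add_le_add (norm_add_le _ _) (norm_add_le _ _)).trans ?_)
  simp only [norm_torusChar]
  norm_num

lemma circVec_eq_trigPoly_mul {n : ℕ} {k : ZMod (n + 1) × ZMod (n + 1)} {r : ℕ}
    (hr : ∀ j, s j ≤ r ∧ t j ≤ r) (h1 : k.1.val + r ≤ n) (h2 : k.2.val + r ≤ n) (θ : Torus) :
    circVec p s t n k θ = trigPoly p s t θ * symChar (valPair k) θ := by
  rw [trigPoly_mul_symChar, circVec_eq]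
  have key : ∀ (x : ZMod (n + 1)) (m : ℕ), x.val + r ≤ n → m ≤ r →
      (x + (m : ZMod (n + 1))).val = x.val + m := fun x m hx hm => by
    have : (m : ZMod (n + 1)).val = m := ZMod.val_natCast_of_lt (by omega)
    rw [ZMod.val_add_of_lt (by omega), this]
  refine Finset.sum_congr rfl fun j _ => ?_
  simp only [valPair, cyclicShift, key _ _ h1 (hr j).1, key _ _ h1 (hr j).2, key _ _ h2 (hr j).1,
    key _ _ h2 (hr j).2, Nat.cast_add]

lemma card_filter_lt_val_add_le (n r : ℕ) :
    (Finset.univ.filter fun x : ZMod (n + 1) => n < x.val + r).card ≤ r := by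
  have h := Finset.card_le_card_of_injOn (s := Finset.univ.filter fun x : ZMod (n +
      1) => n < x.val + r)
    (t := Finset.range r) (fun x => n - x.val) (fun x hx => by
      simp only [Finset.coe_filter, Finset.mem_univ, true_and, Set.mem_ofPred_eq] at hx
      simp only [Finset.coe_range, Set.mem_Iio]
      have := x.val_lt
      omega) (fun x _ y _ hxy => by
      have h1 := x.val_lt
      have h2 := y.val_lt
      refine ZMod.val_injective _ ?_
      simp only at hxy
      omega)
  simpa using h

/-- The boundary effects in the comparison with the circulant ensemble are negligible. -/
lemma exists_sum_integral_circVec_le : ∃ K : ℝ, 0 ≤ K ∧ ∀ n : ℕ,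
    ∑ k, ∫ θ, ‖trigPoly p s t θ * symChar (valPair k) θ - circVec p s t n k θ‖ ^ 2 ∂torusMeasure ≤
      K * (n + 1) := by
  set r : ℕ := ∑ j, (s j + t j) with hr
  have hr' : ∀ j, s j ≤ r ∧ t j ≤ r := fun j => by
    have := Finset.single_le_sum (f := fun j => s j +
        t j) (fun _ _ => Nat.zero_le _) (Finset.mem_univ j)
    simp only [← hr] at this
    omega
  set D : ℝ := (4 * ∑ j, |p j|) ^ 2 with hD
  refine ⟨2 * r * D, by positivity, fun n => ?_⟩
  set bad : ZMod (n + 1) → ℝ := fun x => if n < x.val + r then 1 else 0 with hbad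
  have hs : ∑ x, bad x ≤ r := by
    simp only [hbad]
    rw [Finset.sum_boole]
    exact_mod_cast card_filter_lt_val_add_le n r
  have h1 : ∀ k : ZMod (n + 1) × ZMod (n + 1),
      ∫ θ, ‖trigPoly p s t θ * symChar (valPair k) θ - circVec p s t n k θ‖ ^ 2 ∂torusMeasure ≤
        (bad k.1 + bad k.2) * D := fun k => by
    have hb0 : ∀ x, 0 ≤ bad x := fun x => by simp only [hbad]; split_ifs <;> norm_num
    have h2 : ∀ θ, ‖trigPoly p s t θ * symChar (valPair k) θ - circVec p s t n k θ‖ ^ 2 ≤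
        (bad k.1 + bad k.2) * D := fun θ => by
      by_cases hk : k.1.val + r ≤ n ∧ k.2.val + r ≤ n
      · rw [circVec_eq_trigPoly_mul p s t hr' hk.1 hk.2, sub_self, norm_zero, zero_pow two_ne_zero]
        exact mul_nonneg (add_nonneg (hb0 _) (hb0 _)) (sq_nonneg _)
      · have h3 : 1 ≤ bad k.1 + bad k.2 := by
          rw [not_and_or, not_le, not_le] at hk
          rcases hk with hk | hk
          · have : bad k.1 = 1 := if_pos hk
            linarith [hb0 k.2]
          · have : bad k.2 = 1 := if_pos hk
            linarith [hb0 k.1]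
        refine (pow_le_pow_left₀ (norm_nonneg _) (norm_circVec_sub_le p s t n k θ) 2).trans ?_
        exact le_mul_of_one_le_left (by positivity) h3
    refine (integral_mono_of_nonneg (ae_of_all _ fun θ => sq_nonneg _) (integrable_const _)
      (ae_of_all _ h2)).trans ?_
    simp
  refine (Finset.sum_le_sum fun k _ => h1 k).trans ?_
  rw [← Finset.sum_mul, Fintype.sum_prod_type]
  simp only [Finset.sum_add_distrib, Finset.sum_const, Finset.card_univ, ZMod.card, nsmul_eq_mul]
  rw [← Finset.mul_sum]
  push_cast
  have hD0 : 0 ≤ D := by positivity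
  have : (n + 1 : ℝ) * ∑ x, bad x + (n + 1) * ∑ x, bad x ≤ 2 * r * (n + 1) := by nlinarith
  nlinarith

/-- The vectors of a moving average are close to those of the circulant ensemble. -/
lemma sum_integral_sub_circVec_le {w : Torus → ℂ} (hw : MemLp w 2 torusMeasure) {ε K : ℝ}
    (hε : ∫ θ, ‖w θ - trigPoly p s t θ‖ ^ 2 ∂torusMeasure ≤ ε) {n : ℕ}
    (hK : ∑ k, ∫ θ, ‖trigPoly p s t θ * symChar (valPair k) θ - circVec p s t n k θ‖ ^ 2
      ∂torusMeasure ≤ K * (n + 1)) :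
    ∑ k, ∫ θ, ‖w θ * symChar (valPair k) θ - circVec p s t n k θ‖ ^ 2 ∂torusMeasure ≤
      8 * ε * (n + 1) ^ 2 + 2 * K * (n + 1) := by
  have hi : Integrable (fun θ => ‖w θ - trigPoly p s t θ‖ ^ 2) torusMeasure :=
    (memLp_two_iff_integrable_sq_norm (hw.1.sub (by fun_prop))).1
      (hw.sub (memLp_of_continuous (by fun_prop)))
  have h1 : ∀ k : ZMod (n + 1) × ZMod (n + 1),
      ∫ θ, ‖w θ * symChar (valPair k) θ - circVec p s t n k θ‖ ^ 2 ∂torusMeasure ≤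
      8 * ε + 2 * ∫ θ, ‖trigPoly p s t θ * symChar (valPair k) θ - circVec p s t n k θ‖ ^ 2
        ∂torusMeasure := fun k => by
    have hi2 : Integrable (fun θ => ‖trigPoly p s t θ * symChar (valPair k) θ -
        circVec p s t n k θ‖ ^ 2) torusMeasure :=
      (memLp_two_iff_integrable_sq_norm (by fun_prop)).1 (memLp_of_continuous (by fun_prop))
    have h2 : ∀ θ, ‖w θ * symChar (valPair k) θ - circVec p s t n k θ‖ ^ 2 ≤
        8 * ‖w θ - trigPoly p s t θ‖ ^ 2 +
          2 * ‖trigPoly p s t θ * symChar (valPair k) θ - circVec p s t n k θ‖ ^ 2 := fun θ => by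
      have e : w θ * symChar (valPair k) θ - circVec p s t n k θ =
          (w θ - trigPoly p s t θ) * symChar (valPair k) θ +
          (trigPoly p s t θ * symChar (valPair k) θ - circVec p s t n k θ) := by ring
      rw [e]
      set x := (w θ - trigPoly p s t θ) * symChar (valPair k) θ with hx
      set y := trigPoly p s t θ * symChar (valPair k) θ - circVec p s t n k θ
      have hx2 : ‖x‖ ^ 2 ≤ 4 * ‖w θ - trigPoly p s t θ‖ ^ 2 := by
        rw [hx, norm_mul, mul_pow]
        have := pow_le_pow_left₀ (norm_nonneg _) (norm_symChar_le (valPair k) θ) 2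
        nlinarith [sq_nonneg ‖w θ - trigPoly p s t θ‖]
      have h3 := pow_le_pow_left₀ (norm_nonneg _) (norm_add_le x y) 2
      nlinarith [sq_nonneg (‖x‖ - ‖y‖)]
    refine (integral_mono_of_nonneg (ae_of_all _ fun θ => sq_nonneg _)
      ((hi.const_mul 8).add (hi2.const_mul 2)) (ae_of_all _ h2)).trans ?_
    simp only [Pi.add_apply]
    rw [integral_add (hi.const_mul 8) (hi2.const_mul 2), integral_const_mul, integral_const_mul]
    linarith
  refine (Finset.sum_le_sum fun k _ => h1 k).trans ?_
  rw [Finset.sum_add_distrib, ← Finset.mul_sum (f := fun k => ∫ θ, ‖trigPoly p s t θ *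
    symChar (valPair k) θ - circVec p s t n k θ‖ ^ 2 ∂torusMeasure)]
  simp only [Finset.sum_const, Finset.card_univ, Fintype.card_prod, ZMod.card, nsmul_eq_mul]
  push_cast
  linarith

end CirculantFamily

section Comparison

open Topology

variable {Z : Type*} [Fintype Z]

/-- The normalized symmetric matrix with the given entries. -/
noncomputable def symMat (x : Z × Z → ℝ) : Matrix Z Z ℝ :=
  Matrix.of fun a b => (√(Fintype.card Z))⁻¹ * ((x (a, b) + x (b, a)) / 2)

lemma isHermitian_symMat (x : Z × Z → ℝ) : (symMat x).IsHermitian := by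
  ext a b
  simp [symMat, add_comm]

lemma sum_sq_symMat_sub_le (x y : Z × Z → ℝ) :
    ∑ a, ∑ b, (symMat x a b - symMat y a b) ^ 2 ≤ (Fintype.card Z : ℝ)⁻¹ * ∑ k,
        (x k - y k) ^ 2 := by
  have h1 : ∀ a b, (symMat x a b - symMat y a b) ^ 2 ≤ (Fintype.card Z : ℝ)⁻¹ *
      ((x (a, b) - y (a, b)) ^ 2 / 2 + (x (b, a) - y (b, a)) ^ 2 / 2) := fun a b => by
    have e : (symMat x a b - symMat y a b) ^ 2 = (Fintype.card Z : ℝ)⁻¹ *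
        (((x (a, b) - y (a, b)) + (x (b, a) - y (b, a))) / 2) ^ 2 := by
      have : ((√(Fintype.card Z))⁻¹) ^ 2 = (Fintype.card Z : ℝ)⁻¹ := by
        rw [inv_pow, Real.sq_sqrt (Nat.cast_nonneg _)]
      rw [← this]
      simp only [symMat, Matrix.of_apply]
      ring
    rw [e]
    gcongr
    nlinarith [sq_nonneg ((x (a, b) - y (a, b)) - (x (b, a) - y (b, a)))]
  refine (Finset.sum_le_sum fun a _ => Finset.sum_le_sum fun b _ => h1 a b).trans (le_of_eq ?_)
  simp_rw [← Finset.mul_sum, Finset.sum_add_distrib]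
  rw [Finset.sum_comm (f := fun a b => (x (b, a) - y (b, a)) ^ 2 / 2), Fintype.sum_prod_type,
    ← Finset.sum_add_distrib]
  congr 1
  refine Finset.sum_congr rfl fun a _ => ?_
  rw [← Finset.sum_add_distrib]
  exact Finset.sum_congr rfl fun b _ => by ring

variable [DecidableEq Z]

/-- The deviation of the Stieltjes transform from a constant. -/
noncomputable def traceDev (z M : ℂ) (x : Z × Z → ℝ) : ℝ :=
  ‖(Fintype.card Z : ℂ)⁻¹ * (matResolvent (symMat x) z).trace - M‖

lemma measurable_traceDev (z M : ℂ) : Measurable (traceDev (Z := Z) z M) := by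
  have h : Measurable fun x : Z × Z → ℝ => (matResolvent (symMat x) z).trace := by
    refine measurable_trace_matResolvent (fun i j => ?_) measurable_const
    simp only [symMat, Matrix.of_apply]
    fun_prop
  exact ((h.const_mul _).sub_const _).norm

lemma traceDev_le {z : ℂ} (hz : 0 < z.im) (M : ℂ) (x : Z × Z → ℝ) :
    |traceDev z M x| ≤ z.im⁻¹ + ‖M‖ := by
  rw [traceDev, abs_norm]
  refine (norm_sub_le _ _).trans (add_le_add_left ?_ _)
  rw [norm_mul, norm_inv, Complex.norm_natCast]
  have h := norm_trace_matResolvent_le (isHermitian_symMat x) hz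
  rcases Nat.eq_zero_or_pos (Fintype.card Z) with h0 | h0
  · rw [h0]
    simp [hz.le]
  · have : (0 : ℝ) < Fintype.card Z := by exact_mod_cast h0
    rwa [inv_mul_le_iff₀ this]

lemma abs_traceDev_sub_le [Nonempty Z] {z : ℂ} (hz : 0 < z.im) (M : ℂ) (x y : Z × Z → ℝ) :
    |traceDev z M x - traceDev z M y| ≤
      (Fintype.card Z : ℝ)⁻¹ * z.im⁻¹ ^ 2 * √(∑ k, (x k - y k) ^ 2) := by
  have hN : (0 : ℝ) < Fintype.card Z := by exact_mod_cast Fintype.card_pos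
  refine (abs_norm_sub_norm_le _ _).trans ?_
  rw [sub_sub_sub_cancel_right, ← mul_sub, norm_mul, norm_inv, Complex.norm_natCast, mul_assoc]
  refine mul_le_mul_of_nonneg_left ?_ (by positivity)
  refine (norm_trace_matResolvent_sub_le (isHermitian_symMat y) (isHermitian_symMat x) hz).trans ?_
  calc _ ≤ √((Fintype.card Z : ℝ)⁻¹ * ∑ k, (x k - y k) ^ 2) * (√(Fintype.card Z) * z.im⁻¹ ^ 2) := by
        gcongr
        exact sum_sq_symMat_sub_le x y
    _ = _ := by
        rw [Real.sqrt_mul (by positivity), Real.sqrt_inv]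
        field_simp

omit [DecidableEq Z] in
lemma symMat_eq {x : Z × Z → ℝ} (hx : ∀ k, x k.swap = x k) :
    symMat x = (√(Fintype.card Z))⁻¹ • Matrix.of fun a b => x (a, b) := by
  ext a b
  have : x (b, a) = x (a, b) := hx (a, b)
  simp [symMat, this]

lemma linComb_circEnsemble [AddCommGroup Z] {J : Type*} [Fintype J] (p : J → ℝ) (s t : J → Z)
    (ξ : Z × Z → ℝ) : linComb (circEnsemble p s t) ξ =
      symMat fun k => linComb (circMat p s t) ξ k.1 k.2 := by
  rw [symMat_eq fun k => by simpa using (isHermitian_linComb (isHermitian_circMat p s t) ξ).apply k.1 k.2]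
  ext a b
  simp only [linComb_apply, circEnsemble, Matrix.smul_apply, smul_eq_mul, Matrix.of_apply,
    Finset.mul_sum]
  exact Finset.sum_congr rfl fun q _ => by ring

lemma trigSum_eq_trigPoly {J : Type*} [Fintype J] (p : J → ℝ) (s t : J → ℕ) (x y : ℝ) :
    trigSum p s t x y = trigPoly p s t ![(x : UnitAddCircle), (y : UnitAddCircle)] := by
  simp [trigSum, trigPoly, torusChar_coe]

variable {Ω : Type*} [MeasurableSpace Ω] {P : Measure Ω} [IsProbabilityMeasure P]

/-- The approximate convergence of the Stieltjes transform for an even spectral amplitude. -/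
lemma exists_eventually_integral_traceDev_le {h : Torus → ℝ} (hh : MemLp h 2 torusMeasure)
    (heven : ∀ θ, h (-θ) = h θ) {δ : ℝ} (hδ : 0 < δ) (hpos : ∀ᵐ θ ∂torusMeasure, δ ≤ h θ)
    {W : ∀ n : ℕ, ZMod (n + 1) × ZMod (n + 1) → Ω → ℝ} (hWm : ∀ n k, Measurable (W n k))
    (hW : ∀ n, IsGaussianFamily P (W n) torusMeasure fun k θ => h θ * symChar (valPair k) θ)
    {z : ℂ} (hz : 0 < z.im) {ε : ℝ} (hε : 0 < ε) :
    ∃ M : ℂ, ‖M‖ ≤ √(δ ^ 2 / 2)⁻¹ ∧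
      ∀ᶠ n in atTop, ∫ ω, traceDev z M (fun k => W n k ω) ∂P ≤ ε := by
  set ε' : ℝ := (ε * z.im ^ 2) ^ 2 / 128 with hε'
  obtain ⟨S, p, s, t, r, hp, hpε⟩ := exists_trigPoly_approx hh heven hδ hpos (ε := ε') (by positivity)
  have hker : ∀ x y, δ ^ 2 / 2 ≤ trigKernel p s t x y := fun x y => by
    rw [trigKernel, trigSum_eq_trigPoly, trigSum_eq_trigPoly]
    have h1 := pow_le_pow_left₀ (by positivity) (hp ![(x : UnitAddCircle),
        ((-y : ℝ) : UnitAddCircle)]) 2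
    have h2 := pow_le_pow_left₀ (by positivity) (hp ![((-y : ℝ) : UnitAddCircle),
        (x : UnitAddCircle)]) 2
    linarith
  obtain ⟨M, hM, hlim⟩ := exists_tendsto_trace_circResolvent (by positivity : 0 < δ ^ 2 / 2) hker hz
  obtain ⟨K, hK0, hK⟩ := exists_sum_integral_circVec_le p s t
  refine ⟨M, hM, ?_⟩
  set w : Torus → ℂ := fun θ => torusChar (r, r) θ * h θ with hw
  have hwm : MemLp w 2 torusMeasure := by
    refine MemLp.of_le (g := h) hh ((by fun_prop : Continuous (torusChar (r,
        r))).aestronglyMeasurable.mul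
      (Complex.continuous_ofReal.comp_aestronglyMeasurable hh.1)) (ae_of_all _ fun θ => ?_)
    simp [hw]
  have hW' : ∀ n, IsGaussianFamily P (W n) torusMeasure fun k θ => w θ * symChar (valPair k) θ :=
    fun n c => by
      rw [hW n c]
      congr 2
      refine integral_congr_ae (ae_of_all _ fun θ => ?_)
      simp only [hw]
      have : ∑ k, (c k : ℂ) * (torusChar (r, r) θ * h θ * symChar (valPair k) θ) =
          torusChar (r, r) θ * ∑ k, (c k : ℂ) * (h θ * symChar (valPair k) θ) := by
        rw [Finset.mul_sum]
        exact Finset.sum_congr rfl fun k _ => by ring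
      rw [this, norm_mul, norm_torusChar, one_mul]
  have hvm : ∀ (n : ℕ) (k : ZMod (n + 1) × ZMod (n + 1)),
      MemLp (fun θ => w θ * symChar (valPair k) θ) 2 torusMeasure := fun n k => by
    refine MemLp.of_le (g := fun θ => 2 * w θ) (hwm.const_mul 2) (hwm.1.mul
      (continuous_symChar _).aestronglyMeasurable) (ae_of_all _ fun θ => ?_)
    have := norm_symChar_le (valPair k) θ
    have h2 : ‖(2 : ℂ)‖ = 2 := by norm_num
    rw [norm_mul, norm_mul 2, h2, mul_comm]
    gcongr
  have key : ∀ n : ℕ, ∫ ω, traceDev z M (fun k => W n k ω) ∂P ≤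
      (∫ ξ, ‖((n + 1 : ℕ) : ℂ)⁻¹ * (circResolvent p (cyclicShift n s) (cyclicShift n t) z ξ).trace - M‖
        ∂(gaussianPi (ZMod (n + 1) × ZMod (n + 1)))) +
      z.im⁻¹ ^ 2 * √(8 * ε' + 2 * K * ((n : ℝ) + 1)⁻¹) := fun n => by
    have h1 := (hW' n).abs_integral_sub_le (hWm n) (fun k => by
      simp_rw [linComb_apply]
      fun_prop) (hvm n) (fun k => memLp_of_continuous (by fun_prop)) (isGaussianFamily_circVec p s t n)
      (measurable_traceDev z M) (traceDev_le hz M) (by positivity) (abs_traceDev_sub_le hz M)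
    have h2 := sum_integral_sub_circVec_le p s t hwm hpε (hK n)
    have h3 : ∀ ξ : ZMod (n + 1) × ZMod (n + 1) → ℝ, traceDev z M (fun k =>
        linComb (circMat p (cyclicShift n s) (cyclicShift n t)) ξ k.1 k.2) = ‖((n + 1 : ℕ) : ℂ)⁻¹ *
          (circResolvent p (cyclicShift n s) (cyclicShift n t) z ξ).trace - M‖ := fun ξ => by
      rw [traceDev, circResolvent, linComb_circEnsemble, ZMod.card]
    simp_rw [h3] at h1
    have h4 : ((Fintype.card (ZMod (n + 1)) : ℝ)⁻¹ * z.im⁻¹ ^ 2) *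
        √(∑ k : ZMod (n + 1) × ZMod (n + 1),
        ∫ θ, ‖w θ * symChar (valPair k) θ - circVec p s t n k θ‖ ^ 2 ∂torusMeasure) ≤
        z.im⁻¹ ^ 2 * √(8 * ε' + 2 * K * ((n : ℝ) + 1)⁻¹) := by
      rw [ZMod.card]
      push_cast
      have hn : (0 : ℝ) < n + 1 := by positivity
      have e : 8 * ε' * ((n : ℝ) + 1) ^ 2 + 2 * K * (n + 1) =
          (n + 1) ^ 2 * (8 * ε' + 2 * K * ((n : ℝ) + 1)⁻¹) := by
        field_simp
      rw [e] at h2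
      calc _ ≤ (((n : ℝ) + 1)⁻¹ * z.im⁻¹ ^ 2) *
            √((n + 1) ^ 2 * (8 * ε' + 2 * K * ((n : ℝ) + 1)⁻¹)) := by
            gcongr
        _ = _ := by
            rw [Real.sqrt_mul (by positivity), Real.sqrt_sq hn.le]
            field_simp
    linarith [le_abs_self (∫ ω, traceDev z M (fun k => W n k ω) ∂P -
      ∫ ξ, ‖((n + 1 : ℕ) : ℂ)⁻¹ * (circResolvent p (cyclicShift n s) (cyclicShift n t) z ξ).trace - M‖
        ∂(gaussianPi (ZMod (n + 1) × ZMod (n + 1))))]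
  have hlim2 : Tendsto (fun n : ℕ => z.im⁻¹ ^ 2 * √(8 * ε' + 2 * K * ((n : ℝ) + 1)⁻¹)) atTop
      (𝓝 (ε / 4)) := by
    have h0 : Tendsto (fun n : ℕ => ((n : ℝ) + 1)⁻¹) atTop (𝓝 0) := by
      simpa [one_div] using tendsto_one_div_add_atTop_nhds_zero_nat (𝕜 := ℝ)
    have h1 := ((((h0.const_mul (2 * K)).const_add (8 * ε')).sqrt).const_mul (z.im⁻¹ ^ 2))
    have e : z.im⁻¹ ^ 2 * √(8 * ε' + 2 * K * 0) = ε / 4 := by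
      have : 8 * ε' + 2 * K * 0 = (ε * z.im ^ 2 / 4) ^ 2 := by
        rw [hε']
        ring
      rw [this, Real.sqrt_sq (by positivity)]
      field_simp
    rwa [e] at h1
  filter_upwards [hlim.eventually_le_const (by positivity : 0 < ε / 2),
    hlim2.eventually_le_const (by linarith : ε / 4 < ε / 2)] with n h1 h2
  linarith [key n]

/-- The convergence of the Stieltjes transform for an even spectral amplitude. -/
theorem exists_tendsto_integral_traceDev {h : Torus → ℝ} (hh : MemLp h 2 torusMeasure)
    (heven : ∀ θ, h (-θ) = h θ) {δ : ℝ} (hδ : 0 < δ) (hpos : ∀ᵐ θ ∂torusMeasure, δ ≤ h θ)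
    {W : ∀ n : ℕ, ZMod (n + 1) × ZMod (n + 1) → Ω → ℝ} (hWm : ∀ n k, Measurable (W n k))
    (hW : ∀ n, IsGaussianFamily P (W n) torusMeasure fun k θ => h θ * symChar (valPair k) θ)
    {z : ℂ} (hz : 0 < z.im) :
    ∃ M : ℂ, ‖M‖ ≤ √(δ ^ 2 / 2)⁻¹ ∧
      Tendsto (fun n => ∫ ω, traceDev z M (fun k => W n k ω) ∂P) atTop (𝓝 0) := by
  choose m hmB hm using fun k : ℕ => exists_eventually_integral_traceDev_le hh heven hδ hpos hWm hW hz
    (ε := 1 / ((k : ℝ) + 1)) (by positivity)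
  obtain ⟨M, hM, φ, hφ, hlim⟩ := (isCompact_closedBall (0 : ℂ) (√(δ ^ 2 / 2)⁻¹)).tendsto_subseq
    (x := m) fun k => by simpa using hmB k
  refine ⟨M, by simpa using hM, ?_⟩
  have hi : ∀ n M, Integrable (fun ω => traceDev z M (fun k => W n k ω)) P := fun n M =>
    Integrable.of_bound ((measurable_traceDev z M).comp
      (measurable_pi_lambda _ fun k => hWm n k)).aestronglyMeasurable _
      (ae_of_all _ fun ω => traceDev_le hz M _)
  rw [Metric.tendsto_atTop']
  intro ε hε
  have h1 : Tendsto (fun k : ℕ => 1 / ((φ k : ℝ) + 1) + ‖m (φ k) - M‖) atTop (𝓝 (0 + 0)) :=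
    ((tendsto_one_div_add_atTop_nhds_zero_nat (𝕜 := ℝ)).comp hφ.tendsto_atTop).add
      (tendsto_iff_norm_sub_tendsto_zero.1 hlim)
  rw [add_zero] at h1
  obtain ⟨k, hk⟩ := (h1.eventually_lt_const hε).exists
  obtain ⟨n0, hn0⟩ := eventually_atTop.1 (hm (φ k))
  refine ⟨n0, fun n hn => ?_⟩
  have h2 : ∫ ω, traceDev z M (fun k => W n k ω) ∂P ≤
      ∫ ω, (traceDev z (m (φ k)) (fun k => W n k ω) + ‖m (φ k) - M‖) ∂P := by
    refine integral_mono (hi n M) ((hi n _).add (integrable_const _)) fun ω => ?_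
    simp only [traceDev]
    refine le_trans (le_of_eq ?_) (norm_add_le _ _)
    congr 1
    ring
  rw [integral_add (hi n _) (integrable_const _), integral_const, probReal_univ, one_smul] at h2
  have h3 : 0 ≤ ∫ ω, traceDev z M (fun k => W n k ω) ∂P := integral_nonneg fun ω => norm_nonneg _
  rw [Real.dist_eq, sub_zero, abs_of_nonneg h3]
  linarith [hn0 n hn.le]

end Comparison

section Density

open Topology

/-- The spectral density transported to the torus. -/
noncomputable def torusDensity (f : ℝ → ℝ → ℝ) (θ : Torus) : ℝ :=
  (2 * π) ^ 2 * f (torusLift θ).1 (torusLift θ).2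

/-- The symmetrization of a function under the sign change and the exchange of coordinates. -/
noncomputable def symDensity (F : Torus → ℝ) (θ : Torus) : ℝ :=
  (F θ + F (-θ) + F (torusSwap θ) + F (torusSwap (-θ))) / 4

lemma symDensity_neg (F : Torus → ℝ) (θ : Torus) : symDensity F (-θ) = symDensity F θ := by
  simp only [symDensity, neg_neg]
  ring

lemma symDensity_nonneg {F : Torus → ℝ} (hF : ∀ θ, 0 ≤ F θ) (θ : Torus) : 0 ≤ symDensity F θ := by
  have h1 := hF θ
  have h2 := hF (-θ)
  have h3 := hF (torusSwap θ)
  have h4 := hF (torusSwap (-θ))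
  unfold symDensity
  positivity

lemma measurePreserving_torusSwap_neg :
    MeasurePreserving (fun θ => torusSwap (-θ)) torusMeasure torusMeasure :=
  measurePreserving_torusSwap.comp measurePreserving_torusNeg

lemma integrable_symDensity {F : Torus → ℝ} (hF : Integrable F torusMeasure) :
    Integrable (symDensity F) torusMeasure :=
  (((hF.add (measurePreserving_torusNeg.integrable_comp_of_integrable hF)).add
    (measurePreserving_torusSwap.integrable_comp_of_integrable hF)).add
    (measurePreserving_torusSwap_neg.integrable_comp_of_integrable hF)).div_const 4

lemma integral_comp_mul_eq {τ : Torus → Torus} (hτ : MeasurePreserving τ torusMeasure torusMeasure)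
    {F g : Torus → ℝ} (hF : Integrable F torusMeasure) (hg : Continuous g) (hgτ : ∀ θ,
        g (τ θ) = g θ) :
    ∫ θ, F (τ θ) * g θ ∂torusMeasure = ∫ θ, F θ * g θ ∂torusMeasure := by
  have h : AEStronglyMeasurable (fun θ => F θ * g θ) (torusMeasure.map τ) := by
    rw [hτ.map_eq]
    exact hF.1.mul hg.aestronglyMeasurable
  have := integral_map hτ.measurable.aemeasurable h
  rw [hτ.map_eq] at this
  rw [this]
  simp_rw [hgτ]

lemma integral_symDensity_mul {F g : Torus → ℝ} (hF : Integrable F torusMeasure) (hg : Continuous g)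
    (h1 : ∀ θ, g (-θ) = g θ) (h2 : ∀ θ, g (torusSwap θ) = g θ) :
    ∫ θ, symDensity F θ * g θ ∂torusMeasure = ∫ θ, F θ * g θ ∂torusMeasure := by
  obtain ⟨C, hC⟩ := isCompact_univ.exists_bound_of_continuousOn hg.continuousOn
  have hi : ∀ {τ : Torus → Torus}, MeasurePreserving τ torusMeasure torusMeasure →
      Integrable (fun θ => F (τ θ) * g θ) torusMeasure := fun hτ =>
    (hτ.integrable_comp_of_integrable hF).mul_bdd (c := C) hg.aestronglyMeasurable
      (ae_of_all _ fun θ => hC θ trivial)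
  have i1 := hi (MeasurePreserving.id torusMeasure)
  have i2 := hi measurePreserving_torusNeg
  have i3 := hi measurePreserving_torusSwap
  have i4 := hi measurePreserving_torusSwap_neg
  have e : ∀ θ, symDensity F θ * g θ = 4⁻¹ * (F (id θ) * g θ + F (-θ) * g θ +
      F (torusSwap θ) * g θ +
      F (torusSwap (-θ)) * g θ) := fun θ => by
    rw [symDensity, id]
    ring
  have i12 : Integrable (fun θ => F (id θ) * g θ + F (-θ) * g θ) torusMeasure := i1.add i2
  have i123 : Integrable (fun θ => F (id θ) * g θ + F (-θ) * g θ + F (torusSwap θ) *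
      g θ) torusMeasure :=
    i12.add i3
  simp_rw [e]
  rw [integral_const_mul, integral_add i123 i4, integral_add i12 i3, integral_add i1 i2,
    integral_comp_mul_eq measurePreserving_torusNeg hF hg h1,
    integral_comp_mul_eq measurePreserving_torusSwap hF hg h2,
    integral_comp_mul_eq measurePreserving_torusSwap_neg hF hg fun θ => by rw [h2, h1]]
  simp only [id]
  ring

variable {f : ℝ → ℝ → ℝ}

lemma torusDensity_nonneg (hf : ∀ x ∈ Set.Icc (-π) π, ∀ y ∈ Set.Icc (-π) π, 0 ≤ f x y) (θ : Torus) :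
    0 ≤ torusDensity f θ :=
  mul_nonneg (sq_nonneg _) (hf _ (torusLift_mem θ).1 _ (torusLift_mem θ).2)

lemma integral_comp_torusLift {g : ℝ × ℝ → ℂ}
    (hg : IntegrableOn g (Set.Icc (-π) π ×ˢ Set.Icc (-π) π)) :
    Integrable (fun θ => g (torusLift θ)) torusMeasure ∧
    ∫ θ, g (torusLift θ) ∂torusMeasure = ((2 * π : ℂ)⁻¹ ^ 2) *
      ∫ x in (-π)..π, ∫ y in (-π)..π, g (x, y) := by
  have hp := Real.pi_pos
  have hi : Integrable g (ENNReal.ofReal ((2 * π)⁻¹ ^ 2) •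
      volume.restrict (Set.Icc (-π) π ×ˢ Set.Icc (-π) π)) :=
    Integrable.smul_measure hg ENNReal.ofReal_ne_top
  refine ⟨measurePreserving_torusLift.integrable_comp_of_integrable hi, ?_⟩
  have h1 : ∫ θ, g (torusLift θ) ∂torusMeasure = ∫ p, g p ∂(torusMeasure.map torusLift) := by
    refine (integral_map measurePreserving_torusLift.measurable.aemeasurable ?_).symm
    rw [measurePreserving_torusLift.map_eq]
    exact hi.1
  rw [h1, measurePreserving_torusLift.map_eq, integral_smul_measure,
    ENNReal.toReal_ofReal (by positivity), Measure.volume_eq_prod,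
    setIntegral_prod _ (by rwa [← Measure.volume_eq_prod]),
        intervalIntegral.integral_of_le (by linarith),
    integral_Icc_eq_integral_Ioc, Complex.real_smul]
  push_cast
  congr 1
  refine integral_congr_ae (ae_of_all _ fun x => ?_)
  simp only
  rw [intervalIntegral.integral_of_le (by linarith), integral_Icc_eq_integral_Ioc]

lemma integrable_torusDensity (hf : IntegrableOn (fun p : ℝ × ℝ => f p.1 p.2)
    (Set.Icc (-π) π ×ˢ Set.Icc (-π) π)) : Integrable (torusDensity f) torusMeasure := by
  have := (integral_comp_torusLift (g := fun p => (f p.1 p.2 : ℂ)) hf.ofReal).1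
  exact (this.re).const_mul _

lemma integral_torusChar_mul_torusDensity (hf : IntegrableOn (fun p : ℝ × ℝ => f p.1 p.2)
    (Set.Icc (-π) π ×ˢ Set.Icc (-π) π)) (u v : ℤ) :
    ∫ θ, torusChar (u, v) θ * torusDensity f θ ∂torusMeasure =
      ∫ x in (-π)..π, ∫ y in (-π)..π,
        Complex.exp (Complex.I * ((u : ℂ) * (x : ℂ) + (v : ℂ) * (y : ℂ))) * (f x y : ℂ) := by
  have hp : (π : ℂ) ≠ 0 := by exact_mod_cast Real.pi_pos.ne'
  have hi : IntegrableOn (fun p : ℝ × ℝ =>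
      Complex.exp (Complex.I * ((u : ℂ) * (p.1 : ℂ) + (v : ℂ) * (p.2 : ℂ))) * (f p.1 p.2 : ℂ))
      (Set.Icc (-π) π ×ˢ Set.Icc (-π) π) := by
    refine Integrable.bdd_mul (c := 1) hf.ofReal
      (by fun_prop : Continuous fun p : ℝ × ℝ =>
        Complex.exp (Complex.I * ((u : ℂ) * (p.1 : ℂ) + (v : ℂ) * (p.2 : ℂ)))).aestronglyMeasurable
      (ae_of_all _ fun p => le_of_eq ?_)
    have : Complex.I * ((u : ℂ) * (p.1 : ℂ) + (v : ℂ) * (p.2 : ℂ)) =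
        ((u * p.1 + v * p.2 : ℝ) : ℂ) * Complex.I := by
      push_cast
      ring
    rw [this, Complex.norm_exp_ofReal_mul_I]
  have h := (integral_comp_torusLift hi).2
  have e : ∀ θ, torusChar (u, v) θ * torusDensity f θ = (2 * π : ℂ) ^ 2 *
      (Complex.exp (Complex.I * ((u : ℂ) * ((torusLift θ).1 : ℂ) + (v : ℂ) *
          ((torusLift θ).2 : ℂ))) *
        (f (torusLift θ).1 (torusLift θ).2 : ℂ)) := fun θ => by
    rw [torusChar_torusLift, torusDensity]
    push_cast
    ring
  simp_rw [e]
  rw [integral_const_mul, h]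
  field_simp

lemma exists_le_symDensity (hf : ∀ x ∈ Set.Icc (-π) π, ∀ y ∈ Set.Icc (-π) π, 0 ≤ f x y)
    (hess : 0 < essInf (fun p : ℝ × ℝ => f p.1 p.2 + f p.2 p.1)
      (volume.restrict (Set.Icc (-π) π ×ˢ Set.Icc (-π) π))) :
    ∃ a : ℝ, 0 < a ∧ ∀ᵐ θ ∂torusMeasure, a ≤ symDensity (torusDensity f) θ := by
  set a := essInf (fun p : ℝ × ℝ => f p.1 p.2 + f p.2 p.1)
    (volume.restrict (Set.Icc (-π) π ×ˢ Set.Icc (-π) π)) with ha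
  have hm : MeasurableSet (Set.Icc (-π) π ×ˢ Set.Icc (-π) π) :=
      measurableSet_Icc.prod measurableSet_Icc
  have h1 : ∀ᵐ p ∂(volume.restrict (Set.Icc (-π) π ×ˢ Set.Icc (-π) π) : Measure (ℝ × ℝ)),
      a ≤ f p.1 p.2 + f p.2 p.1 := by
    refine ae_essInf_le ⟨0, ?_⟩
    rw [eventually_map]
    filter_upwards [ae_restrict_mem hm] with p hp
    exact add_nonneg (hf _ hp.1 _ hp.2) (hf _ hp.2 _ hp.1)
  have h2 : ∀ᵐ θ ∂torusMeasure, (2 * π) ^ 2 * a ≤ torusDensity f θ +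
      torusDensity f (torusSwap θ) := by
    have := measurePreserving_torusLift.quasiMeasurePreserving.ae (Measure.ae_smul_measure h1 _)
    filter_upwards [this] with θ hθ
    simp only [torusDensity, torusLift_swap, Prod.fst_swap, Prod.snd_swap]
    rw [← mul_add]
    gcongr
  refine ⟨(2 * π) ^ 2 * a / 4, by have := Real.pi_pos; positivity, ?_⟩
  filter_upwards [h2] with θ hθ
  have h3 := torusDensity_nonneg hf (-θ)
  have h4 := torusDensity_nonneg hf (torusSwap (-θ))
  unfold symDensity
  linarith

lemma norm_sum_symChar_neg {ι : Type*} [Fintype ι] (c : ι → ℝ) (q : ι → ℤ × ℤ) (θ : Torus) :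
    ‖∑ i, (c i : ℂ) * symChar (q i) (-θ)‖ = ‖∑ i, (c i : ℂ) * symChar (q i) θ‖ := by
  rw [← RCLike.norm_conj]
  simp only [map_sum, map_mul, Complex.conj_ofReal, symChar, map_add, conj_torusChar, torusChar_neg,
    neg_neg]

lemma symChar_swap (q : ℤ × ℤ) (θ : Torus) : symChar q (torusSwap θ) = symChar q θ := by
  rw [symChar, symChar, torusChar_swap, torusChar_swap, Prod.swap_swap, add_comm]

end Density

section SpectralRepresentation

open ProbabilityTheory Topology
open scoped Matrix

variable {Ω : Type*} [MeasurableSpace Ω] {P : Measure Ω}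
  {f : ℝ → ℝ → ℝ} {G : ℤ → ℤ → Ω → ℝ}

lemma memLp_of_map_eq_gaussianReal {X : Ω → ℝ} (hX : Measurable X) {v : NNReal}
    (h : P.map X = gaussianReal 0 v) : MemLp X 2 P := by
  have h1 : MemLp id 2 (P.map X) := h ▸ memLp_id_gaussianReal 2
  exact (memLp_map_measure_iff aestronglyMeasurable_id hX.aemeasurable).1 h1

lemma integral_sq_of_map_eq_gaussianReal {X : Ω → ℝ} (hX : Measurable X) {v : NNReal}
    (h : P.map X = gaussianReal 0 v) : ∫ ω, X ω ^ 2 ∂P = v := by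
  have h1 : ∫ ω, X ω ^ 2 ∂P = ∫ x, x ^ 2 ∂(P.map X) :=
    (integral_map hX.aemeasurable (by fun_prop : Continuous fun x : ℝ => x ^ 2).aestronglyMeasurable).symm
  have h2 := variance_fun_id_gaussianReal (μ := 0) (v := v)
  rw [variance_eq_integral (by fun_prop)] at h2
  rw [h1, h, ← h2]
  simp

lemma memLp_stationary (hGmeas : ∀ i j : ℤ, Measurable (G i j))
    (hGauss : ∀ (m : ℕ) (c : Fin m → ℝ) (idx : Fin m → ℤ × ℤ), ∃ v : NNReal,
      Measure.map (fun ω => ∑ p, c p * G (idx p).1 (idx p).2 ω) P = gaussianReal 0 v)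
    (i j : ℤ) : MemLp (G i j) 2 P := by
  obtain ⟨v, hv⟩ := hGauss 1 (fun _ => 1) (fun _ => (i, j))
  simp only [Finset.univ_unique, Finset.sum_const, Finset.card_singleton, one_mul, one_smul] at hv
  exact memLp_of_map_eq_gaussianReal (hGmeas i j) hv

variable (hf_nonneg : ∀ x ∈ Set.Icc (-π) π, ∀ y ∈ Set.Icc (-π) π, 0 ≤ f x y)
  (hf_int : IntegrableOn (fun p : ℝ × ℝ => f p.1 p.2) (Set.Icc (-π) π ×ˢ Set.Icc (-π) π))
  (hGmeas : ∀ i j : ℤ, Measurable (G i j))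
  (hGauss : ∀ (m : ℕ) (c : Fin m → ℝ) (idx : Fin m → ℤ × ℤ), ∃ v : NNReal,
    Measure.map (fun ω => ∑ p, c p * G (idx p).1 (idx p).2 ω) P = gaussianReal 0 v)
  (hcov : ∀ i j u v : ℤ,
    ((∫ ω, G i j ω * G (i + u) (j + v) ω ∂P : ℝ) : ℂ) =
      ∫ x in (-π)..π, ∫ y in (-π)..π,
        Complex.exp (Complex.I * ((u : ℂ) * (x : ℂ) + (v : ℂ) * (y : ℂ))) * (f x y : ℂ))

/-- The vector representing a variable of the process with the given spectral density. -/
noncomputable def spectralVec (f : ℝ → ℝ → ℝ) (q : ℤ × ℤ) (θ : Torus) : ℂ :=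
  (√(torusDensity f θ) : ℂ) * torusChar q θ

include hf_nonneg hf_int in
lemma memLp_spectralVec (q : ℤ × ℤ) : MemLp (spectralVec f q) 2 torusMeasure := by
  have hF := integrable_torusDensity hf_int
  have hm : AEStronglyMeasurable (spectralVec f q) torusMeasure :=
    (Complex.continuous_ofReal.comp_aestronglyMeasurable
      (Real.continuous_sqrt.comp_aestronglyMeasurable hF.1)).mul
      (continuous_torusChar q).aestronglyMeasurable
  refine (memLp_two_iff_integrable_sq_norm hm).2 (hF.congr (ae_of_all _ fun θ => ?_))
  simp only [spectralVec]
  rw [norm_mul, norm_torusChar, mul_one, Complex.norm_real,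
      Real.norm_of_nonneg (Real.sqrt_nonneg _),
    Real.sq_sqrt (torusDensity_nonneg hf_nonneg θ)]

include hf_nonneg hf_int hcov in
lemma integral_mul_eq_spectralVec (q q' : ℤ × ℤ) : ∫ ω, G q.1 q.2 ω * G q'.1 q'.2 ω ∂P =
    ∫ θ, (starRingEnd ℂ (spectralVec f q θ) * spectralVec f q' θ).re ∂torusMeasure := by
  have h := hcov q.1 q.2 (q'.1 - q.1) (q'.2 - q.2)
  rw [← integral_torusChar_mul_torusDensity hf_int, add_sub_cancel, add_sub_cancel] at h
  have hre := integral_re (integrable_conj_mul (memLp_spectralVec hf_nonneg hf_int q)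
    (memLp_spectralVec hf_nonneg hf_int q'))
  simp only [RCLike.re_eq_complex_re] at hre
  rw [hre, ← Complex.ofReal_re (∫ ω, G q.1 q.2 ω * G q'.1 q'.2 ω ∂P), h]
  congr 1
  refine integral_congr_ae (ae_of_all _ fun θ => ?_)
  simp only [spectralVec, map_mul, Complex.conj_ofReal, conj_torusChar]
  have e : ((√(torusDensity f θ) : ℝ) : ℂ) * (√(torusDensity f θ) : ℝ) = torusDensity f θ := by
    rw [← Complex.ofReal_mul, Real.mul_self_sqrt (torusDensity_nonneg hf_nonneg θ)]
  have e2 : torusChar (q'.1 - q.1, q'.2 - q.2) θ = torusChar (-q) θ * torusChar q' θ := by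
    rw [← torusChar_add]
    congr 1
    ext <;> simp <;> ring
  rw [e2, ← e]
  ring

include hf_nonneg hf_int hGmeas hGauss hcov in
lemma isGaussianFamily_stationary {ι : Type*} [Fintype ι] (idx : ι → ℤ × ℤ) :
    IsGaussianFamily P (fun i => G (idx i).1 (idx i).2) torusMeasure (fun i => spectralVec f (idx i)) := by
  intro c
  obtain ⟨v, hv⟩ := hGauss (Fintype.card ι) (fun m => c ((Fintype.equivFin ι).symm m))
    (fun m => idx ((Fintype.equivFin ι).symm m))
  have e : ∀ ω, ∑ m, c ((Fintype.equivFin ι).symm m) * G (idx ((Fintype.equivFin ι).symm m)).1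
      (idx ((Fintype.equivFin ι).symm m)).2 ω = ∑ i, c i * G (idx i).1 (idx i).2 ω := fun ω =>
    Equiv.sum_comp (Fintype.equivFin ι).symm fun i => c i * G (idx i).1 (idx i).2 ω
  simp_rw [e] at hv
  rw [hv]
  congr 1
  have hm : Measurable fun ω => ∑ i, c i * G (idx i).1 (idx i).2 ω :=
    Finset.measurable_sum _ fun i _ => (hGmeas _ _).const_mul _
  have h1 := integral_sq_of_map_eq_gaussianReal hm hv
  have hi : ∀ i j, Integrable (fun ω => c i * c j *
      (G (idx i).1 (idx i).2 ω * G (idx j).1 (idx j).2 ω)) P :=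
    fun i j => ((memLp_stationary hGmeas hGauss _ _).integrable_mul
      (memLp_stationary hGmeas hGauss _ _)).const_mul _
  have h2 : ∫ ω, (∑ i, c i * G (idx i).1 (idx i).2 ω) ^ 2 ∂P =
      ∑ i, ∑ j, c i * c j * ∫ ω, G (idx i).1 (idx i).2 ω * G (idx j).1 (idx j).2 ω ∂P := by
    have : ∀ ω, (∑ i, c i * G (idx i).1 (idx i).2 ω) ^ 2 =
        ∑ i, ∑ j, c i * c j * (G (idx i).1 (idx i).2 ω * G (idx j).1 (idx j).2 ω) := fun ω => by
      rw [sq, Finset.sum_mul_sum]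
      exact Finset.sum_congr rfl fun i _ => Finset.sum_congr rfl fun j _ => by ring
    simp_rw [this]
    rw [integral_finsetSum _ fun i _ => integrable_finsetSum _ fun j _ => hi i j]
    refine Finset.sum_congr rfl fun i _ => ?_
    rw [integral_finsetSum _ fun j _ => hi i j]
    exact Finset.sum_congr rfl fun j _ => integral_const_mul _ _
  have h3 : ∫ θ, ‖∑ i, (c i : ℂ) * spectralVec f (idx i) θ‖ ^ 2 ∂torusMeasure = v := by
    rw [← h1, h2, integral_norm_sq_sum fun i => memLp_spectralVec hf_nonneg hf_int _]
    simp only [dotProduct, Matrix.mulVec, Finset.mul_sum, gram, Matrix.of_apply]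
    refine Finset.sum_congr rfl fun i _ => Finset.sum_congr rfl fun j _ => ?_
    rw [integral_mul_eq_spectralVec hf_nonneg hf_int hcov]
    ring
  rw [h3, Real.toNNReal_coe]

include hf_nonneg hf_int hGmeas hGauss hcov in
lemma isGaussianFamily_symmetrized {ι : Type*} [Fintype ι] (idx : ι → ℤ × ℤ) :
    IsGaussianFamily P (fun i ω => G ((idx i).1 + 1) ((idx i).2 + 1) ω +
      G ((idx i).2 + 1) ((idx i).1 + 1) ω) torusMeasure
      (fun i θ => (√(symDensity (torusDensity f) θ) : ℂ) * symChar (idx i) θ) := by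
  intro c
  have h := isGaussianFamily_stationary hf_nonneg hf_int hGmeas hGauss hcov
    (Sum.elim (fun i => idx i + (1, 1)) (fun i => (idx i).swap + (1, 1))) (Sum.elim c c)
  simp only [Fintype.sum_sum_type, Sum.elim_inl, Sum.elim_inr, Prod.fst_add, Prod.snd_add,
    Prod.fst_swap, Prod.snd_swap, ← Finset.sum_add_distrib, ← mul_add] at h
  rw [h]
  congr 2
  have e1 : ∀ θ, ‖∑ i, (c i : ℂ) * (spectralVec f (idx i + (1, 1)) θ +
      spectralVec f ((idx i).swap + (1, 1)) θ)‖ ^ 2 =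
      torusDensity f θ * ‖∑ i, (c i : ℂ) * symChar (idx i) θ‖ ^ 2 := fun θ => by
    have : ∑ i, (c i : ℂ) * (spectralVec f (idx i + (1, 1)) θ +
        spectralVec f ((idx i).swap + (1, 1)) θ) =
        (√(torusDensity f θ) : ℂ) * torusChar (1, 1) θ * ∑ i, (c i : ℂ) * symChar (idx i) θ := by
      rw [Finset.mul_sum]
      refine Finset.sum_congr rfl fun i _ => ?_
      simp only [spectralVec, symChar, torusChar_add]
      ring
    rw [this, norm_mul, norm_mul, norm_torusChar, mul_one, Complex.norm_real,
      Real.norm_of_nonneg (Real.sqrt_nonneg _), mul_pow,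
          Real.sq_sqrt (torusDensity_nonneg hf_nonneg θ)]
  have e2 : ∀ θ, ‖∑ i, (c i : ℂ) * ((√(symDensity (torusDensity f) θ) : ℂ) *
      symChar (idx i) θ)‖ ^ 2 =
      symDensity (torusDensity f) θ * ‖∑ i, (c i : ℂ) * symChar (idx i) θ‖ ^ 2 := fun θ => by
    have : ∑ i, (c i : ℂ) * ((√(symDensity (torusDensity f) θ) : ℂ) * symChar (idx i) θ) =
        (√(symDensity (torusDensity f) θ) : ℂ) * ∑ i, (c i : ℂ) * symChar (idx i) θ := by
      rw [Finset.mul_sum]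
      exact Finset.sum_congr rfl fun i _ => by ring
    rw [this, norm_mul, Complex.norm_real, Real.norm_of_nonneg (Real.sqrt_nonneg _), mul_pow,
      Real.sq_sqrt (symDensity_nonneg (torusDensity_nonneg hf_nonneg) θ)]
  simp_rw [e1, e2]
  refine (integral_symDensity_mul (integrable_torusDensity hf_int) (by fun_prop) (fun θ => ?_)
    fun θ => ?_).symm
  · rw [norm_sum_symChar_neg]
  · simp_rw [symChar_swap]

include hf_nonneg hf_int hcov in
lemma integral_sq_stationary (i j : ℤ) :
    ∫ ω, G i j ω ^ 2 ∂P = ∫ θ, torusDensity f θ ∂torusMeasure := by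
  have h := integral_mul_eq_spectralVec hf_nonneg hf_int hcov (i, j) (i, j)
  simp only [← sq] at h
  rw [h]
  refine integral_congr_ae (ae_of_all _ fun θ => ?_)
  simp only
  rw [← Complex.normSq_eq_conj_mul_self, Complex.ofReal_re, Complex.normSq_eq_norm_sq, spectralVec,
    norm_mul, norm_torusChar, mul_one, Complex.norm_real, Real.norm_of_nonneg (Real.sqrt_nonneg _),
    Real.sq_sqrt (torusDensity_nonneg hf_nonneg θ)]

end SpectralRepresentation

section MomentBound

open ProbabilityTheory

variable {Ω : Type*} [MeasurableSpace Ω] {P : Measure Ω}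
  {f : ℝ → ℝ → ℝ} {G : ℤ → ℤ → Ω → ℝ}

/-- The symmetrized process normalized as a random matrix. -/
noncomputable def processMat (G : ℤ → ℤ → Ω → ℝ) (N : ℕ) (ω : Ω) : Matrix (Fin N) (Fin N) ℝ :=
  Matrix.of fun i j : Fin N => (G (((i : ℕ) : ℤ) + 1) (((j : ℕ) : ℤ) + 1) ω
    + G (((j : ℕ) : ℤ) + 1) (((i : ℕ) : ℤ) + 1) ω) / Real.sqrt N

omit [MeasurableSpace Ω] in
lemma isHermitian_processMat (N : ℕ) (ω : Ω) : (processMat G N ω).IsHermitian := by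
  ext i j
  simp [processMat, add_comm]

lemma measurable_processMat (hGmeas : ∀ i j : ℤ, Measurable (G i j)) (N : ℕ) (i j : Fin N) :
    Measurable fun ω => processMat G N ω i j :=
  ((hGmeas _ _).add (hGmeas _ _)).div_const _

lemma integrable_processMat_sq (hG : ∀ i j, MemLp (G i j) 2 P) (N : ℕ) (i j : Fin N) :
    Integrable (fun ω => processMat G N ω i j ^ 2) P := by
  have h := (((hG (((i : ℕ) : ℤ) + 1) (((j : ℕ) : ℤ) + 1)).add
    (hG (((j : ℕ) : ℤ) + 1) (((i : ℕ) : ℤ) + 1))).mul_const (Real.sqrt N)⁻¹).integrable_sq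
  simpa only [processMat, Matrix.of_apply, div_eq_mul_inv, Pi.add_apply] using h

lemma integral_processMat_sq_le (hG : ∀ i j, MemLp (G i j) 2 P) {V : ℝ}
    (hV : ∀ i j, ∫ ω, G i j ω ^ 2 ∂P = V) (N : ℕ) (i j : Fin N) :
    ∫ ω, processMat G N ω i j ^ 2 ∂P ≤ 4 * V * (N : ℝ)⁻¹ := by
  set a : ℤ := ((i : ℕ) : ℤ) + 1 with ha
  set b : ℤ := ((j : ℕ) : ℤ) + 1 with hb
  have h1 : ∀ ω, processMat G N ω i j ^ 2 ≤ (N : ℝ)⁻¹ * (2 * G a b ω ^ 2 + 2 * G b a ω ^ 2) := by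
    intro ω
    simp only [processMat, Matrix.of_apply]
    rw [div_pow, Real.sq_sqrt (Nat.cast_nonneg N), div_eq_inv_mul]
    gcongr
    nlinarith [sq_nonneg (G a b ω - G b a ω)]
  have i1 := (hG a b).integrable_sq.const_mul 2
  have i2 := (hG b a).integrable_sq.const_mul 2
  calc ∫ ω, processMat G N ω i j ^ 2 ∂P
      ≤ ∫ ω, (N : ℝ)⁻¹ * (2 * G a b ω ^ 2 + 2 * G b a ω ^ 2) ∂P :=
        integral_mono (integrable_processMat_sq hG N i j) ((i1.add i2).const_mul _) h1
    _ = 4 * V * (N : ℝ)⁻¹ := by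
        rw [integral_const_mul, integral_add i1 i2, integral_const_mul, integral_const_mul, hV, hV]
        ring

lemma integrable_processMat_sum_sq (hG : ∀ i j, MemLp (G i j) 2 P) (N : ℕ) :
    Integrable (fun ω => (N : ℝ)⁻¹ * ∑ i, ∑ j, processMat G N ω i j ^ 2) P :=
  (integrable_finsetSum _ fun i _ => integrable_finsetSum _ fun j _ =>
    integrable_processMat_sq hG N i j).const_mul _

lemma integral_processMat_sum_sq_le (hG : ∀ i j, MemLp (G i j) 2 P) {V : ℝ}
    (hV : ∀ i j, ∫ ω, G i j ω ^ 2 ∂P = V) (N : ℕ) :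
    ∫ ω, (N : ℝ)⁻¹ * ∑ i, ∑ j, processMat G N ω i j ^ 2 ∂P ≤ 4 * V := by
  have hV0 : 0 ≤ V := hV 0 0 ▸ integral_nonneg fun ω => sq_nonneg _
  rw [integral_const_mul, integral_finsetSum _ fun i _ => integrable_finsetSum _ fun j _ =>
    integrable_processMat_sq hG N i j]
  simp_rw [integral_finsetSum _ fun j _ => integrable_processMat_sq hG N _ j]
  calc (N : ℝ)⁻¹ * ∑ i : Fin N, ∑ j : Fin N, ∫ ω, processMat G N ω i j ^ 2 ∂P
      ≤ (N : ℝ)⁻¹ * ∑ _i : Fin N, ∑ _j : Fin N, 4 * V * (N : ℝ)⁻¹ := by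
        gcongr with i _ j _
        exact integral_processMat_sq_le hG hV N i j
    _ ≤ 4 * V := by
        rcases eq_or_ne N 0 with rfl | hN
        · simpa using hV0
        · have hN' : (N : ℝ) ≠ 0 := Nat.cast_ne_zero.2 hN
          simp only [Finset.sum_const, Finset.card_univ, Fintype.card_fin, nsmul_eq_mul]
          field_simp
          rfl

omit [MeasurableSpace Ω] in
lemma symMat_process (n : ℕ) (ω : Ω) :
    symMat (Z := ZMod (n + 1)) (fun k => G ((valPair k).1 + 1) ((valPair k).2 + 1) ω +
      G ((valPair k).2 + 1) ((valPair k).1 + 1) ω) = processMat G (n + 1) ω := by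
  rw [symMat_eq fun k => add_comm _ _]
  ext i j
  rw [Matrix.smul_apply, ZMod.card, smul_eq_mul]
  exact (div_eq_inv_mul _ _).symm

omit [MeasurableSpace Ω] in
lemma traceDev_process (z M : ℂ) (n : ℕ) (ω : Ω) :
    traceDev (Z := ZMod (n + 1)) z M (fun k => G ((valPair k).1 + 1) ((valPair k).2 + 1) ω +
      G ((valPair k).2 + 1) ((valPair k).1 + 1) ω) =
    ‖((n + 1 : ℕ) : ℂ)⁻¹ * (matResolvent (processMat G (n + 1) ω) z).trace - M‖ := by
  rw [traceDev, symMat_process, ZMod.card]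
  rfl

end MomentBound

/-- Let `f` be a nonnegative, even, integrable function on `[-π,π]²` whose
symmetrization `f(x,y) + f(y,x)` has strictly positive essential infimum, let
`(G_{i,j} : i,j ∈ ℤ)` be a centered stationary Gaussian process with spectral density `f`,
and let `Ḡ_N(i,j) = (G_{i,j} + G_{j,i})/√N`, `1 ≤ i,j ≤ N`. Then there is a probability
measure `ν ≪ Leb` such that `ESD(Ḡ_N) → ν` weakly in probability: for every bounded
continuous `φ : ℝ → ℝ`, `∫ φ d(ESD(Ḡ_N)) → ∫ φ dν` in probability. -/
theorem stmt_0
    {Ω : Type*} [MeasurableSpace Ω] (P : Measure Ω) [IsProbabilityMeasure P]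
    (f : ℝ → ℝ → ℝ)
    (hf_nonneg : ∀ x ∈ Set.Icc (-π) π, ∀ y ∈ Set.Icc (-π) π, 0 ≤ f x y)
    (hf_even : ∀ x ∈ Set.Icc (-π) π, ∀ y ∈ Set.Icc (-π) π, f (-x) (-y) = f x y)
    (hf_int : IntegrableOn (fun p : ℝ × ℝ => f p.1 p.2)
      (Set.Icc (-π) π ×ˢ Set.Icc (-π) π))
    (hess : 0 < essInf (fun p : ℝ × ℝ => f p.1 p.2 + f p.2 p.1)
      (volume.restrict (Set.Icc (-π) π ×ˢ Set.Icc (-π) π)))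
    (G : ℤ → ℤ → Ω → ℝ)
    (hGmeas : ∀ i j : ℤ, Measurable (G i j))
    (hGauss : ∀ (m : ℕ) (c : Fin m → ℝ) (idx : Fin m → ℤ × ℤ), ∃ v : NNReal,
      Measure.map (fun ω => ∑ p, c p * G (idx p).1 (idx p).2 ω) P =
        ProbabilityTheory.gaussianReal 0 v)
    (hcov : ∀ i j u v : ℤ,
      ((∫ ω, G i j ω * G (i + u) (j + v) ω ∂P : ℝ) : ℂ) =
        ∫ x in (-π)..π, ∫ y in (-π)..π,
          Complex.exp (Complex.I * ((u : ℂ) * (x : ℂ) + (v : ℂ) * (y : ℂ)))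
            * (f x y : ℂ)) :
    ∃ ν : Measure ℝ, IsProbabilityMeasure ν ∧ ν ≪ volume ∧
      ∀ φ : BoundedContinuousFunction ℝ ℝ,
        TendstoInMeasure P
          (fun N ω => ∫ x, φ x ∂(ESD (Matrix.of fun i j : Fin N =>
            (G (((i : ℕ) : ℤ) + 1) (((j : ℕ) : ℤ) + 1) ω
              + G (((j : ℕ) : ℤ) + 1) (((i : ℕ) : ℤ) + 1) ω) / Real.sqrt N)))
          atTop (fun _ => ∫ x, φ x ∂ν) := by
  have hF0 := torusDensity_nonneg hf_nonneg
  have hS := integrable_symDensity (integrable_torusDensity hf_int)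
  obtain ⟨a, ha, hae⟩ := exists_le_symDensity hf_nonneg hess
  have hh : MemLp (fun θ => √(symDensity (torusDensity f) θ)) 2 torusMeasure := by
    refine (memLp_two_iff_integrable_sq (Real.continuous_sqrt.comp_aestronglyMeasurable hS.1)).2
      (hS.congr (ae_of_all _ fun θ => ?_))
    exact (Real.sq_sqrt (symDensity_nonneg hF0 θ)).symm
  have hlim : ∀ z : ℂ, 0 < z.im → ∃ M : ℂ, ‖M‖ ≤ √(√a ^ 2 / 2)⁻¹ ∧ Tendsto (fun N : ℕ =>
      ∫ ω, ‖(N : ℂ)⁻¹ * (matResolvent (processMat G N ω) z).trace - M‖ ∂P) atTop (nhds 0) := by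
    intro z hz
    obtain ⟨M, hM1, hM2⟩ := exists_tendsto_integral_traceDev (P := P) hh
      (fun θ => by simp only [symDensity_neg]) (Real.sqrt_pos.2 ha)
      (hae.mono fun θ hθ => Real.sqrt_le_sqrt hθ)
      (W := fun n k ω => G ((valPair k).1 + 1) ((valPair k).2 + 1) ω +
        G ((valPair k).2 + 1) ((valPair k).1 + 1) ω)
      (fun n k => (hGmeas _ _).add (hGmeas _ _))
      (fun n => isGaussianFamily_symmetrized hf_nonneg hf_int hGmeas hGauss hcov valPair) hz
    refine ⟨M, hM1, (tendsto_add_atTop_iff_nat 1).1 ?_⟩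
    simpa only [traceDev_process] using hM2
  choose! M hM1 hM2 using hlim
  have hG := memLp_stationary hGmeas hGauss
  exact exists_limit_ESD isHermitian_processMat (measurable_processMat hGmeas)
    (integrable_processMat_sum_sq hG)
    (integral_processMat_sum_sq_le hG (integral_sq_stationary hf_nonneg hf_int hcov)) hM1 hM2
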